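/- arXiv:2405.11923 — 12 statements merged into one kernel-verified Lean document; each statement's English description precedes it below -/
import Mathlib

section
/- Upper bound of Theorem 1 (achievability by the CoverSelect mechanism). Let (Θ, ρ) be a nonempty bounded metric space endowed with its Borel σ-algebra, let Φ : [0,∞) → [0,∞) be nondecreasing, let α > 0 and let n ≥ 1 be an integer. Suppose Δ > 0 and θ_1, …, θ_N ∈ Θ form a Δ-cover of Θ, i.e. for every θ ∈ Θ there exists j ∈ {1,…,N} with ρ(θ, θ_j) ≤ Δ. Then there exist a Markov kernel Q from Θ to the finite space {0,1}^N that is α-LDP on all of Θ, and a function θ̂ : ({0,1}^N)^n → Θ, such that for every θ ∈ Θ, ∫ Φ(ρ(θ̂(z), θ)) d(Q(θ)^{⊗n})(z) ≤ Φ(Δ) + Φ(diam Θ) · N · exp(−n·min{α, α²}/20), where Q(θ)^{⊗n} denotes the n-fold product of the measure Q(θ) and diam Θ is the diameter of Θ. -/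
open MeasureTheory Real
open scoped ENNReal

/-- A mechanism, given as a (measurable) family of probability measures, is `α`-LDP on `D`. -/
def IsLDPOn {X Z : Type*} [MeasurableSpace X] [MeasurableSpace Z]
    (Q : X → Measure Z) (α : ℝ) (D : Set X) : Prop :=
  ∀ S : Set Z, MeasurableSet S → ∀ x ∈ D, ∀ x' ∈ D,
    Q x S ≤ ENNReal.ofReal (Real.exp α) * Q x' S

/-- On a finite product of finite discrete spaces, the integral of a product of functions of
the coordinates is the product of the integrals. -/
lemma lintegral_pi_prod_of_fintype {ι β : Type*} [Fintype ι] [Fintype β]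
    [MeasurableSpace β] [MeasurableSingletonClass β] (μ : ι → Measure β)
    [∀ i, SigmaFinite (μ i)] (f : ι → β → ℝ≥0∞) :
    ∫⁻ x, ∏ i, f i (x i) ∂(Measure.pi μ) = ∏ i, ∫⁻ b, f i b ∂(μ i) := by
  classical
  simp_rw [lintegral_fintype, Measure.pi_singleton, ← Finset.prod_mul_distrib]
  rw [Finset.prod_univ_sum, Fintype.piFinset_univ]

/-- The law of a binary randomized response, with odds `r : 1` of reporting the true bit `b`. -/
noncomputable def bitResponse (r : ℝ) (b : Bool) : Measure Bool :=
  ENNReal.ofReal (r / (1 + r)) • Measure.dirac b + ENNReal.ofReal (1 / (1 + r)) • Measure.dirac (!b)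

lemma bitResponse_singleton (r : ℝ) (b c : Bool) :
    bitResponse r b {c} = ENNReal.ofReal ((if b = c then r else 1) / (1 + r)) := by
  cases b <;> cases c <;> simp [bitResponse]

lemma isProbabilityMeasure_bitResponse {r : ℝ} (hr : 0 < r) (b : Bool) :
    IsProbabilityMeasure (bitResponse r b) := by
  constructor
  simp only [bitResponse, Measure.add_apply, Measure.smul_apply, measure_univ, smul_eq_mul,
    mul_one]
  rw [← ENNReal.ofReal_add (by positivity) (by positivity), ← add_div, add_comm r,
    div_self (by positivity), ENNReal.ofReal_one]

lemma lintegral_bitResponse {r : ℝ} (hr : 0 < r) (b : Bool) {f : Bool → ℝ} (hf : ∀ c, 0 ≤ f c) :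
    ∫⁻ c, ENNReal.ofReal (f c) ∂(bitResponse r b)
      = ENNReal.ofReal ((r * f b + f (!b)) / (1 + r)) := by
  have h1 := hf true
  have h2 := hf false
  rw [lintegral_fintype, Fintype.sum_bool]
  simp only [bitResponse_singleton]
  cases b <;>
  · simp only [reduceCtorEq, if_true, if_false, Bool.not_true, Bool.not_false]
    rw [← ENNReal.ofReal_mul (by positivity), ← ENNReal.ofReal_mul (by positivity),
      ← ENNReal.ofReal_add (by positivity) (by positivity)]
    congr 1
    ring

/-- The law of the randomized response applied coordinatewise to the one-hot encoding of `j`. -/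
noncomputable def oneHotResponse {N : ℕ} (r : ℝ) (j : Fin N) : Measure (Fin N → Bool) :=
  Measure.pi fun l => bitResponse r (decide (l = j))

lemma isProbabilityMeasure_oneHotResponse {N : ℕ} {r : ℝ} (hr : 0 < r) (j : Fin N) :
    IsProbabilityMeasure (oneHotResponse r j) := by
  have := isProbabilityMeasure_bitResponse hr
  unfold oneHotResponse
  infer_instance

lemma oneHotResponse_singleton_le {N : ℕ} {r : ℝ} (hr : 1 ≤ r) (j k : Fin N) (w : Fin N → Bool) :
    oneHotResponse r j {w} ≤ ENNReal.ofReal (r ^ 2) * oneHotResponse r k {w} := by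
  have := isProbabilityMeasure_bitResponse (zero_lt_one.trans_le hr)
  have hr0 : 0 < 1 + r := by linarith
  simp only [oneHotResponse, Measure.pi_singleton, bitResponse_singleton]
  have hsq : ENNReal.ofReal (r ^ 2)
      = ∏ l : Fin N, ENNReal.ofReal ((if l = j then r else 1) * (if l = k then r else 1)) := by
    rw [← ENNReal.ofReal_prod_of_nonneg (by intro l _; split_ifs <;> nlinarith),
      Finset.prod_mul_distrib]
    simp [sq]
  rw [hsq, ← Finset.prod_mul_distrib]
  refine Finset.prod_le_prod' fun l _ => ?_
  rw [← ENNReal.ofReal_mul (by split_ifs <;> nlinarith), ← mul_div_assoc]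
  refine ENNReal.ofReal_le_ofReal (div_le_div_of_nonneg_right ?_ hr0.le)
  by_cases h1 : l = j <;> by_cases h2 : l = k <;> cases w l <;> simp [h1, h2] <;>
    (try split_ifs) <;> nlinarith

lemma oneHotResponse_le {N : ℕ} {r : ℝ} (hr : 1 ≤ r) (j k : Fin N) (S : Set (Fin N → Bool)) :
    oneHotResponse r j S ≤ ENNReal.ofReal (r ^ 2) * oneHotResponse r k S := by
  classical
  rw [← Set.coe_toFinset S, ← sum_measure_singleton, ← sum_measure_singleton, Finset.mul_sum]
  exact Finset.sum_le_sum fun w _ => oneHotResponse_singleton_le hr j k w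

/-- The exponential tilt `r ^ (w k - w j)` of a binary vector `w`. -/
noncomputable def tilt {N : ℕ} (r : ℝ) (j k : Fin N) (w : Fin N → Bool) : ℝ :=
  (if w k then r else 1) * (if w j then r⁻¹ else 1)

lemma tilt_nonneg {N : ℕ} {r : ℝ} (hr : 0 < r) (j k : Fin N) (w : Fin N → Bool) :
    0 ≤ tilt r j k w := by
  unfold tilt
  positivity

lemma lintegral_tilt {N : ℕ} {r : ℝ} (hr : 0 < r) {j k : Fin N} (hjk : k ≠ j) :
    ∫⁻ w, ENNReal.ofReal (tilt r j k w) ∂(oneHotResponse r j)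
      = ENNReal.ofReal (4 * r / (1 + r) ^ 2) := by
  have := isProbabilityMeasure_bitResponse hr
  let φ : Fin N → Bool → ℝ := fun l b =>
    (if l = k then (if b then r else 1) else 1) * (if l = j then (if b then r⁻¹ else 1) else 1)
  have hφ : ∀ l b, 0 ≤ φ l b := by
    intro l b
    simp only [φ]
    positivity
  have htilt : ∀ w : Fin N → Bool,
      ENNReal.ofReal (tilt r j k w) = ∏ l, ENNReal.ofReal (φ l (w l)) := by
    intro w
    rw [← ENNReal.ofReal_prod_of_nonneg fun l _ => hφ l (w l)]
    simp only [φ, Finset.prod_mul_distrib, Finset.prod_ite_eq', Finset.mem_univ, if_true, tilt]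
  simp_rw [htilt]
  rw [oneHotResponse, lintegral_pi_prod_of_fintype _ fun l b => ENNReal.ofReal (φ l b)]
  have hfactor : ∀ l : Fin N, ∫⁻ b, ENNReal.ofReal (φ l b) ∂(bitResponse r (decide (l = j)))
      = ENNReal.ofReal ((if l = k then 2 * r / (1 + r) else 1)
          * (if l = j then 2 / (1 + r) else 1)) := by
    intro l
    rw [lintegral_bitResponse hr _ (hφ l)]
    congr 1
    by_cases h1 : l = k
    · have h2 : l ≠ j := h1 ▸ hjk
      simp only [φ, h1, hjk, decide_false, if_true, if_false, Bool.not_false, reduceCtorEq]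
      ring
    · by_cases h2 : l = j
      · simp only [φ, h2, hjk.symm, decide_true, if_true, if_false, Bool.not_true, reduceCtorEq]
        field_simp
        ring
      · simp only [φ, h1, h2, if_false]
        field_simp
        ring
  simp_rw [hfactor]
  rw [← ENNReal.ofReal_prod_of_nonneg (by intro l _; positivity), Finset.prod_mul_distrib]
  congr 1
  simp only [Finset.prod_ite_eq', Finset.mem_univ, if_true]
  field_simp
  ring

/-- The number of reports that vote for the index `k`. -/
def voteCount {n N : ℕ} (z : Fin n → Fin N → Bool) (k : Fin N) : ℕ :=
  ∑ i, if z i k then 1 else 0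

lemma one_le_prod_tilt {n N : ℕ} {r : ℝ} (hr : 1 ≤ r) {j k : Fin N} {z : Fin n → Fin N → Bool}
    (h : voteCount z j ≤ voteCount z k) : 1 ≤ ∏ i, tilt r j k (z i) := by
  have hr0 : 0 < r := zero_lt_one.trans_le hr
  have key : ∀ (x : ℝ) (l : Fin N), (∏ i, if z i l then x else 1) = x ^ voteCount z l := by
    intro x l
    rw [voteCount, ← Finset.prod_pow_eq_pow_sum]
    exact Finset.prod_congr rfl fun i _ => by split_ifs <;> simp
  simp only [tilt, Finset.prod_mul_distrib, key]
  rw [inv_pow, ← div_eq_mul_inv, one_le_div (by positivity)]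
  exact pow_le_pow_right₀ hr h

lemma lintegral_prod_tilt {n N : ℕ} {r : ℝ} (hr : 0 < r) {j k : Fin N} (hjk : k ≠ j) :
    ∫⁻ z, ENNReal.ofReal (∏ i, tilt r j k (z i)) ∂(Measure.pi fun _ : Fin n => oneHotResponse r j)
      = ENNReal.ofReal (4 * r / (1 + r) ^ 2) ^ n := by
  have := isProbabilityMeasure_oneHotResponse hr j
  simp_rw [ENNReal.ofReal_prod_of_nonneg fun i _ => tilt_nonneg hr j k _]
  rw [lintegral_pi_prod_of_fintype _ fun _ w => ENNReal.ofReal (tilt r j k w)]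
  simp [lintegral_tilt hr hjk]

lemma four_mul_pow_eleven_le {u : ℝ} (hu : 1.05 ≤ u) : 4 * u ^ 11 ≤ (u ^ 10 + 1) ^ 2 := by
  obtain ⟨t, ht, rfl⟩ : ∃ t : ℝ, 0 ≤ t ∧ u = 1.05 + t := ⟨u - 1.05, by linarith, by ring⟩
  rw [← sub_nonneg]
  ring_nf
  positivity

/-- The Chernoff factor of the randomized response with odds `exp (α / 2)`. -/
lemma four_mul_exp_div_le {α : ℝ} (hα : 0 < α) :
    4 * exp (α / 2) / (1 + exp (α / 2)) ^ 2 ≤ exp (-(min α (α ^ 2)) / 20) := by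
  have hsplit : -(min α (α ^ 2)) / 20 = -(min α (α ^ 2) / 20) := by ring
  rw [hsplit, exp_neg, div_le_iff₀ (by positivity), inv_mul_eq_div, le_div_iff₀ (exp_pos _)]
  rcases le_total α 1 with h | h
  · rw [min_eq_right (by nlinarith)]
    have hexp : exp (α ^ 2 / 20) * (1 - α ^ 2 / 20) ≤ 1 := by
      have h1 := add_one_le_exp (-(α ^ 2 / 20))
      calc exp (α ^ 2 / 20) * (1 - α ^ 2 / 20)
          ≤ exp (α ^ 2 / 20) * exp (-(α ^ 2 / 20)) := by gcongr; linarith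
        _ = 1 := by rw [← exp_add]; simp
    have hle : exp (α ^ 2 / 20) ≤ 1 + α ^ 2 / 16 := by
      have hmul : 1 ≤ (1 + α ^ 2 / 16) * (1 - α ^ 2 / 20) := by
        have hsq : α ^ 2 ≤ 1 := by nlinarith
        nlinarith [mul_nonneg (sq_nonneg α) (sub_nonneg.mpr hsq)]
      have hpos : 0 < 1 - α ^ 2 / 20 := by nlinarith
      exact le_of_mul_le_mul_right (hexp.trans hmul) hpos
    have hcosh : 1 + (α / 4) ^ 2 ≤ cosh (α / 4) ^ 2 := by
      rw [cosh_sq']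
      have := self_le_sinh_iff.mpr (show 0 ≤ α / 4 by positivity)
      gcongr
    have hid : (1 + exp (α / 2)) ^ 2 = 4 * exp (α / 2) * cosh (α / 4) ^ 2 := by
      have hx : exp (α / 2) = exp (α / 4) ^ 2 := by rw [← exp_nat_mul]; congr 1; push_cast; ring
      rw [cosh_eq, exp_neg, hx]
      field_simp
      ring
    rw [hid]
    gcongr
    linarith
  · rw [min_eq_left (by nlinarith)]
    have hu : 1.05 ≤ exp (α / 20) := by linarith [add_one_le_exp (α / 20)]
    have hx : exp (α / 2) = exp (α / 20) ^ 10 := by rw [← exp_nat_mul]; congr 1; push_cast; ring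
    rw [hx]
    linarith [four_mul_pow_eleven_le hu]

/-- A finite cover by closed balls admits a measurable choice of a ball containing each point. -/
lemma exists_measurable_cover_index {Θ : Type*} [PseudoMetricSpace Θ] [MeasurableSpace Θ]
    [OpensMeasurableSpace Θ] {Δ : ℝ} {N : ℕ} {θs : Fin N → Θ}
    (hcover : ∀ θ : Θ, ∃ j : Fin N, dist θ (θs j) ≤ Δ) :
    ∃ idx : Θ → Fin N, Measurable idx ∧ ∀ θ, dist θ (θs (idx θ)) ≤ Δ := by
  classical
  have hex : ∀ θ : Θ, ∃ m : ℕ, ∃ h : m < N, dist θ (θs ⟨m, h⟩) ≤ Δ := fun θ =>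
    let ⟨j, hj⟩ := hcover θ
    ⟨j, j.2, hj⟩
  have hmeas : Measurable fun θ => Nat.find (hex θ) := by
    refine measurable_find hex fun m => ?_
    by_cases h : m < N
    · simp only [h, exists_true_left]
      exact (Metric.isClosed_closedBall (x := θs ⟨m, h⟩) (ε := Δ)).measurableSet
    · simp [h]
  refine ⟨fun θ => ⟨Nat.find (hex θ), (Nat.find_spec (hex θ)).1⟩, ?_,
    fun θ => (Nat.find_spec (hex θ)).2⟩
  refine measurable_to_countable' fun k => ?_
  convert hmeas (measurableSet_singleton (k : ℕ)) using 1
  ext θ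
  simp [Fin.ext_iff]

/-- Upper bound of Theorem 1: achievability by the `CoverSelect` mechanism. -/
theorem coverSelect_upper_bound
    {Θ : Type*} [MetricSpace Θ] [MeasurableSpace Θ] [BorelSpace Θ] [Nonempty Θ]
    (hΘ : Bornology.IsBounded (Set.univ : Set Θ))
    (Φ : ℝ → ℝ) (hΦmono : MonotoneOn Φ (Set.Ici 0)) (hΦnonneg : ∀ x : ℝ, 0 ≤ x → 0 ≤ Φ x)
    (α : ℝ) (hα : 0 < α) (n : ℕ) (hn : 1 ≤ n)
    (Δ : ℝ) (hΔ : 0 < Δ) (N : ℕ) (θs : Fin N → Θ)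
    (hcover : ∀ θ : Θ, ∃ j : Fin N, dist θ (θs j) ≤ Δ) :
    ∃ (Q : Θ → Measure (Fin N → Bool)) (θhat : (Fin n → Fin N → Bool) → Θ),
      Measurable Q ∧ (∀ θ, IsProbabilityMeasure (Q θ)) ∧ IsLDPOn Q α Set.univ ∧
      ∀ θ : Θ,
        (∫⁻ z, ENNReal.ofReal (Φ (dist (θhat z) θ)) ∂(Measure.pi fun _ : Fin n => Q θ))
          ≤ ENNReal.ofReal (Φ Δ)
            + ENNReal.ofReal (Φ (Metric.diam (Set.univ : Set Θ))) * (N : ℝ≥0∞)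
              * ENNReal.ofReal (Real.exp (-((n : ℝ) * min α (α ^ 2)) / 20)) := by
  classical
  obtain ⟨idx, hidx, hdist⟩ := exists_measurable_cover_index hcover
  have : Nonempty (Fin N) := ⟨idx (Classical.arbitrary Θ)⟩
  have hr0 : 0 < exp (α / 2) := exp_pos _
  have hr1 : 1 ≤ exp (α / 2) := one_le_exp (by positivity)
  choose sel hsel using fun z : Fin n → Fin N → Bool => Finite.exists_max (voteCount z)
  refine ⟨fun θ => oneHotResponse (exp (α / 2)) (idx θ), fun z => θs (sel z),
    (Measurable.of_discrete (f := oneHotResponse (exp (α / 2)))).comp hidx, fun θ => isProbabilityMeasure_oneHotResponse hr0 _, ?_, ?_⟩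
  · intro S _ θ _ θ' _
    have hsq : exp α = exp (α / 2) ^ 2 := by rw [← exp_nat_mul]; congr 1; push_cast; ring
    rw [hsq]
    exact oneHotResponse_le hr1 _ _ S
  intro θ
  set j := idx θ with hj
  have := isProbabilityMeasure_oneHotResponse hr0 j
  set D := ENNReal.ofReal (Φ (Metric.diam (Set.univ : Set Θ)))
  have hpoint : ∀ z : Fin n → Fin N → Bool, ENNReal.ofReal (Φ (dist (θs (sel z)) θ))
      ≤ ENNReal.ofReal (Φ Δ) + D * ∑ k ∈ Finset.univ.erase j,
          ENNReal.ofReal (∏ i, tilt (exp (α / 2)) j k (z i)) := by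
    intro z
    by_cases h : sel z = j
    · refine le_add_right (ENNReal.ofReal_le_ofReal ?_)
      refine hΦmono dist_nonneg hΔ.le ?_
      rw [h, dist_comm]
      exact hdist θ
    · refine le_add_left ?_
      calc ENNReal.ofReal (Φ (dist (θs (sel z)) θ)) ≤ D * 1 := by
            rw [mul_one]
            exact ENNReal.ofReal_le_ofReal (hΦmono dist_nonneg Metric.diam_nonneg
              (Metric.dist_le_diam_of_mem hΘ (Set.mem_univ _) (Set.mem_univ _)))
        _ ≤ _ := by
            gcongr
            refine le_trans ?_ (Finset.single_le_sum (fun _ _ => zero_le)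
              (Finset.mem_erase.mpr ⟨h, Finset.mem_univ _⟩))
            exact ENNReal.one_le_ofReal.mpr (one_le_prod_tilt hr1 (hsel z j))
  have htail : ∀ k ∈ Finset.univ.erase j,
      ∫⁻ z, ENNReal.ofReal (∏ i, tilt (exp (α / 2)) j k (z i))
        ∂(Measure.pi fun _ : Fin n => oneHotResponse (exp (α / 2)) j)
      ≤ ENNReal.ofReal (exp (-((n : ℝ) * min α (α ^ 2)) / 20)) := by
    intro k hk
    have hpow : exp (-((n : ℝ) * min α (α ^ 2)) / 20) = exp (-(min α (α ^ 2)) / 20) ^ n := by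
      rw [← exp_nat_mul]
      congr 1
      ring
    rw [lintegral_prod_tilt hr0 (Finset.ne_of_mem_erase hk), hpow,
      ENNReal.ofReal_pow (exp_pos _).le]
    gcongr
    exact four_mul_exp_div_le hα
  refine (lintegral_mono hpoint).trans ?_
  rw [lintegral_add_left measurable_const, lintegral_const, measure_univ, mul_one,
    lintegral_const_mul _ Measurable.of_discrete,
    lintegral_finsetSum _ fun _ _ => Measurable.of_discrete, mul_assoc]
  gcongr
  refine (Finset.sum_le_card_nsmul _ _ _ htail).trans ?_
  rw [nsmul_eq_mul]
  gcongr
  exact (Finset.card_le_univ _).trans (Fintype.card_fin N).le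
end

section
/- Lower bound of Theorem 1 for non-interactive mechanisms (the infinite-T problem, in which each user's raw datum is the parameter itself). Let (Θ, ρ) be a metric space with its Borel σ-algebra, let Z be a measurable space, let Φ : [0,∞) → [0,∞) be nondecreasing with Φ(0) = 0, let α > 0 and let n ≥ 1 be an integer. Let Δ > 0 and let θ_1, …, θ_N ∈ Θ with N ≥ 2 be 2Δ-separated, i.e. ρ(θ_j, θ_l) ≥ 2Δ for all j ≠ l. Then for every family of Markov kernels Q_1, …, Q_n from Θ to Z, each α-LDP on Θ, and every measurable estimator θ̂ : Z^n → Θ, there exists j ∈ {1,…,N} such that ∫ Φ(ρ(θ̂(z), θ_j)) d(⊗_{i=1}^n Q_i(θ_j))(z) ≥ (Φ(Δ)/2) · (1 − (12·n·min{α, α²} + log 2)/log N). -/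
open MeasureTheory Real
open scoped ENNReal

/-- A bounded-ratio pair of measures: the integral of a nonnegative bounded function changes by at
most the same ratio. -/
lemma integral_le_mul_integral_of_measure_le {Z : Type*} [MeasurableSpace Z] {μ ν : Measure Z}
    [IsFiniteMeasure μ] [IsFiniteMeasure ν] {c : ℝ} (hc : 0 ≤ c)
    (h : ∀ S, MeasurableSet S → μ S ≤ ENNReal.ofReal c * ν S)
    {f : Z → ℝ} (hf0 : ∀ z, 0 ≤ f z) (hfν : Integrable f ν) :
    ∫ z, f z ∂μ ≤ c * ∫ z, f z ∂ν := by
  have hle : μ ≤ ENNReal.ofReal c • ν := Measure.le_iff.2 fun S hS => by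
    simpa using h S hS
  have hint : Integrable f (ENNReal.ofReal c • ν) := hfν.smul_measure ENNReal.ofReal_ne_top
  calc ∫ z, f z ∂μ ≤ ∫ z, f z ∂(ENNReal.ofReal c • ν) :=
        integral_mono_measure hle (ae_of_all _ hf0) hint
    _ = c * ∫ z, f z ∂ν := by
        rw [integral_smul_measure, ENNReal.toReal_ofReal hc, smul_eq_mul]

lemma integrable_of_measurable_of_abs_le {Z : Type*} [MeasurableSpace Z] (μ : Measure Z)
    [IsFiniteMeasure μ] {f : Z → ℝ} (hf : Measurable f) (C : ℝ) (hC : ∀ z, |f z| ≤ C) :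
    Integrable f μ :=
  Integrable.of_bound hf.aestronglyMeasurable C (ae_of_all _ hC)

lemma sq_integral_le_integral_sq {Z : Type*} [MeasurableSpace Z] (μ : Measure Z)
    [IsProbabilityMeasure μ] {f : Z → ℝ} (hf : Measurable f) (C : ℝ) (hC : ∀ z, |f z| ≤ C) :
    (∫ z, f z ∂μ) ^ 2 ≤ ∫ z, f z ^ 2 ∂μ := by
  have hLp : MemLp f 2 μ := MemLp.of_bound hf.aestronglyMeasurable C (ae_of_all _ hC)
  have h := ProbabilityTheory.variance_nonneg f μ
  rw [ProbabilityTheory.variance_eq_sub hLp] at h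
  simpa using h

/-- Second-moment comparison under a likelihood ratio in `[exp (-α), exp α]`, from the bound
`1 + (exp α - 1) ^ 2` on the second moment of the likelihood ratio. -/
lemma sq_integral_le_one_add_sq_mul {Z : Type*} [MeasurableSpace Z] {μ ν : Measure Z}
    [IsProbabilityMeasure μ] [IsProbabilityMeasure ν] {α : ℝ} (hα : 0 < α)
    (hμν : ∀ S, MeasurableSet S → μ S ≤ ENNReal.ofReal (exp α) * ν S)
    (hνμ : ∀ S, MeasurableSet S → ν S ≤ ENNReal.ofReal (exp α) * μ S)
    {f : Z → ℝ} (hf : Measurable f) (C : ℝ) (hC : ∀ z, |f z| ≤ C) :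
    (∫ z, f z ∂μ) ^ 2 ≤ (1 + (exp α - 1) ^ 2) * ∫ z, f z ^ 2 ∂ν := by
  set m := ∫ z, f z ∂ν with hm
  set ε := exp α - 1 with hε
  have hε0 : 0 ≤ ε := by linarith [Real.add_one_le_exp α]
  set g : Z → ℝ := fun z => f z - m with hg
  have hgm : Measurable g := hf.sub_const m
  have hgC : ∀ z, |g z| ≤ C + |m| := fun z =>
    (norm_sub_le (f z) m).trans (add_le_add_left (hC z) |m|)
  have hgi : ∀ κ : Measure Z, IsFiniteMeasure κ → Integrable g κ := fun κ _ =>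
    integrable_of_measurable_of_abs_le κ hgm _ hgC
  have hfi : ∀ κ : Measure Z, IsFiniteMeasure κ → Integrable f κ := fun κ _ =>
    integrable_of_measurable_of_abs_le κ hf _ hC
  have hgν : ∫ z, g z ∂ν = 0 := by
    simp only [hg]
    rw [integral_sub (hfi ν inferInstance) (integrable_const _)]
    simp [hm]
  have hgμ : ∫ z, g z ∂μ = ∫ z, f z ∂μ - m := by
    simp only [hg]
    rw [integral_sub (hfi μ inferInstance) (integrable_const _)]
    simp
  have hg2 : ∫ z, g z ^ 2 ∂ν = ∫ z, f z ^ 2 ∂ν - m ^ 2 := by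
    have hLp : MemLp f 2 ν := MemLp.of_bound hf.aestronglyMeasurable C (ae_of_all _ hC)
    have h1 := ProbabilityTheory.variance_eq_sub hLp
    rw [ProbabilityTheory.variance_eq_integral hf.aemeasurable] at h1
    simpa [hg, hm] using h1
  have hsplit : ∀ κ : Measure Z, IsFiniteMeasure κ →
      ∫ z, g z ∂κ = ∫ z, max (g z) 0 ∂κ - ∫ z, max (-g z) 0 ∂κ := fun κ hκ => by
    rw [← integral_sub (hgi κ hκ).pos_part (hgi κ hκ).neg_part]
    refine integral_congr_ae (ae_of_all _ fun z => ?_)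
    simp only [max_def]; split_ifs <;> linarith
  have habs : ∫ z, |g z| ∂ν = ∫ z, max (g z) 0 ∂ν + ∫ z, max (-g z) 0 ∂ν := by
    rw [← integral_add (hgi ν inferInstance).pos_part (hgi ν inferInstance).neg_part]
    refine integral_congr_ae (ae_of_all _ fun z => ?_)
    simp only [max_def]; split_ifs <;> cases abs_cases (g z) <;> linarith
  have hp := fun u : Z → ℝ => fun hu : ∀ z, 0 ≤ u z =>
    integral_le_mul_integral_of_measure_le (f := u) (exp_pos α).le hμν hu
  have hq := fun u : Z → ℝ => fun hu : ∀ z, 0 ≤ u z =>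
    integral_le_mul_integral_of_measure_le (f := u) (exp_pos α).le hνμ hu
  have hpp := hp _ (fun z => le_max_right (g z) 0) (hgi ν inferInstance).pos_part
  have hpn := hp _ (fun z => le_max_right (-g z) 0) (hgi ν inferInstance).neg_part
  have hqp := hq _ (fun z => le_max_right (g z) 0) (hgi μ inferInstance).pos_part
  have hqn := hq _ (fun z => le_max_right (-g z) 0) (hgi μ inferInstance).neg_part
  have hdual : ∀ a b : ℝ, 0 ≤ b → b ≤ exp α * a → b - a ≤ ε * b := fun a b hb hab => by
    have h2 : 0 ≤ (exp α - 1) * (exp α * a - b) := mul_nonneg hε0 (by linarith)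
    by_cases hba : b ≤ a
    · linarith [mul_nonneg hε0 hb]
    · nlinarith
  have hpos : ∀ (κ : Measure Z) (u : Z → ℝ), 0 ≤ ∫ z, max (u z) 0 ∂κ := fun κ u =>
    integral_nonneg fun z => le_max_right _ _
  have hd1 := hdual _ _ (hpos ν g) hqp
  have hd2 := hdual _ _ (hpos ν fun z => -g z) hqn
  have hgabs : |∫ z, g z ∂μ| ≤ ε * ∫ z, |g z| ∂ν := by
    have h0 := hsplit ν inferInstance
    rw [hgν] at h0
    rw [hsplit μ inferInstance, habs, abs_le]
    constructor <;> nlinarith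
  have hJ := sq_integral_le_integral_sq ν (f := fun z => |g z|) hgm.abs _
    (fun z => (abs_abs (g z)).trans_le (hgC z))
  simp only [sq_abs] at hJ
  have hA0 : 0 ≤ ∫ z, |g z| ∂ν := integral_nonneg fun z => abs_nonneg _
  set A := ∫ z, |g z| ∂ν
  set d := ∫ z, g z ∂μ
  have hdm : ∫ z, f z ∂μ = m + d := by linarith
  have hd : d ^ 2 ≤ ε ^ 2 * A ^ 2 := by
    rw [← sq_abs d, ← mul_pow]
    exact pow_le_pow_left₀ (abs_nonneg _) hgabs 2
  have hmd : m * d ≤ |m| * (ε * A) :=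
    (le_abs_self _).trans (by rw [abs_mul]; gcongr)
  rw [hdm]
  have hF : ∫ z, f z ^ 2 ∂ν = m ^ 2 + ∫ z, g z ^ 2 ∂ν := by linarith
  rw [hF]
  have hsq : 0 ≤ (ε * |m| - A) ^ 2 := sq_nonneg _
  have hmm : |m| ^ 2 = m ^ 2 := sq_abs m
  have hfin : (1 + ε ^ 2) * A ^ 2 ≤ (1 + ε ^ 2) * ∫ z, g z ^ 2 ∂ν := by gcongr
  nlinarith

lemma one_add_sq_exp_sub_one_le {α : ℝ} (hα : 0 < α) (hα1 : α ≤ 1) :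
    1 + (exp α - 1) ^ 2 ≤ exp (4 * α ^ 2) := by
  have h1 := Real.abs_exp_sub_one_sub_id_le (x := α) (by rw [abs_of_pos hα]; exact hα1)
  have h2 := (abs_le.1 h1).2
  have h3 : exp α - 1 ≤ 2 * α := by nlinarith
  have h4 : 0 ≤ exp α - 1 := by linarith [Real.add_one_le_exp α]
  nlinarith [Real.add_one_le_exp (4 * α ^ 2)]

/-- Second-moment comparison under a likelihood ratio in `[exp (-α), exp α]`. -/
lemma sq_integral_le_exp_mul {Z : Type*} [MeasurableSpace Z] {μ ν : Measure Z}
    [IsProbabilityMeasure μ] [IsProbabilityMeasure ν] {α : ℝ} (hα : 0 < α)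
    (hμν : ∀ S, MeasurableSet S → μ S ≤ ENNReal.ofReal (exp α) * ν S)
    (hνμ : ∀ S, MeasurableSet S → ν S ≤ ENNReal.ofReal (exp α) * μ S)
    {f : Z → ℝ} (hf : Measurable f) (C : ℝ) (hC : ∀ z, |f z| ≤ C) :
    (∫ z, f z ∂μ) ^ 2 ≤ exp (4 * min α (α ^ 2)) * ∫ z, f z ^ 2 ∂ν := by
  have hnn : 0 ≤ ∫ z, f z ^ 2 ∂ν := integral_nonneg fun z => sq_nonneg _
  rcases le_total α 1 with h | h
  · rw [min_eq_right (by nlinarith)]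
    exact (sq_integral_le_one_add_sq_mul hα hμν hνμ hf C hC).trans
      (mul_le_mul_of_nonneg_right (one_add_sq_exp_sub_one_le hα h) hnn)
  · rw [min_eq_left (by nlinarith)]
    have hi : Integrable (fun z => f z ^ 2) ν :=
      integrable_of_measurable_of_abs_le ν (hf.pow_const 2) (C ^ 2) fun z => by
        rw [abs_pow]; exact pow_le_pow_left₀ (abs_nonneg _) (hC z) 2
    calc (∫ z, f z ∂μ) ^ 2 ≤ ∫ z, f z ^ 2 ∂μ := sq_integral_le_integral_sq μ hf C hC
      _ ≤ exp α * ∫ z, f z ^ 2 ∂ν :=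
        integral_le_mul_integral_of_measure_le (exp_pos α).le hμν (fun z => sq_nonneg _) hi
      _ ≤ exp (4 * α) * ∫ z, f z ^ 2 ∂ν := by gcongr; linarith

/-- Tensorization of second-moment comparison. -/
lemma sq_integral_pi_le_pow_mul {Z : Type*} [MeasurableSpace Z] {K : ℝ} (hK : 0 ≤ K) :
    ∀ (n : ℕ) (μ ν : Fin n → Measure Z) [∀ i, IsProbabilityMeasure (μ i)]
      [∀ i, IsProbabilityMeasure (ν i)],
      (∀ i, ∀ f : Z → ℝ, Measurable f → (∀ z, |f z| ≤ 1) →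
        (∫ z, f z ∂μ i) ^ 2 ≤ K * ∫ z, f z ^ 2 ∂ν i) →
      ∀ f : (Fin n → Z) → ℝ, Measurable f → (∀ z, |f z| ≤ 1) →
        (∫ z, f z ∂Measure.pi μ) ^ 2 ≤ K ^ n * ∫ z, f z ^ 2 ∂Measure.pi ν := by
  intro n
  induction n with
  | zero =>
    intro μ ν _ _ _ f hf hf1
    rw [Subsingleton.elim μ ν, pow_zero, one_mul]
    exact sq_integral_le_integral_sq _ hf 1 hf1
  | succ n ih =>
    intro μ ν _ _ h f hf hf1
    let e := MeasurableEquiv.piFinSuccAbove (fun _ : Fin (n + 1) => Z) 0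
    let F : Z × (Fin n → Z) → ℝ := fun p => f (e.symm p)
    have hF : Measurable F := hf.comp e.symm.measurable
    have hF1 : ∀ p, |F p| ≤ 1 := fun p => hf1 _
    have hF2 : ∀ p, |F p ^ 2| ≤ 1 := fun p => by
      rw [abs_pow]; exact pow_le_one₀ (abs_nonneg _) (hF1 p)
    let μ' : Fin n → Measure Z := fun j => μ ((0 : Fin (n + 1)).succAbove j)
    let ν' : Fin n → Measure Z := fun j => ν ((0 : Fin (n + 1)).succAbove j)
    have hμ : ∫ z, f z ∂Measure.pi μ = ∫ x, ∫ y, F (x, y) ∂Measure.pi μ' ∂μ 0 := by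
      rw [← integral_prod F (integrable_of_measurable_of_abs_le _ hF 1 hF1),
        ← (measurePreserving_piFinSuccAbove μ 0).integral_comp' F]
      exact integral_congr_ae (ae_of_all _ fun z => congrArg f (e.symm_apply_apply z).symm)
    have hν : ∫ z, f z ^ 2 ∂Measure.pi ν = ∫ x, ∫ y, F (x, y) ^ 2 ∂Measure.pi ν' ∂ν 0 := by
      rw [← integral_prod (fun p => F p ^ 2)
          (integrable_of_measurable_of_abs_le _ (hF.pow_const 2) 1 hF2),
        ← (measurePreserving_piFinSuccAbove ν 0).integral_comp' (fun p => F p ^ 2)]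
      exact integral_congr_ae
        (ae_of_all _ fun z => congrArg (fun w => f w ^ 2) (e.symm_apply_apply z).symm)
    let g : Z → ℝ := fun x => ∫ y, F (x, y) ∂Measure.pi μ'
    let G : Z → ℝ := fun x => ∫ y, F (x, y) ^ 2 ∂Measure.pi ν'
    have hg : Measurable g := hF.stronglyMeasurable.integral_prod_right'.measurable
    have hG : Measurable G := (hF.pow_const 2).stronglyMeasurable.integral_prod_right'.measurable
    have hg1 : ∀ x, |g x| ≤ 1 := fun x => by
      simpa using norm_integral_le_of_norm_le_const (μ := Measure.pi μ')
        (f := fun y => F (x, y)) (ae_of_all _ fun y => hF1 (x, y))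
    have hG1 : ∀ x, |G x| ≤ 1 := fun x => by
      simpa using norm_integral_le_of_norm_le_const (μ := Measure.pi ν')
        (f := fun y => F (x, y) ^ 2) (C := 1) (ae_of_all _ fun y => hF2 (x, y))
    have hgG : ∀ x, g x ^ 2 ≤ K ^ n * G x := fun x =>
      ih μ' ν' (fun i => h _) (fun y => F (x, y)) (hF.comp measurable_prodMk_left)
        fun y => hF1 (x, y)
    rw [hμ, hν]
    calc (∫ x, g x ∂μ 0) ^ 2 ≤ K * ∫ x, g x ^ 2 ∂ν 0 := h 0 g hg hg1
      _ ≤ K * ∫ x, K ^ n * G x ∂ν 0 := by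
        refine mul_le_mul_of_nonneg_left (integral_mono ?_ ?_ hgG) hK
        · exact integrable_of_measurable_of_abs_le _ (hg.pow_const 2) 1 fun x => by
            rw [abs_pow]; exact pow_le_one₀ (abs_nonneg _) (hg1 x)
        · exact (integrable_of_measurable_of_abs_le _ hG 1 hG1).const_mul _
      _ = K ^ (n + 1) * ∫ x, G x ∂ν 0 := by rw [integral_const_mul]; ring

/-- The elementary inequality turning a second-moment bound into a bound of Fano type. -/
lemma exp_half_sub_log_le {N : ℕ} (hN : 2 ≤ N) {D : ℝ} (hD : 0 ≤ D) (hDN : 3 * D ≤ Real.log N) :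
    exp ((D - Real.log N) / 2) ≤ 1 / 2 + (3 * D + Real.log 2) / (2 * Real.log N) := by
  have hN' : (2 : ℝ) ≤ N := by exact_mod_cast hN
  have hl2 : 0 < Real.log 2 := Real.log_pos one_lt_two
  have hL2 : Real.log 2 ≤ Real.log N := Real.log_le_log two_pos hN'
  set L := Real.log N with hL
  have hL0 : 0 < L := hl2.trans_le hL2
  set t := 3 * D / L with ht
  have ht0 : 0 ≤ t := by positivity
  have ht1 : t ≤ 1 := (div_le_one hL0).2 hDN
  have hbase : exp (-L / 2) ≤ 1 / 2 + Real.log 2 / (2 * L) := by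
    rcases le_total L (2 * Real.log 2) with h | h
    · have h1 : exp (-L / 2) ≤ 3 / 4 := by
        have h2 : exp (-L / 2) ^ 2 ≤ 1 / 2 := by
          rw [← Real.exp_nat_mul]
          calc exp ((2 : ℕ) * (-L / 2)) ≤ exp (-Real.log 2) :=
                Real.exp_le_exp.2 (by push_cast; linarith)
            _ = 1 / 2 := by rw [Real.exp_neg, Real.exp_log two_pos]; norm_num
        nlinarith [exp_pos (-L / 2)]
      have h2 : 1 / 4 ≤ Real.log 2 / (2 * L) := by
        rw [div_le_div_iff₀ (by norm_num) (by positivity)]; linarith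
      linarith
    · have h1 : exp (-L / 2) ≤ 1 / 2 := by
        calc exp (-L / 2) ≤ exp (-Real.log 2) := Real.exp_le_exp.2 (by linarith)
          _ = 1 / 2 := by rw [Real.exp_neg, Real.exp_log two_pos]; norm_num
      have h2 : 0 ≤ Real.log 2 / (2 * L) := by positivity
      linarith
  have hconv := convexOn_exp.2 (Set.mem_univ (-L / 2)) (Set.mem_univ (-L / 3))
    (sub_nonneg.2 ht1) ht0 (by ring)
  simp only [smul_eq_mul] at hconv
  have hcomb : (1 - t) * (-L / 2) + t * (-L / 3) = (D - L) / 2 := by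
    rw [ht]; field_simp; ring
  rw [hcomb] at hconv
  have he1 : exp (-L / 3) ≤ 1 := Real.exp_le_one_iff.2 (by linarith)
  have hR : 1 / 2 + (3 * D + Real.log 2) / (2 * L) = 1 / 2 + t / 2 + Real.log 2 / (2 * L) := by
    rw [ht]; field_simp; ring
  rw [hR]
  have hl : 0 ≤ Real.log 2 / (2 * L) := by positivity
  have hA := mul_le_mul_of_nonneg_left hbase (sub_nonneg.2 ht1)
  have hB := mul_le_mul_of_nonneg_left he1 ht0
  nlinarith [mul_nonneg ht0 hl]

/-- Lower bound of Theorem 1 for non-interactive mechanisms (the infinite-`T` problem). -/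
theorem infiniteT_lower_bound
    {Θ : Type*} [MetricSpace Θ] [MeasurableSpace Θ] [BorelSpace Θ]
    {Z : Type*} [MeasurableSpace Z]
    (Φ : ℝ → ℝ) (hΦmono : MonotoneOn Φ (Set.Ici 0)) (hΦnonneg : ∀ x : ℝ, 0 ≤ x → 0 ≤ Φ x)
    (hΦ0 : Φ 0 = 0)
    (α : ℝ) (hα : 0 < α) (n : ℕ) (hn : 1 ≤ n)
    (Δ : ℝ) (hΔ : 0 < Δ) (N : ℕ) (hN : 2 ≤ N) (θs : Fin N → Θ)
    (hsep : ∀ j l : Fin N, j ≠ l → 2 * Δ ≤ dist (θs j) (θs l))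
    (Q : Fin n → Θ → Measure Z)
    (hQmeas : ∀ i, Measurable (Q i)) (hQprob : ∀ i θ, IsProbabilityMeasure (Q i θ))
    (hQLDP : ∀ i, IsLDPOn (Q i) α (Set.univ : Set Θ))
    (θhat : (Fin n → Z) → Θ) (hθhat : Measurable θhat) :
    ∃ j : Fin N,
      ENNReal.ofReal (Φ Δ / 2 *
          (1 - (12 * (n : ℝ) * min α (α ^ 2) + Real.log 2) / Real.log N))
        ≤ ∫⁻ z, ENNReal.ofReal (Φ (dist (θhat z) (θs j)))
            ∂(Measure.pi fun i : Fin n => Q i (θs j)) := by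
  have hN' : (2 : ℝ) ≤ N := by exact_mod_cast hN
  have hL0 : 0 < Real.log N := Real.log_pos (by linarith)
  have hm0 : 0 ≤ min α (α ^ 2) := le_min hα.le (sq_nonneg α)
  let P : Fin N → Measure (Fin n → Z) := fun j => Measure.pi fun i => Q i (θs j)
  let A : Fin N → Set (Fin n → Z) := fun j => {z | dist (θhat z) (θs j) < Δ}
  have hA : ∀ j, MeasurableSet (A j) := fun j =>
    hθhat (Metric.isOpen_ball (x := θs j) (ε := Δ)).measurableSet
  have hdisj : Pairwise (Function.onFun Disjoint A) := fun j l hjl =>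
    Set.disjoint_left.2 fun z hz hz' => by
      have h1 : dist (θhat z) (θs j) < Δ := hz
      have h2 : dist (θhat z) (θs l) < Δ := hz'
      linarith [hsep j l hjl, dist_triangle_left (θs j) (θs l) (θhat z)]
  let o : Fin N := ⟨0, by omega⟩
  obtain ⟨j, hj⟩ : ∃ j, (P o).real (A j) ≤ 1 / N := by
    by_contra! h
    have h1 : ∑ j, (P o).real (A j) ≤ 1 := by
      rw [← measureReal_iUnion_fintype hdisj hA]
      exact measureReal_le_one
    have h2 : ∑ _j : Fin N, (1 / N : ℝ) < ∑ j, (P o).real (A j) :=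
      Finset.sum_lt_sum_of_nonempty ⟨o, Finset.mem_univ _⟩ fun j _ => h j
    have h3 : (N : ℝ) ≠ 0 := by linarith
    simp [h3] at h2
    linarith
  refine ⟨j, ?_⟩
  set D : ℝ := n * (4 * min α (α ^ 2)) with hD
  have hD0 : 0 ≤ D := by positivity
  have hcmp : (P j).real (A j) ^ 2 ≤ exp D * (P o).real (A j) := by
    have h := sq_integral_pi_le_pow_mul (exp_pos (4 * min α (α ^ 2))).le n
      (fun i => Q i (θs j)) (fun i => Q i (θs o))
      (fun i f hf hf1 => sq_integral_le_exp_mul hα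
        (fun S hS => hQLDP i S hS _ (Set.mem_univ _) _ (Set.mem_univ _))
        (fun S hS => hQLDP i S hS _ (Set.mem_univ _) _ (Set.mem_univ _)) hf 1 hf1)
      ((A j).indicator 1) (measurable_one.indicator (hA j)) (fun z => by
        by_cases hz : z ∈ A j <;> simp [hz])
    have hsq : ∀ z, (A j).indicator (1 : (Fin n → Z) → ℝ) z ^ 2 = (A j).indicator 1 z :=
      fun z => by by_cases hz : z ∈ A j <;> simp [hz]
    simp only [hsq] at h
    rw [integral_indicator_one (hA j), integral_indicator_one (hA j), ← Real.exp_nat_mul] at h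
    exact h
  have hbound : (P j).real (A j) ≤ 1 / 2 + (3 * D + Real.log 2) / (2 * Real.log N) := by
    rcases le_total (3 * D) (Real.log N) with h | h
    · refine le_trans ((pow_le_pow_iff_left₀ measureReal_nonneg (exp_pos _).le two_ne_zero).1 ?_) (exp_half_sub_log_le hN hD0 h)
      calc (P j).real (A j) ^ 2 ≤ exp D * (1 / N) := hcmp.trans (by gcongr)
        _ = exp ((D - Real.log N) / 2) ^ 2 := by
          rw [← Real.exp_nat_mul]
          push_cast
          rw [mul_div_cancel₀ _ two_ne_zero, Real.exp_sub, Real.exp_log (by linarith)]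
          ring
    · have h1 : 1 / 2 ≤ (3 * D + Real.log 2) / (2 * Real.log N) := by
        rw [div_le_div_iff₀ two_pos (by positivity)]
        linarith [Real.log_pos one_lt_two]
      linarith [measureReal_le_one (μ := P j) (s := A j)]
  have hΦΔ : 0 ≤ Φ Δ := hΦnonneg Δ hΔ.le
  calc ENNReal.ofReal (Φ Δ / 2 * (1 - (12 * (n : ℝ) * min α (α ^ 2) + Real.log 2) / Real.log N))
      ≤ ENNReal.ofReal (Φ Δ * (P j).real (A j)ᶜ) := by
        refine ENNReal.ofReal_le_ofReal ?_
        rw [probReal_compl_eq_one_sub (hA j), div_mul_eq_mul_div, mul_div_assoc]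
        refine mul_le_mul_of_nonneg_left ?_ hΦΔ
        have h1 : (3 * D + Real.log 2) / (2 * Real.log N) =
            (12 * (n : ℝ) * min α (α ^ 2) + Real.log 2) / Real.log N / 2 := by
          rw [hD]; field_simp; ring
        rw [h1] at hbound
        linarith
    _ = ENNReal.ofReal (Φ Δ) * P j (A j)ᶜ := by
        rw [ENNReal.ofReal_mul hΦΔ, ofReal_measureReal]
    _ = ∫⁻ _ in (A j)ᶜ, ENNReal.ofReal (Φ Δ) ∂P j := by rw [setLIntegral_const]
    _ ≤ ∫⁻ z in (A j)ᶜ, ENNReal.ofReal (Φ (dist (θhat z) (θs j))) ∂P j := by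
        refine setLIntegral_mono' (hA j).compl fun z hz => ENNReal.ofReal_le_ofReal ?_
        exact hΦmono hΔ.le dist_nonneg (not_lt.1 hz)
    _ ≤ ∫⁻ z, ENNReal.ofReal (Φ (dist (θhat z) (θs j))) ∂P j := setLIntegral_le_lintegral _ _
end

section
/- Corollary 1 for non-interactive mechanisms: a T-independent lower bound for user-level locally private estimation. Let X be a measurable space, (Θ, ρ) a metric space with Borel σ-algebra, Φ : [0,∞) → [0,∞) nondecreasing with Φ(0)=0, α > 0, and n, T ≥ 1 integers. Let P_1, …, P_N (N ≥ 2) be probability measures on X with associated parameters θ_1, …, θ_N ∈ Θ that are 2Δ-separated (ρ(θ_j, θ_l) ≥ 2Δ for j ≠ l) for some Δ > 0. Then for every measurable space Z, every family of Markov kernels Q_1, …, Q_n from X^T to Z, each α-LDP on X^T (user-level privacy), and every measurable estimator θ̂ : Z^n → Θ, there exists j ∈ {1,…,N} such that ∫ Φ(ρ(θ̂(z), θ_j)) dM_j(z) ≥ (Φ(Δ)/2)·(1 − (12·n·min{α,α²} + log 2)/log N), where M_j = ⊗_{i=1}^n ((P_j^{⊗T}).bind Q_i) is the joint law of the privatized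 outputs when every user draws T i.i.d. observations from P_j. In particular, this lower bound does not depend on T. -/
open MeasureTheory Real
open scoped ENNReal

/-- Order-two Rényi comparison of measures, in its dual (Cauchy–Schwarz) form. -/
def SqLIntegralLE {X : Type*} [MeasurableSpace X] (c : ℝ≥0∞) (μ ν : Measure X) : Prop :=
  ∀ g : X → ℝ≥0∞, Measurable g → (∫⁻ x, g x ∂μ) ^ 2 ≤ c * ∫⁻ x, g x ^ 2 ∂ν

theorem sq_lintegral_mul_le {X : Type*} [MeasurableSpace X] (μ : Measure X) {f g : X → ℝ≥0∞}
    (hf : Measurable f) (hg : Measurable g) :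
    (∫⁻ x, f x * g x ∂μ) ^ 2 ≤ (∫⁻ x, f x ^ 2 ∂μ) * ∫⁻ x, g x ^ 2 ∂μ := by
  have h := ENNReal.lintegral_mul_le_Lp_mul_Lq μ Real.HolderConjugate.two_two
    hf.aemeasurable hg.aemeasurable
  simp only [Pi.mul_apply, ENNReal.rpow_ofNat] at h
  have half (x : ℝ≥0∞) : (x ^ (1 / 2 : ℝ)) ^ 2 = x := by
    rw [← ENNReal.rpow_natCast, ← ENNReal.rpow_mul]
    norm_num
  calc (∫⁻ x, f x * g x ∂μ) ^ 2
      ≤ ((∫⁻ x, f x ^ 2 ∂μ) ^ (1 / 2 : ℝ) * (∫⁻ x, g x ^ 2 ∂μ) ^ (1 / 2 : ℝ)) ^ 2 := by gcongr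
    _ = _ := by rw [mul_pow, half, half]

theorem SqLIntegralLE.mono {X : Type*} [MeasurableSpace X] {c c' : ℝ≥0∞} {μ ν : Measure X}
    (h : SqLIntegralLE c μ ν) (hc : c ≤ c') : SqLIntegralLE c' μ ν :=
  fun g hg ↦ (h g hg).trans (by gcongr)

theorem SqLIntegralLE.prod {X Y : Type*} [MeasurableSpace X] [MeasurableSpace Y] {c d : ℝ≥0∞}
    {μ ν : Measure X} {μ' ν' : Measure Y} [SFinite μ'] [SFinite ν']
    (h : SqLIntegralLE c μ ν) (h' : SqLIntegralLE d μ' ν') :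
    SqLIntegralLE (c * d) (μ.prod μ') (ν.prod ν') := by
  intro g hg
  rw [lintegral_prod _ hg.aemeasurable, lintegral_prod _ (hg.pow_const 2).aemeasurable]
  calc (∫⁻ x, ∫⁻ y, g (x, y) ∂μ' ∂μ) ^ 2
      ≤ c * ∫⁻ x, (∫⁻ y, g (x, y) ∂μ') ^ 2 ∂ν := h _ hg.lintegral_prod_right'
    _ ≤ c * ∫⁻ x, d * ∫⁻ y, g (x, y) ^ 2 ∂ν' ∂ν := by
        gcongr with x
        exact h' _ (hg.comp measurable_prodMk_left)
    _ = c * d * ∫⁻ x, ∫⁻ y, g (x, y) ^ 2 ∂ν' ∂ν := by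
        rw [lintegral_const_mul _ (hg.pow_const 2).lintegral_prod_right', mul_assoc]

theorem SqLIntegralLE.pi {X : Type*} [MeasurableSpace X] {c : ℝ≥0∞} {n : ℕ}
    {μ ν : Fin n → Measure X} [∀ i, SigmaFinite (μ i)] [∀ i, SigmaFinite (ν i)]
    (h : ∀ i, SqLIntegralLE c (μ i) (ν i)) :
    SqLIntegralLE (c ^ n) (Measure.pi μ) (Measure.pi ν) := by
  induction n with
  | zero =>
    intro g hg
    rw [Measure.pi_of_empty μ, Measure.pi_of_empty ν, lintegral_dirac' _ hg,
      lintegral_dirac' _ (hg.pow_const 2)]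
    simp
  | succ n ih =>
    intro g hg
    let e := MeasurableEquiv.piFinSuccAbove (fun _ : Fin (n + 1) ↦ X) 0
    have hμ := (measurePreserving_piFinSuccAbove μ 0).symm
    have hν := (measurePreserving_piFinSuccAbove ν 0).symm
    rw [← hμ.lintegral_comp hg, ← hν.lintegral_comp (hg.pow_const 2), pow_succ' c n]
    exact ((h 0).prod (ih fun i ↦ h (Fin.succAbove 0 i))) _ (hg.comp e.symm.measurable)

theorem SqLIntegralLE.of_le_smul {X : Type*} [MeasurableSpace X] {μ ν : Measure X}
    [IsProbabilityMeasure μ] {c : ℝ≥0∞} (h : μ ≤ c • ν) : SqLIntegralLE c μ ν := by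
  intro g hg
  calc (∫⁻ x, g x ∂μ) ^ 2 ≤ ∫⁻ x, g x ^ 2 ∂μ := by
        simpa using sq_lintegral_mul_le μ hg (measurable_const (a := (1 : ℝ≥0∞)))
    _ ≤ ∫⁻ x, g x ^ 2 ∂(c • ν) := lintegral_mono' h le_rfl
    _ = c * ∫⁻ x, g x ^ 2 ∂ν := by simp

theorem sq_add_one_le_mul_of_exp_bounds {α : ℝ} {f : ℝ≥0∞}
    (hu : f ≤ ENNReal.ofReal (exp α)) (hl : 1 ≤ ENNReal.ofReal (exp α) * f) :
    f ^ 2 + 1 ≤ ENNReal.ofReal (2 * cosh α) * f := by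
  lift f to NNReal using ne_top_of_le_ne_top ENNReal.ofReal_ne_top hu
  rw [← ENNReal.ofReal_coe_nnreal] at *
  rw [ENNReal.ofReal_le_ofReal_iff (exp_pos α).le] at hu
  rw [← ENNReal.ofReal_mul (exp_pos α).le, ENNReal.one_le_ofReal] at hl
  rw [← ENNReal.ofReal_mul (by positivity), ← ENNReal.ofReal_pow f.coe_nonneg, ← ENNReal.ofReal_one,
    ← ENNReal.ofReal_add (by positivity) zero_le_one]
  apply ENNReal.ofReal_le_ofReal
  have hl' : exp (-α) ≤ f := by
    rw [exp_neg, inv_le_iff_one_le_mul₀' (exp_pos α)]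
    exact hl
  have hprod : exp α * exp (-α) = 1 := by rw [← exp_add]; simp
  have := mul_nonneg (sub_nonneg.2 hu) (sub_nonneg.2 hl')
  rw [cosh_eq]
  nlinarith

theorem SqLIntegralLE.of_le_exp_smul {X : Type*} [MeasurableSpace X] {μ ν : Measure X}
    [IsProbabilityMeasure μ] [IsProbabilityMeasure ν] {α : ℝ}
    (h : μ ≤ ENNReal.ofReal (exp α) • ν) (h' : ν ≤ ENNReal.ofReal (exp α) • μ) :
    SqLIntegralLE (ENNReal.ofReal (2 * cosh α - 1)) μ ν := by
  have hac : μ ≪ ν := (Measure.absolutelyContinuous_of_le h).trans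
    (Measure.smul_absolutelyContinuous)
  set f := μ.rnDeriv ν
  have hfm : Measurable f := Measure.measurable_rnDeriv μ ν
  have hμ : ν.withDensity f = μ := Measure.withDensity_rnDeriv_eq μ ν hac
  have hset (s : Set X) : ∫⁻ x in s, f x ∂ν = μ s := Measure.setLIntegral_rnDeriv hac s
  have hu : ∀ᵐ x ∂ν, f x ≤ ENNReal.ofReal (exp α) := by
    refine ae_le_of_forall_setLIntegral_le_of_sigmaFinite hfm fun s _ _ ↦ ?_
    rw [hset, setLIntegral_const]
    exact h s
  have hl : ∀ᵐ x ∂ν, 1 ≤ ENNReal.ofReal (exp α) * f x := by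
    refine ae_le_of_forall_setLIntegral_le_of_sigmaFinite measurable_const fun s _ _ ↦ ?_
    rw [lintegral_const_mul _ hfm, hset, setLIntegral_const, one_mul]
    exact h' s
  have hf2 : ∫⁻ x, f x ^ 2 ∂ν ≤ ENNReal.ofReal (2 * cosh α - 1) := by
    have : ∫⁻ x, (f x ^ 2 + 1) ∂ν ≤ ∫⁻ x, ENNReal.ofReal (2 * cosh α) * f x ∂ν := by
      apply lintegral_mono_ae
      filter_upwards [hu, hl] with x hx hx' using sq_add_one_le_mul_of_exp_bounds hx hx'
    rw [lintegral_add_right _ measurable_const, lintegral_const_mul _ hfm,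
      ← setLIntegral_univ f, hset] at this
    simp only [lintegral_one, measure_univ, mul_one] at this
    rw [ENNReal.ofReal_sub _ zero_le_one, ENNReal.ofReal_one]
    exact ENNReal.le_sub_of_add_le_right ENNReal.one_ne_top this
  intro g hg
  calc (∫⁻ x, g x ∂μ) ^ 2 = (∫⁻ x, f x * g x ∂ν) ^ 2 := by
        conv_lhs => rw [← hμ]
        rw [lintegral_withDensity_eq_lintegral_mul _ hfm hg]
        rfl
    _ ≤ (∫⁻ x, f x ^ 2 ∂ν) * ∫⁻ x, g x ^ 2 ∂ν := sq_lintegral_mul_le ν hfm hg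
    _ ≤ _ := by gcongr

theorem two_mul_cosh_sub_one_le (α : ℝ) : 2 * cosh α - 1 ≤ exp (α ^ 2) := by
  have h := cosh_le_exp_half_sq α
  have : exp (α ^ 2) = exp (α ^ 2 / 2) ^ 2 := by
    rw [← exp_nat_mul]
    congr 1
    push_cast
    ring
  nlinarith [sq_nonneg (exp (α ^ 2 / 2) - 1)]

theorem SqLIntegralLE.of_le_exp_smul_min {X : Type*} [MeasurableSpace X] {μ ν : Measure X}
    [IsProbabilityMeasure μ] [IsProbabilityMeasure ν] {α : ℝ}
    (h : μ ≤ ENNReal.ofReal (exp α) • ν) (h' : ν ≤ ENNReal.ofReal (exp α) • μ) :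
    SqLIntegralLE (ENNReal.ofReal (exp (min α (α ^ 2)))) μ ν := by
  rcases min_choice α (α ^ 2) with hm | hm <;> rw [hm]
  · exact .of_le_smul h
  · exact (SqLIntegralLE.of_le_exp_smul h h').mono
      (ENNReal.ofReal_le_ofReal (two_mul_cosh_sub_one_le α))

theorem IsLDPOn.bind_le_smul_bind {X Z : Type*} [MeasurableSpace X] [MeasurableSpace Z]
    {Q : X → Measure Z} {α : ℝ} (h : IsLDPOn Q α Set.univ) (hQ : Measurable Q)
    (μ ν : Measure X) [IsProbabilityMeasure μ] [IsProbabilityMeasure ν] :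
    μ.bind Q ≤ ENNReal.ofReal (exp α) • ν.bind Q := by
  refine Measure.le_iff.2 fun S hS ↦ ?_
  have hm : Measurable fun x ↦ Q x S := (Measure.measurable_coe hS).comp hQ
  rw [Measure.smul_apply, Measure.bind_apply hS hQ.aemeasurable,
    Measure.bind_apply hS hQ.aemeasurable, smul_eq_mul, ← lintegral_const_mul _ hm]
  calc ∫⁻ x, Q x S ∂μ = ∫⁻ _, ∫⁻ x, Q x S ∂μ ∂ν := by simp
    _ ≤ ∫⁻ x', ENNReal.ofReal (exp α) * Q x' S ∂ν := by
        gcongr with x'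
        calc ∫⁻ x, Q x S ∂μ ≤ ∫⁻ _, ENNReal.ofReal (exp α) * Q x' S ∂μ := by
              gcongr with x
              exact h S hS x trivial x' trivial
          _ = _ := by simp

theorem exists_measureReal_le_inv {X : Type*} [MeasurableSpace X] (ν : Measure X)
    [IsProbabilityMeasure ν] {N : ℕ} (hN : N ≠ 0) {A : Fin N → Set X}
    (hA : ∀ j, MeasurableSet (A j)) (hd : Pairwise (Function.onFun Disjoint A)) :
    ∃ j, ν.real (A j) ≤ (N : ℝ)⁻¹ := by
  have : Nonempty (Fin N) := ⟨⟨0, Nat.pos_of_ne_zero hN⟩⟩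
  have hsum : ∑ j, ν.real (A j) ≤ ∑ _j : Fin N, (N : ℝ)⁻¹ := by
    rw [← measureReal_iUnion_fintype hd hA]
    simp [hN]
  obtain ⟨j, -, hj⟩ := Finset.exists_le_of_sum_le Finset.univ_nonempty hsum
  exact ⟨j, hj⟩

theorem le_half_mul_one_add_of_sq_le {p k L : ℝ} (hp : p ≤ 1) (hk : 0 ≤ k) (hL : 0 < L)
    (h : p ^ 2 ≤ exp (k - L)) : p ≤ 1 / 2 * (1 + (12 * k + log 2) / L) := by
  have hlog : 1 / 2 < log 2 := by linarith [log_two_gt_d9]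
  rcases le_or_gt L k with hLk | hkL
  · have : 1 ≤ (12 * k + log 2) / L := by
      rw [one_le_div hL]
      linarith
    linarith
  set r := (12 * k + log 2) / L with hr
  have hr0 : 0 ≤ r := by positivity
  have key : exp (k - L) ≤ r := by
    rw [hr, le_div_iff₀ hL]
    have h1 : exp (k - L) ≤ 1 := exp_le_one_iff.2 (by linarith)
    have h2 : (L - k) * exp (k - L) ≤ 1 / 2 := by
      have hq := quadratic_le_exp_of_nonneg (sub_nonneg.2 hkL.le)
      have he : exp (L - k) * exp (k - L) = 1 := by rw [← exp_add]; simp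
      have h3 : 2 * (L - k) ≤ exp (L - k) := by nlinarith [sq_nonneg (L - k - 1)]
      nlinarith [exp_pos (k - L)]
    nlinarith
  exact le_of_sq_le_sq (by nlinarith [sq_nonneg (1 - r)]) (by positivity)

theorem ofReal_mul_le_lintegral {X : Type*} [MeasurableSpace X] (μ : Measure X)
    [IsProbabilityMeasure μ] {A : Set X} (hA : MeasurableSet A) {c : ℝ} (hc : 0 ≤ c)
    {F : X → ℝ} (hF : ∀ x ∉ A, c ≤ F x) :
    ENNReal.ofReal (c * (1 - μ.real A)) ≤ ∫⁻ x, ENNReal.ofReal (F x) ∂μ := by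
  rw [← probReal_compl_eq_one_sub hA, ENNReal.ofReal_mul hc, ofReal_measureReal,
    ← lintegral_indicator_const hA.compl]
  refine lintegral_mono fun x ↦ ?_
  by_cases hx : x ∈ A
  · simp [hx]
  · simpa [hx] using ENNReal.ofReal_le_ofReal (hF x hx)

/-- Corollary 1 for non-interactive mechanisms: a `T`-independent lower bound for
user-level locally private estimation. -/
theorem userLevel_T_independent_lower
    {X : Type*} [MeasurableSpace X]
    {Θ : Type*} [MetricSpace Θ] [MeasurableSpace Θ] [BorelSpace Θ]
    {Z : Type*} [MeasurableSpace Z]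
    (Φ : ℝ → ℝ) (hΦmono : MonotoneOn Φ (Set.Ici 0)) (hΦnonneg : ∀ x : ℝ, 0 ≤ x → 0 ≤ Φ x)
    (hΦ0 : Φ 0 = 0)
    (α : ℝ) (hα : 0 < α) (n T : ℕ) (hn : 1 ≤ n) (hT : 1 ≤ T)
    (Δ : ℝ) (hΔ : 0 < Δ) (N : ℕ) (hN : 2 ≤ N)
    (P : Fin N → Measure X) (hP : ∀ j, IsProbabilityMeasure (P j))
    (θs : Fin N → Θ)
    (hsep : ∀ j l : Fin N, j ≠ l → 2 * Δ ≤ dist (θs j) (θs l))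
    (Q : Fin n → (Fin T → X) → Measure Z)
    (hQmeas : ∀ i, Measurable (Q i)) (hQprob : ∀ i x, IsProbabilityMeasure (Q i x))
    (hQLDP : ∀ i, IsLDPOn (Q i) α (Set.univ : Set (Fin T → X)))
    (θhat : (Fin n → Z) → Θ) (hθhat : Measurable θhat) :
    ∃ j : Fin N,
      ENNReal.ofReal (Φ Δ / 2 *
          (1 - (12 * (n : ℝ) * min α (α ^ 2) + Real.log 2) / Real.log N))
        ≤ ∫⁻ z, ENNReal.ofReal (Φ (dist (θhat z) (θs j)))
            ∂(Measure.pi fun i : Fin n =>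
                (Measure.pi fun _ : Fin T => P j).bind (Q i)) := by
  set M : Fin N → Fin n → Measure Z := fun j i ↦ (Measure.pi fun _ : Fin T ↦ P j).bind (Q i)
  have hMprob (j : Fin N) (i : Fin n) : IsProbabilityMeasure (M j i) :=
    isProbabilityMeasure_bind (hQmeas i).aemeasurable (.of_forall (hQprob i))
  have hMle (j l : Fin N) (i : Fin n) : M j i ≤ ENNReal.ofReal (exp α) • M l i :=
    (hQLDP i).bind_le_smul_bind (hQmeas i) _ _
  let j₀ : Fin N := ⟨0, by omega⟩
  set A : Fin N → Set (Fin n → Z) := fun j ↦ θhat ⁻¹' Metric.ball (θs j) Δ with hAdef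
  have hA (j : Fin N) : MeasurableSet (A j) := hθhat measurableSet_ball
  have hd : Pairwise (Function.onFun Disjoint A) := fun j l hjl ↦
    (Metric.ball_disjoint_ball (by linarith [hsep j l hjl])).preimage _
  obtain ⟨j, hj⟩ := exists_measureReal_le_inv (Measure.pi (M j₀)) (by omega) hA hd
  refine ⟨j, ?_⟩
  have hN' : (0 : ℝ) < N := by positivity
  have hL : 0 < log N := log_pos (by exact_mod_cast hN)
  have hk : 0 ≤ n * min α (α ^ 2) := by positivity
  have hsq : (Measure.pi (M j)).real (A j) ^ 2 ≤ exp (n * min α (α ^ 2) - log N) := by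
    have h := SqLIntegralLE.pi (fun i ↦ SqLIntegralLE.of_le_exp_smul_min (hMle j j₀ i)
      (hMle j₀ j i)) ((A j).indicator 1) (measurable_one.indicator (hA j))
    have hind : (fun x ↦ (A j).indicator (1 : (Fin n → Z) → ℝ≥0∞) x ^ 2)
        = (A j).indicator 1 := by
      ext x
      by_cases hx : x ∈ A j <;> simp [hx]
    rw [hind, lintegral_indicator_one (hA j), lintegral_indicator_one (hA j)] at h
    have h' := ENNReal.toReal_mono (by finiteness) h
    rw [ENNReal.toReal_pow, ENNReal.toReal_mul, ENNReal.toReal_pow,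
      ENNReal.toReal_ofReal (exp_pos _).le, ← exp_nat_mul] at h'
    calc (Measure.pi (M j)).real (A j) ^ 2
        ≤ exp (n * min α (α ^ 2)) * (Measure.pi (M j₀)).real (A j) := h'
      _ ≤ exp (n * min α (α ^ 2)) * (N : ℝ)⁻¹ := by gcongr
      _ = exp (n * min α (α ^ 2) - log N) := by
        rw [exp_sub, exp_log hN', div_eq_mul_inv]
  have hp := le_half_mul_one_add_of_sq_le measureReal_le_one hk hL hsq
  have hΦΔ := hΦnonneg Δ hΔ.le
  refine le_trans (ENNReal.ofReal_le_ofReal ?_) (ofReal_mul_le_lintegral (Measure.pi (M j)) (hA j)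
    hΦΔ (F := fun z ↦ Φ (dist (θhat z) (θs j))) fun z hz ↦
      hΦmono hΔ.le dist_nonneg (by simpa [hAdef] using hz))
  rw [div_mul_eq_mul_div, mul_div_assoc]
  refine mul_le_mul_of_nonneg_left ?_ hΦΔ
  rw [← mul_assoc] at hp
  linarith
end

section
/- Explicit infinite-T lower bound for mean estimation on the Euclidean unit ball (the lower bound of Proposition 1(ii), non-interactive case, with explicit constants). Let d, n ≥ 1 be integers and α > 0 with n·min{α, α²} > 60d, and let B = {θ ∈ ℝ^d : ‖θ‖₂ ≤ 1} be the closed Euclidean unit ball. Then for every measurable space Z, every family of Markov kernels Q_1, …, Q_n from ℝ^d to Z, each α-LDP on B, and every measurable estimator θ̂ : Z^n → ℝ^d, there exists θ ∈ B such that ∫ ‖θ̂(z) − θ‖₂² d(⊗_{i=1}^n Q_i(θ))(z) ≥ (1/16)·exp(−48·n·min{α,α²}/d − log(16)/d). -/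
open MeasureTheory Real
open scoped ENNReal

/-- Fubini for a product of functions of one coordinate each. -/
lemma lintegral_pi_prod_eq {ι : Type*} [Fintype ι] {Z : ι → Type*} [∀ i, MeasurableSpace (Z i)]
    (μ : ∀ i, Measure (Z i)) [∀ i, IsProbabilityMeasure (μ i)]
    (f : ∀ i, Z i → ℝ≥0∞) (hf : ∀ i, Measurable (f i)) :
    ∫⁻ z, ∏ i, f i (z i) ∂(Measure.pi μ) = ∏ i, ∫⁻ x, f i x ∂(μ i) := by
  have hind : ProbabilityTheory.iIndepFun (fun i (z : ∀ i, Z i) => f i (z i)) (Measure.pi μ) :=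
    ProbabilityTheory.iIndepFun_pi (fun i => (hf i).aemeasurable)
  have hprod := ProbabilityTheory.lintegral_prod_eq_prod_lintegral_of_indepFun Finset.univ _ hind
    (fun i => (hf i).comp (measurable_pi_apply i))
  rw [hprod]
  refine Finset.prod_congr rfl fun i _ => ?_
  exact (measurePreserving_eval μ i).lintegral_comp (hf i)

/-- The product of measures with densities has the product density. -/
lemma pi_withDensity_eq {ι : Type*} [Fintype ι] {Z : ι → Type*} [∀ i, MeasurableSpace (Z i)]
    (μ : ∀ i, Measure (Z i)) [∀ i, IsProbabilityMeasure (μ i)]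
    (f : ∀ i, Z i → ℝ≥0∞) (hf : ∀ i, Measurable (f i))
    [∀ i, SigmaFinite ((μ i).withDensity (f i))] :
    Measure.pi (fun i => (μ i).withDensity (f i))
      = (Measure.pi μ).withDensity (fun z => ∏ i, f i (z i)) := by
  refine Measure.pi_eq fun s hs => ?_
  rw [withDensity_apply _ (MeasurableSet.univ_pi hs),
    ← lintegral_indicator (MeasurableSet.univ_pi hs)]
  have hprod := lintegral_pi_prod_eq μ (fun i => (s i).indicator (f i))
    (fun i => (hf i).indicator (hs i))
  have hind : ∀ z : ∀ i, Z i, (Set.univ.pi s).indicator (fun z => ∏ i, f i (z i)) z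
      = ∏ i, (s i).indicator (f i) (z i) := by
    intro z
    by_cases hz : z ∈ Set.univ.pi s
    · rw [Set.indicator_of_mem hz]
      refine Finset.prod_congr rfl fun i _ => ?_
      rw [Set.indicator_of_mem (hz i (Set.mem_univ i))]
    · rw [Set.indicator_of_notMem hz]
      simp only [Set.mem_univ_pi, not_forall] at hz
      obtain ⟨i, hi⟩ := hz
      exact (Finset.prod_eq_zero (Finset.mem_univ i) (Set.indicator_of_notMem hi _)).symm
  simp_rw [hind, hprod]
  refine Finset.prod_congr rfl fun i _ => ?_
  rw [lintegral_indicator (hs i), withDensity_apply _ (hs i)]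

lemma sq_add_one_le_of_mem_Icc_exp {α x : ℝ} (hα : 0 < α) (hα1 : α ≤ 1)
    (hx : x ≤ exp α) (hx' : exp (-α) ≤ x) : x ^ 2 + 1 ≤ 4 * α ^ 2 + 2 * x := by
  have hexp := (abs_le.1 (abs_exp_sub_one_sub_id_le (x := α) (by rwa [abs_of_pos hα]))).2
  have hexp' := add_one_le_exp (-α)
  have hsq : (x - 1) ^ 2 ≤ (2 * α) ^ 2 := sq_le_sq' (by nlinarith) (by nlinarith)
  nlinarith

/-- Second moment of the likelihood ratio of two probability measures that are within a factor
`exp α` of each other. -/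
lemma lintegral_rnDeriv_sq_le {Z : Type*} [MeasurableSpace Z] (P ν : Measure Z)
    [IsProbabilityMeasure P] [IsProbabilityMeasure ν] {α : ℝ} (hα : 0 < α)
    (hPν : ∀ S, MeasurableSet S → P S ≤ ENNReal.ofReal (exp α) * ν S)
    (hνP : ∀ S, MeasurableSet S → ν S ≤ ENNReal.ofReal (exp α) * P S) :
    ∫⁻ x, P.rnDeriv ν x ^ 2 ∂ν ≤ ENNReal.ofReal (exp (4 * min α (α ^ 2))) := by
  have hac : P ≪ ν := Measure.AbsolutelyContinuous.mk fun S hS h0 => by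
    simpa [h0] using hPν S hS
  have hmeas := Measure.measurable_rnDeriv P ν
  have hint : ∫⁻ x, P.rnDeriv ν x ∂ν = 1 := by
    rw [Measure.lintegral_rnDeriv hac, measure_univ]
  have hub : ∀ᵐ x ∂ν, P.rnDeriv ν x ≤ ENNReal.ofReal (exp α) := by
    refine ae_le_of_forall_setLIntegral_le_of_sigmaFinite hmeas fun S hS _ => ?_
    rw [Measure.setLIntegral_rnDeriv hac, setLIntegral_const]
    exact hPν S hS
  rcases le_total 1 α with h1 | h1
  · rw [min_eq_left (by nlinarith)]
    calc ∫⁻ x, P.rnDeriv ν x ^ 2 ∂ν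
        ≤ ∫⁻ x, ENNReal.ofReal (exp α) * P.rnDeriv ν x ∂ν := by
          refine lintegral_mono_ae ?_
          filter_upwards [hub] with x hx
          rw [sq]
          gcongr
      _ = ENNReal.ofReal (exp α) := by rw [lintegral_const_mul _ hmeas, hint, mul_one]
      _ ≤ _ := ENNReal.ofReal_le_ofReal (exp_le_exp.2 (by linarith))
  · rw [min_eq_right (by nlinarith)]
    have hlb : ∀ᵐ x ∂ν, ENNReal.ofReal (exp (-α)) ≤ P.rnDeriv ν x := by
      refine ae_le_of_forall_setLIntegral_le_of_sigmaFinite measurable_const fun S hS _ => ?_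
      rw [Measure.setLIntegral_rnDeriv hac, setLIntegral_const]
      calc ENNReal.ofReal (exp (-α)) * ν S
          ≤ ENNReal.ofReal (exp (-α)) * (ENNReal.ofReal (exp α) * P S) := by
            gcongr
            exact hνP S hS
        _ = P S := by
            rw [← mul_assoc, ← ENNReal.ofReal_mul (exp_pos _).le, ← exp_add]
            simp
    have hpt : ∀ᵐ x ∂ν, P.rnDeriv ν x ^ 2 + 1
        ≤ ENNReal.ofReal (4 * α ^ 2) + 2 * P.rnDeriv ν x := by
      filter_upwards [hub, hlb] with x hx hx'
      obtain ⟨y, hy⟩ : ∃ y, P.rnDeriv ν x = y := ⟨_, rfl⟩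
      rw [hy] at hx hx' ⊢
      lift y to NNReal using ne_top_of_le_ne_top ENNReal.ofReal_ne_top hx
      rw [← ENNReal.ofReal_coe_nnreal] at hx hx' ⊢
      rw [ENNReal.ofReal_le_ofReal_iff (exp_pos _).le] at hx
      rw [ENNReal.ofReal_le_ofReal_iff y.coe_nonneg] at hx'
      have hreal := sq_add_one_le_of_mem_Icc_exp hα h1 hx hx'
      rw [← ENNReal.ofReal_pow y.coe_nonneg, ← ENNReal.ofReal_one, ← ENNReal.ofReal_ofNat 2,
        ← ENNReal.ofReal_mul (by norm_num), ← ENNReal.ofReal_add (by positivity) (by norm_num),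
        ← ENNReal.ofReal_add (by positivity) (by positivity)]
      exact ENNReal.ofReal_le_ofReal hreal
    have hsum := lintegral_mono_ae hpt
    rw [lintegral_add_right _ measurable_const, lintegral_add_left measurable_const,
      lintegral_const_mul _ hmeas, hint] at hsum
    simp only [lintegral_const, measure_univ, mul_one] at hsum
    rw [show (2 : ℝ≥0∞) = 1 + 1 by norm_num, ← add_assoc,
      ENNReal.add_le_add_iff_right ENNReal.one_ne_top] at hsum
    refine hsum.trans ?_
    rw [← ENNReal.ofReal_one, ← ENNReal.ofReal_add (by positivity) zero_le_one]
    exact ENNReal.ofReal_le_ofReal (add_one_le_exp _)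

lemma le_add_sq_div {K : ℝ} (hK : 0 < K) (x : ℝ≥0∞) :
    x ≤ ENNReal.ofReal K + ENNReal.ofReal (1 / (4 * K)) * x ^ 2 := by
  induction x with
  | top =>
    rw [ENNReal.top_pow two_ne_zero, ENNReal.mul_top (by simpa using hK)]
    simp
  | coe y =>
    rw [← ENNReal.ofReal_coe_nnreal, ← ENNReal.ofReal_pow y.coe_nonneg,
      ← ENNReal.ofReal_mul (by positivity), ← ENNReal.ofReal_add hK.le (by positivity)]
    refine ENNReal.ofReal_le_ofReal ?_
    rw [← sub_nonneg]
    have : K + 1 / (4 * K) * (y : ℝ) ^ 2 - y = (2 * K - y) ^ 2 / (4 * K) := by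
      field_simp
      ring
    rw [this]
    positivity

/-- A change of measure for sets controlled by the second moment of the density. -/
lemma withDensity_apply_le_of_lintegral_sq_le {Ω : Type*} [MeasurableSpace Ω] (ν : Measure Ω)
    {L : Ω → ℝ≥0∞} (hL : Measurable L) {K : ℝ} (hK : 0 < K)
    (hL2 : ∫⁻ x, L x ^ 2 ∂ν ≤ ENNReal.ofReal K) {A : Set Ω} (hA : MeasurableSet A) :
    ν.withDensity L A ≤ ENNReal.ofReal K * ν A + ENNReal.ofReal (1 / 4) := by
  rw [withDensity_apply _ hA]
  calc ∫⁻ x in A, L x ∂ν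
      ≤ ∫⁻ x in A, (ENNReal.ofReal K + ENNReal.ofReal (1 / (4 * K)) * L x ^ 2) ∂ν :=
        lintegral_mono fun x => le_add_sq_div hK _
    _ = ENNReal.ofReal K * ν A + ENNReal.ofReal (1 / (4 * K)) * ∫⁻ x in A, L x ^ 2 ∂ν := by
        rw [lintegral_add_left measurable_const, setLIntegral_const,
          lintegral_const_mul _ (hL.pow_const 2)]
    _ ≤ ENNReal.ofReal K * ν A + ENNReal.ofReal (1 / (4 * K)) * ENNReal.ofReal K := by
        gcongr
        exact (setLIntegral_le_lintegral _ _).trans hL2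
    _ = _ := by
        rw [← ENNReal.ofReal_mul (by positivity), show 1 / (4 * K) * K = 1 / 4 by field_simp]

/-- Some point of the unit ball is `δ`-close to a random point with probability at most the
volume ratio `δ ^ d`. -/
lemma exists_mem_closedBall_measure_norm_sub_le {Ω : Type*} [MeasurableSpace Ω] (ν : Measure Ω)
    [IsProbabilityMeasure ν] {d : ℕ} (hd : 1 ≤ d) {f : Ω → EuclideanSpace ℝ (Fin d)}
    (hf : Measurable f) {δ : ℝ} (hδ : 0 ≤ δ) :
    ∃ θ ∈ Metric.closedBall (0 : EuclideanSpace ℝ (Fin d)) 1,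
      ν {z | ‖f z - θ‖ < δ} ≤ ENNReal.ofReal (δ ^ d) := by
  have : Nonempty (Fin d) := ⟨⟨0, hd⟩⟩
  set B := Metric.closedBall (0 : EuclideanSpace ℝ (Fin d)) 1
  have hB0 : volume B ≠ 0 := (Metric.measure_closedBall_pos _ _ one_pos).ne'
  have hBtop : volume B ≠ ∞ := measure_closedBall_lt_top.ne
  have hS : MeasurableSet {p : EuclideanSpace ℝ (Fin d) × Ω | ‖f p.2 - p.1‖ < δ} :=
    measurableSet_lt (by fun_prop) measurable_const
  have hmeas : Measurable fun θ => ν {z | ‖f z - θ‖ < δ} := measurable_measure_prodMk_left hS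
  obtain ⟨θ, hθ, hle⟩ := exists_le_setLAverage hB0 hBtop hmeas.aemeasurable
  refine ⟨θ, hθ, hle.trans ?_⟩
  rw [setLAverage_eq]
  refine ENNReal.div_le_of_le_mul ?_
  calc ∫⁻ θ in B, ν {z | ‖f z - θ‖ < δ}
      ≤ ∫⁻ θ, ν {z | ‖f z - θ‖ < δ} := setLIntegral_le_lintegral _ _
    _ = ∫⁻ z, volume {θ | ‖f z - θ‖ < δ} ∂ν :=
        (Measure.prod_apply hS).symm.trans (Measure.prod_apply_symm hS)
    _ = ∫⁻ _, ENNReal.ofReal (δ ^ d) * volume B ∂ν := by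
        refine lintegral_congr fun z => ?_
        have hball : {θ | ‖f z - θ‖ < δ} = Metric.ball (f z) δ := by
          ext θ
          rw [Metric.mem_ball, dist_comm, dist_eq_norm]
          rfl
        rw [hball, Measure.addHaar_ball _ _ hδ, finrank_euclideanSpace_fin,
          Measure.addHaar_unitClosedBall_eq_addHaar_unitBall]
    _ = ENNReal.ofReal (δ ^ d) * volume B := by simp

/-- Explicit infinite-`T` lower bound for mean estimation on the Euclidean unit ball
(the lower bound of Proposition 1(ii), non-interactive case, with explicit constants). -/
theorem mean_l2ball_infiniteT_lower
    {Z : Type*} [MeasurableSpace Z]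
    (d n : ℕ) (hd : 1 ≤ d) (hn : 1 ≤ n) (α : ℝ) (hα : 0 < α)
    (h : 60 * (d : ℝ) < (n : ℝ) * min α (α ^ 2))
    (Q : Fin n → EuclideanSpace ℝ (Fin d) → Measure Z)
    (hQmeas : ∀ i, Measurable (Q i)) (hQprob : ∀ i θ, IsProbabilityMeasure (Q i θ))
    (hQLDP : ∀ i, IsLDPOn (Q i) α (Metric.closedBall (0 : EuclideanSpace ℝ (Fin d)) 1))
    (θhat : (Fin n → Z) → EuclideanSpace ℝ (Fin d)) (hθhat : Measurable θhat) :
    ∃ θ ∈ Metric.closedBall (0 : EuclideanSpace ℝ (Fin d)) 1,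
      ENNReal.ofReal ((1 / 16) *
          Real.exp (-(48 * (n : ℝ) * min α (α ^ 2)) / d - Real.log 16 / d))
        ≤ ∫⁻ z, ENNReal.ofReal (‖θhat z - θ‖ ^ 2) ∂(Measure.pi fun i : Fin n => Q i θ) := by
  have hd0 : (0 : ℝ) < d := by exact_mod_cast hd
  set m := min α (α ^ 2) with hm
  have hm0 : 0 ≤ m := le_min hα.le (sq_nonneg α)
  set B := Metric.closedBall (0 : EuclideanSpace ℝ (Fin d)) 1 with hB
  have hzero : (0 : EuclideanSpace ℝ (Fin d)) ∈ B := by simp [hB]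
  set K := exp (4 * n * m) with hK
  have hKpos : 0 < K := exp_pos _
  set δ := exp (-(4 * n * m + log 4) / d) with hδ
  have hδpos : 0 < δ := exp_pos _
  have hδd : δ ^ d = 1 / (4 * K) := by
    rw [hδ, ← exp_nat_mul, mul_div_cancel₀ _ hd0.ne', exp_neg, exp_add, exp_log (by norm_num),
      one_div, mul_comm K]
  set ν : Measure (Fin n → Z) := Measure.pi fun i => Q i 0
  obtain ⟨θ, hθ, hνθ⟩ := exists_mem_closedBall_measure_norm_sub_le ν hd hθhat hδpos.le
  refine ⟨θ, hθ, ?_⟩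
  set A := {z | ‖θhat z - θ‖ < δ} with hAdef
  have hA : MeasurableSet A := measurableSet_lt (by fun_prop) measurable_const
  set L : Fin n → Z → ℝ≥0∞ := fun i => (Q i θ).rnDeriv (Q i 0)
  have hLmeas : ∀ i, Measurable (L i) := fun i => Measure.measurable_rnDeriv _ _
  have hQL : ∀ i, (Q i 0).withDensity (L i) = Q i θ := fun i =>
    Measure.withDensity_rnDeriv_eq _ _ <| Measure.AbsolutelyContinuous.mk fun S hS h0 => by
      simpa [h0] using hQLDP i S hS θ hθ 0 hzero
  have hfin : ∀ i, SigmaFinite ((Q i 0).withDensity (L i)) := fun i => by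
    rw [hQL i]
    infer_instance
  have hpi : (Measure.pi fun i => Q i θ) = ν.withDensity fun z => ∏ i, L i (z i) := by
    rw [← pi_withDensity_eq _ L hLmeas]
    simp_rw [hQL]
  have hL2 : ∫⁻ z, (∏ i, L i (z i)) ^ 2 ∂ν ≤ ENNReal.ofReal K := by
    simp_rw [← Finset.prod_pow]
    rw [lintegral_pi_prod_eq _ (fun i x => L i x ^ 2) fun i => (hLmeas i).pow_const 2]
    calc ∏ i, ∫⁻ x, L i x ^ 2 ∂(Q i 0)
        ≤ ∏ _i : Fin n, ENNReal.ofReal (exp (4 * m)) :=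
          Finset.prod_le_prod' fun i _ => lintegral_rnDeriv_sq_le _ _ hα
            (fun S hS => hQLDP i S hS θ hθ 0 hzero) (fun S hS => hQLDP i S hS 0 hzero θ hθ)
      _ = ENNReal.ofReal K := by
          rw [Finset.prod_const, Finset.card_univ, Fintype.card_fin,
            ← ENNReal.ofReal_pow (exp_pos _).le, ← exp_nat_mul, hK]
          congr 2
          ring
  set P : Measure (Fin n → Z) := Measure.pi fun i => Q i θ with hP
  have hPA : P A ≤ ENNReal.ofReal (1 / 2) := by
    rw [hpi]
    refine (withDensity_apply_le_of_lintegral_sq_le ν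
      (Finset.measurable_prod _ fun i _ => (hLmeas i).comp (measurable_pi_apply i))
      hKpos hL2 hA).trans ?_
    calc ENNReal.ofReal K * ν A + ENNReal.ofReal (1 / 4)
        ≤ ENNReal.ofReal K * ENNReal.ofReal (1 / (4 * K)) + ENNReal.ofReal (1 / 4) := by
          rw [← hδd]
          gcongr
      _ = ENNReal.ofReal (1 / 2) := by
          rw [← ENNReal.ofReal_mul hKpos.le, ← ENNReal.ofReal_add (by positivity) (by norm_num)]
          congr 1
          field_simp
          norm_num
  have hPAc : ENNReal.ofReal (1 / 2) ≤ P Aᶜ := by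
    rw [prob_compl_eq_one_sub hA]
    refine le_trans ?_ (tsub_le_tsub_left hPA 1)
    rw [← ENNReal.ofReal_one, ← ENNReal.ofReal_sub _ (by norm_num)]
    norm_num
  have hrate : 1 / 16 * exp (-(48 * (n : ℝ) * m) / d - log 16 / d) ≤ δ ^ 2 * (1 / 2) := by
    have hlog : log 16 = 2 * log 4 := by
      rw [show (16 : ℝ) = 4 ^ 2 by norm_num, log_pow]
      norm_num
    have hexp : exp (-(48 * (n : ℝ) * m) / d - log 16 / d) ≤ δ ^ 2 := by
      rw [hδ, ← exp_nat_mul, exp_le_exp, ← sub_div, ← mul_div_assoc]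
      gcongr
      push_cast
      have : 0 ≤ (n : ℝ) * m := by positivity
      linarith
    linarith [exp_pos (-(48 * (n : ℝ) * m) / d - log 16 / d)]
  calc _ ≤ ENNReal.ofReal (δ ^ 2 * (1 / 2)) := ENNReal.ofReal_le_ofReal hrate
    _ = ENNReal.ofReal (δ ^ 2) * ENNReal.ofReal (1 / 2) := ENNReal.ofReal_mul (by positivity)
    _ ≤ ENNReal.ofReal (δ ^ 2) * P Aᶜ := by gcongr
    _ ≤ ENNReal.ofReal (δ ^ 2) * P {z | ENNReal.ofReal (δ ^ 2) ≤
          ENNReal.ofReal (‖θhat z - θ‖ ^ 2)} := by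
        gcongr
        intro z hz
        have hz' : δ ≤ ‖θhat z - θ‖ := not_lt.1 hz
        exact ENNReal.ofReal_le_ofReal (by gcongr)
    _ ≤ _ := mul_meas_ge_le_lintegral (by fun_prop) _
end

section
/- Explicit infinite-T upper bound for mean estimation on the Euclidean unit ball (the upper bound of Proposition 1(ii) with explicit constants). Let d, n ≥ 1 be integers and α > 0 with n·min{α, α²} > 60d, and let B = {θ ∈ ℝ^d : ‖θ‖₂ ≤ 1}. Then there exist a finite set W, a Markov kernel Q from ℝ^d to W that is α-LDP on B, and a function θ̂ : W^n → ℝ^d, such that for every θ ∈ B, ∫ ‖θ̂(z) − θ‖₂² d(Q(θ)^{⊗n})(z) ≤ 13·exp(−n·min{α,α²}/(60d)). -/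
open MeasureTheory Real
open scoped ENNReal

/-- A volumetric bound on the size of a finite separated subset of the unit ball. -/
theorem card_le_of_separated_unit_ball {E : Type*} [NormedAddCommGroup E] [NormedSpace ℝ E]
    [FiniteDimensional ℝ E] {ε : ℝ} (hε : 0 < ε) (s : Finset E) (hs : ∀ x ∈ s, ‖x‖ ≤ 1)
    (hsep : ∀ x ∈ s, ∀ y ∈ s, x ≠ y → ε ≤ dist x y) :
    (s.card : ℝ) ≤ (1 + 2 / ε) ^ Module.finrank ℝ E := by
  borelize E
  let μ : Measure E := Measure.addHaar
  have hδ : 0 < ε / 2 := by positivity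
  have hr : 0 < 1 + ε / 2 := by positivity
  have hdisj : Set.Pairwise (s : Set E)
      (Function.onFun Disjoint fun x => Metric.ball x (ε / 2)) := by
    rintro x hx y hy hxy
    apply Metric.ball_disjoint_ball
    simpa using hsep x hx y hy hxy
  have hsub : (⋃ x ∈ s, Metric.ball x (ε / 2)) ⊆ Metric.ball (0 : E) (1 + ε / 2) := by
    refine Set.iUnion₂_subset fun x hx => Metric.ball_subset_ball' ?_
    rw [dist_zero_right]
    linarith [hs x hx]
  have hvol := measure_mono (μ := μ) hsub
  rw [measure_biUnion_finset hdisj fun x _ => measurableSet_ball] at hvol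
  simp only [μ.addHaar_ball_of_pos _ hδ, μ.addHaar_ball_of_pos _ hr, Finset.sum_const,
    nsmul_eq_mul, ← mul_assoc] at hvol
  have hcard := ENNReal.toReal_le_of_le_ofReal (by positivity)
    ((ENNReal.mul_le_mul_iff_left (Metric.measure_ball_pos _ _ zero_lt_one).ne'
      measure_ball_lt_top.ne).1 hvol)
  rw [ENNReal.toReal_mul, ENNReal.toReal_natCast, ENNReal.toReal_ofReal (by positivity),
    ← le_div_iff₀ (by positivity), ← div_pow] at hcard
  refine hcard.trans_eq (congrArg (· ^ _) ?_)
  field_simp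
  ring

/-- The unit ball has a finite `ε`-net of cardinality at most `(1 + 2 / ε) ^ dim`. -/
theorem exists_finset_net_unit_ball (E : Type*) [NormedAddCommGroup E] [NormedSpace ℝ E]
    [FiniteDimensional ℝ E] {ε : ℝ} (hε : 0 < ε) :
    ∃ s : Finset E, s.Nonempty ∧ (∀ x ∈ s, ‖x‖ ≤ 1) ∧
      (∀ x : E, ‖x‖ ≤ 1 → ∃ y ∈ s, dist y x < ε) ∧
      (s.card : ℝ) ≤ (1 + 2 / ε) ^ Module.finrank ℝ E := by
  classical
  let A : Set ℕ := {k | ∃ s : Finset E, s.card = k ∧ (∀ x ∈ s, ‖x‖ ≤ 1) ∧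
    ∀ x ∈ s, ∀ y ∈ s, x ≠ y → ε ≤ dist x y}
  have hbdd : BddAbove A := by
    refine ⟨⌊(1 + 2 / ε) ^ Module.finrank ℝ E⌋₊, ?_⟩
    rintro _ ⟨s, rfl, hs, hsep⟩
    exact Nat.le_floor (card_le_of_separated_unit_ball hε s hs hsep)
  obtain ⟨s, hcard, hs, hsep⟩ := Nat.sSup_mem (s := A) ⟨0, ∅, by simp⟩ hbdd
  have hnet : ∀ x : E, ‖x‖ ≤ 1 → ∃ y ∈ s, dist y x < ε := by
    intro x hx
    by_contra! hfar
    have hxs : x ∉ s := fun hxs => by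
      have := hfar x hxs
      rw [dist_self] at this
      linarith
    have hmem : s.card + 1 ∈ A := by
      refine ⟨insert x s, Finset.card_insert_of_notMem hxs, ?_, ?_⟩
      · intro y hy
        rcases Finset.mem_insert.1 hy with rfl | hy
        exacts [hx, hs y hy]
      · intro y hy z hz hyz
        rw [Finset.mem_insert] at hy hz
        rcases hy with hy | hy <;> rcases hz with hz | hz
        · exact absurd (hy.trans hz.symm) hyz
        · rw [hy, dist_comm]; exact hfar z hz
        · rw [hz]; exact hfar y hy
        · exact hsep y hy z hz hyz
    have := le_csSup hbdd hmem
    omega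
  obtain ⟨y, hy, -⟩ := hnet 0 (by simp)
  exact ⟨s, ⟨y, hy⟩, hs, hnet, card_le_of_separated_unit_ball hε s hs hsep⟩

/-- Projection onto a finite net can be chosen measurably. -/
theorem exists_measurable_net_index {X : Type*} [PseudoMetricSpace X] [MeasurableSpace X]
    [OpensMeasurableSpace X] {M : ℕ} (e : Fin (M + 1) → X) :
    ∃ idx : X → Fin (M + 1), Measurable idx ∧ ∀ x k, dist (e (idx x)) x ≤ dist (e k) x := by
  let e' : ℕ → X := fun k => e (Fin.ofNat (M + 1) k)
  have he' : ∀ k : Fin (M + 1), e' k = e k := fun k => by simp [e']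
  refine ⟨fun x => Fin.ofNat (M + 1) (SimpleFunc.nearestPtInd e' M x), ?_, fun x k => ?_⟩
  · exact (measurable_of_countable (Fin.ofNat (M + 1))).comp (SimpleFunc.nearestPtInd e' M).measurable
  · have hle := SimpleFunc.edist_nearestPt_le e' x (Nat.lt_succ_iff.1 k.2)
    rw [he', edist_dist, edist_dist, ENNReal.ofReal_le_ofReal_iff dist_nonneg] at hle
    exact hle

/-- Maximum likelihood decoding among finitely many hypotheses, with `u i z` the square root of
the probability of `z` under hypothesis `i`: the error probability is bounded through the
pairwise Bhattacharyya coefficients. -/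
theorem exists_decoder {ι Z : Type*} [Fintype ι] [Nonempty ι] [DecidableEq ι] [Fintype Z] (n : ℕ)
    (u : ι → Z → ℝ) (hu : ∀ i z, 0 ≤ u i z) {ρ : ℝ} (hρ0 : 0 ≤ ρ)
    (hρ : ∀ i j, i ≠ j → ∑ z, u i z * u j z ≤ ρ) :
    ∃ dec : (Fin n → Z) → ι, ∀ i,
      ∑ z, (if dec z = i then 0 else ∏ k, u i (z k) ^ 2) ≤ Fintype.card ι * ρ ^ n := by
  have hmax : ∀ z : Fin n → Z, ∃ i, ∀ j, ∏ k, u j (z k) ≤ ∏ k, u i (z k) := fun z => by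
    obtain ⟨i, -, hi⟩ := Finset.exists_max_image Finset.univ (fun i => ∏ k, u i (z k))
      Finset.univ_nonempty
    exact ⟨i, fun j => hi j (Finset.mem_univ j)⟩
  choose dec hdec using hmax
  have hprod : ∀ i (z : Fin n → Z), 0 ≤ ∏ k, u i (z k) :=
    fun i z => Finset.prod_nonneg fun k _ => hu i (z k)
  refine ⟨dec, fun i => ?_⟩
  have hpt : ∀ z : Fin n → Z, (if dec z = i then 0 else ∏ k, u i (z k) ^ 2) ≤
      ∑ j ∈ Finset.univ.erase i, ∏ k, (u i (z k) * u j (z k)) := by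
    intro z
    have hnn : ∀ j ∈ Finset.univ.erase i, 0 ≤ ∏ k, (u i (z k) * u j (z k)) := fun j _ => by
      rw [Finset.prod_mul_distrib]
      exact mul_nonneg (hprod _ _) (hprod _ _)
    split_ifs with h
    · exact Finset.sum_nonneg hnn
    · refine le_trans ?_ (Finset.single_le_sum hnn (Finset.mem_erase.2 ⟨h, Finset.mem_univ _⟩))
      rw [Finset.prod_pow, Finset.prod_mul_distrib, sq]
      exact mul_le_mul_of_nonneg_left (hdec z i) (hprod _ _)
  calc ∑ z, (if dec z = i then 0 else ∏ k, u i (z k) ^ 2)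
      ≤ ∑ z : Fin n → Z, ∑ j ∈ Finset.univ.erase i, ∏ k, (u i (z k) * u j (z k)) :=
        Finset.sum_le_sum fun z _ => hpt z
    _ = ∑ j ∈ Finset.univ.erase i, (∑ z, u i z * u j z) ^ n := by
        rw [Finset.sum_comm]
        exact Finset.sum_congr rfl fun j _ =>
          (Fintype.sum_pow (fun z => u i z * u j z) n).symm
    _ ≤ ∑ j ∈ Finset.univ.erase i, ρ ^ n := by
        refine Finset.sum_le_sum fun j hj => pow_le_pow_left₀ ?_ ?_ n
        · exact Finset.sum_nonneg fun z _ => mul_nonneg (hu i z) (hu j z)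
        · exact hρ i j (Finset.ne_of_mem_erase hj).symm
    _ ≤ Fintype.card ι * ρ ^ n := by
        rw [Finset.sum_const, nsmul_eq_mul]
        exact mul_le_mul_of_nonneg_right (by exact_mod_cast Finset.card_le_univ _)
          (pow_nonneg hρ0 n)

/-- Random hashing: for a finite set of hypotheses there are probability weights `u i z ^ 2` whose
likelihood ratios are at most `c ^ 4` and whose pairwise Bhattacharyya coefficients are
`(2 / (c + c⁻¹)) ^ 2`. -/
theorem exists_hashing_weights (ι : Type*) [Fintype ι] [DecidableEq ι] {c : ℝ} (hc : 1 ≤ c) :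
    ∃ (N : ℕ) (u : ι → Fin N → ℝ), (∀ i z, 0 ≤ u i z) ∧ (∀ i, ∑ z, u i z ^ 2 = 1) ∧
      (∀ i j, i ≠ j → ∑ z, u i z * u j z = (2 / (c + c⁻¹)) ^ 2) ∧
      ∀ i j z, u i z ^ 2 ≤ c ^ 4 * u j z ^ 2 := by
  have hc0 : 0 < c := by linarith
  let f : Bool → ℝ := fun b => if b then c else c⁻¹
  let p : Bool → ℝ := fun b => f (!b) / (c + c⁻¹)
  have hf : ∀ b, 0 < f b := by rintro (_ | _) <;> simp [f, hc0]
  have hp : ∀ b, 0 ≤ p b := fun b => div_nonneg (hf _).le (by positivity)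
  have hp0 : ∑ b, p b = 1 := by simp [p, f]; field_simp; ring
  have hp1 : ∑ b, p b * f b = 2 / (c + c⁻¹) := by simp [p, f]; field_simp; ring
  have hp2 : ∑ b, p b * (f b * f b) = 1 := by simp [p, f]; field_simp
  let P : (ι → Bool) → ℝ := fun z => ∏ l, p (z l)
  have hP : ∀ z, 0 ≤ P z := fun z => Finset.prod_nonneg fun l _ => hp (z l)
  have hsum : ∀ i j, ∑ z, P z * (f (z i) * f (z j)) =
      ∏ l, ∑ b, p b * ((if l = i then f b else 1) * (if l = j then f b else 1)) := by
    intro i j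
    rw [Finset.prod_univ_sum, Fintype.piFinset_univ]
    refine Finset.sum_congr rfl fun z _ => ?_
    rw [Finset.prod_mul_distrib, Finset.prod_mul_distrib]
    simp [P]
  let u : ι → (ι → Bool) → ℝ := fun i z => √(P z) * f (z i)
  have huu : ∀ i j z, u i z * u j z = P z * (f (z i) * f (z j)) := fun i j z => by
    rw [mul_mul_mul_comm, Real.mul_self_sqrt (hP z)]
  let e := Fintype.equivFin (ι → Bool)
  refine ⟨_, fun i z => u i (e.symm z), fun i z => mul_nonneg (Real.sqrt_nonneg _) (hf _).le,
    fun i => ?_, fun i j hij => ?_, fun i j z => ?_⟩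
  · rw [Equiv.sum_comp e.symm (fun z => u i z ^ 2)]
    simp only [sq, huu, hsum]
    refine Finset.prod_eq_one fun l _ => ?_
    by_cases h : l = i
    · simpa only [h, if_true] using hp2
    · simpa only [h, if_false, mul_one, one_mul] using hp0
  · rw [Equiv.sum_comp e.symm (fun z => u i z * u j z)]
    simp only [huu, hsum]
    have hfac : ∀ l, ∑ b, p b * ((if l = i then f b else 1) * (if l = j then f b else 1)) =
        (if l = i then 2 / (c + c⁻¹) else 1) * (if l = j then 2 / (c + c⁻¹) else 1) := by
      intro l
      by_cases hi : l = i
      · have hj : l ≠ j := fun hj => hij (hi.symm.trans hj)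
        simpa only [hi, hj, hij, if_true, if_false, mul_one] using hp1
      · by_cases hj : l = j
        · simpa only [hj, hij.symm, if_true, if_false, one_mul] using hp1
        · simpa only [hi, hj, if_false, mul_one] using hp0
    simp only [hfac, Finset.prod_mul_distrib, Finset.prod_ite_eq', Finset.mem_univ, if_true, sq]
  · have hf_le : ∀ b b', f b ≤ c ^ 2 * f b' := by
      have hinv : c⁻¹ ≤ 1 := inv_le_one_of_one_le₀ hc
      have hcc : c ^ 2 * c⁻¹ = c := by field_simp
      rintro (_ | _) (_ | _) <;> simp only [f, hcc, if_true, Bool.false_eq_true, if_false] <;>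
        nlinarith [mul_self_nonneg c]
    simp only [sq (u _ _), huu]
    have := mul_le_mul (hf_le (e.symm z i) (e.symm z j)) (hf_le (e.symm z i) (e.symm z j))
      (hf _).le (mul_nonneg (sq_nonneg c) (hf _).le)
    calc _ ≤ P (e.symm z) * (c ^ 2 * f (e.symm z j) * (c ^ 2 * f (e.symm z j))) :=
          mul_le_mul_of_nonneg_left this (hP _)
      _ = _ := by ring

theorem one_add_sq_div_two_le_cosh_of_nonneg {x : ℝ} (hx : 0 ≤ x) : 1 + x ^ 2 / 2 ≤ cosh x := by
  have h1 : x / 2 ≤ sinh (x / 2) := self_le_sinh_iff.2 (by linarith)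
  have h2 := cosh_two_mul (x / 2)
  rw [cosh_sq, mul_div_cancel₀ x two_ne_zero] at h2
  nlinarith

theorem exp_min_le_cosh {α : ℝ} (hα : 0 < α) : exp (min α (α ^ 2) / 40) ≤ cosh (α / 4) := by
  by_cases hlarge : 40 ≤ α
  · have hexp : 2 ≤ exp (α * (9 / 40)) := by linarith [add_one_le_exp (α * (9 / 40))]
    calc exp (min α (α ^ 2) / 40) ≤ exp (α / 40) := by gcongr; exact min_le_left _ _
      _ ≤ exp (α / 40) * exp (α * (9 / 40)) / 2 := by nlinarith [exp_pos (α / 40)]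
      _ = exp (α / 4) / 2 := by rw [← exp_add]; ring_nf
      _ ≤ cosh (α / 4) := by rw [cosh_eq]; linarith [exp_pos (-(α / 4))]
  · set m := min α (α ^ 2)
    have hm0 : 0 < m := by positivity
    have hm1 : m ≤ α := min_le_left _ _
    have hm2 : m ≤ α ^ 2 := min_le_right _ _
    have hexp := (abs_le.1 (abs_exp_sub_one_sub_id_le (x := m / 40)
      (by rw [abs_of_pos (by positivity)]; linarith))).2
    have hcosh := one_add_sq_div_two_le_cosh_of_nonneg (x := α / 4) (by positivity)
    nlinarith [mul_self_le_mul_self hm0.le hm1]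

/-- The square-loss risk of a decoder followed by a net lookup, in terms of its error probability. -/
theorem lintegral_sq_dist_pi_le {ι E : Type*} [NormedAddCommGroup E] [DecidableEq ι] {N n : ℕ}
    (w : Fin N → ℝ) (hw : ∀ z, 0 ≤ w z) (hw1 : ∑ z, w z = 1)
    (ν : Measure (Fin N)) [IsProbabilityMeasure ν] (hν : ∀ z, ν {z} = ENNReal.ofReal (w z))
    (dec : (Fin n → Fin N) → ι) (e : ι → E) (he : ∀ i, ‖e i‖ ≤ 1) {θ : E} (hθ : ‖θ‖ ≤ 1)
    (i : ι) {ε : ℝ} (hi : dist (e i) θ ≤ ε) :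
    (∫⁻ z, ENNReal.ofReal (‖e (dec z) - θ‖ ^ 2) ∂(Measure.pi fun _ : Fin n => ν)) ≤
      ENNReal.ofReal (ε ^ 2 + 4 * ∑ z, (if dec z = i then 0 else ∏ k, w (z k))) := by
  have hprod : ∀ z : Fin n → Fin N, 0 ≤ ∏ k, w (z k) :=
    fun z => Finset.prod_nonneg fun k _ => hw (z k)
  have hterm : ∀ z : Fin n → Fin N,
      ENNReal.ofReal (‖e (dec z) - θ‖ ^ 2) * Measure.pi (fun _ : Fin n => ν) {z} =
        ENNReal.ofReal (‖e (dec z) - θ‖ ^ 2 * ∏ k, w (z k)) := fun z => by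
    rw [Measure.pi_singleton, ENNReal.ofReal_mul (sq_nonneg _),
      ENNReal.ofReal_prod_of_nonneg fun k _ => hw (z k)]
    simp only [hν]
  rw [lintegral_fintype, Finset.sum_congr rfl fun z _ => hterm z,
    ← ENNReal.ofReal_sum_of_nonneg fun z _ => mul_nonneg (sq_nonneg _) (hprod z)]
  refine ENNReal.ofReal_le_ofReal ?_
  have hpt : ∀ z, ‖e (dec z) - θ‖ ^ 2 * ∏ k, w (z k) ≤
      ε ^ 2 * ∏ k, w (z k) + 4 * (if dec z = i then 0 else ∏ k, w (z k)) := by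
    intro z
    split_ifs with h
    · rw [h, ← dist_eq_norm, mul_zero, add_zero]
      exact mul_le_mul_of_nonneg_right (pow_le_pow_left₀ dist_nonneg hi 2) (hprod z)
    · have hnorm : ‖e (dec z) - θ‖ ^ 2 ≤ 2 ^ 2 :=
        pow_le_pow_left₀ (norm_nonneg _) (by linarith [norm_sub_le (e (dec z)) θ, he (dec z)]) 2
      nlinarith [mul_le_mul_of_nonneg_right hnorm (hprod z),
        mul_nonneg (sq_nonneg ε) (hprod z)]
  refine (Finset.sum_le_sum fun z _ => hpt z).trans_eq ?_
  rw [Finset.sum_add_distrib, ← Finset.mul_sum, ← Finset.mul_sum, ← Fintype.sum_pow, hw1,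
    one_pow, mul_one]

/-- The mean squared error budget: net size times error probability. -/
theorem net_card_mul_error_le {d n : ℕ} (hd : 1 ≤ d) {m ρ K t : ℝ} (ht : 1 < t)
    (htm : 60 * d * t = n * m) (hρ0 : 0 ≤ ρ) (hρ : ρ ≤ exp (-(m / 20)))
    (hK : K ≤ (1 + 2 / exp (-(t / 2))) ^ d) : K * ρ ^ n ≤ exp (-t) := by
  have hbase : 1 + 2 / exp (-(t / 2)) ≤ exp (2 * t) := by
    have h1 : 1 ≤ exp (t / 2) := one_le_exp (by linarith)
    have h2 : 3 ≤ exp (3 / 2 * t) := by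
      have := quadratic_le_exp_of_nonneg (x := 3 / 2 * t) (by linarith)
      nlinarith
    have h3 : exp (2 * t) = exp (3 / 2 * t) * exp (t / 2) := by rw [← exp_add]; ring_nf
    rw [exp_neg, div_inv_eq_mul, h3]
    nlinarith
  have hρn : ρ ^ n ≤ exp (-(3 * t)) ^ d := by
    refine (pow_le_pow_left₀ hρ0 hρ n).trans_eq ?_
    rw [← exp_nat_mul, ← exp_nat_mul]
    congr 1
    linarith
  calc K * ρ ^ n ≤ exp (2 * t) ^ d * exp (-(3 * t)) ^ d :=
        mul_le_mul (hK.trans (pow_le_pow_left₀ (by positivity) hbase d)) hρn (by positivity)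
          (by positivity)
    _ = exp (-t) ^ d := by rw [← mul_pow, ← exp_add]; ring_nf
    _ ≤ exp (-t) := pow_le_of_le_one (exp_pos _).le (exp_le_one_iff.2 (by linarith)) (by omega)

/-- Explicit infinite-`T` upper bound for mean estimation on the Euclidean unit ball
(the upper bound of Proposition 1(ii) with explicit constants). -/
theorem mean_l2ball_infiniteT_upper
    (d n : ℕ) (hd : 1 ≤ d) (hn : 1 ≤ n) (α : ℝ) (hα : 0 < α)
    (h : 60 * (d : ℝ) < (n : ℝ) * min α (α ^ 2)) :
    ∃ (N : ℕ) (Q : EuclideanSpace ℝ (Fin d) → Measure (Fin N))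
      (θhat : (Fin n → Fin N) → EuclideanSpace ℝ (Fin d)),
      Measurable Q ∧ (∀ θ, IsProbabilityMeasure (Q θ)) ∧
      IsLDPOn Q α (Metric.closedBall (0 : EuclideanSpace ℝ (Fin d)) 1) ∧
      ∀ θ ∈ Metric.closedBall (0 : EuclideanSpace ℝ (Fin d)) 1,
        (∫⁻ z, ENNReal.ofReal (‖θhat z - θ‖ ^ 2) ∂(Measure.pi fun _ : Fin n => Q θ))
          ≤ ENNReal.ofReal (13 * Real.exp (-((n : ℝ) * min α (α ^ 2)) / (60 * d))) := by
  set m := min α (α ^ 2)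
  have hd0 : (0 : ℝ) < d := by exact_mod_cast hd
  set t : ℝ := n * m / (60 * d) with ht_def
  have ht : 1 < t := by rw [ht_def, lt_div_iff₀ (by positivity)]; linarith
  have htm : 60 * d * t = n * m := by rw [ht_def]; field_simp
  obtain ⟨s, hs_ne, hs_ball, hs_net, hs_card⟩ :=
    exists_finset_net_unit_ball (EuclideanSpace ℝ (Fin d)) (exp_pos (-(t / 2)))
  rw [finrank_euclideanSpace_fin] at hs_card
  obtain ⟨M, hM⟩ := Nat.exists_eq_succ_of_ne_zero hs_ne.card_pos.ne'
  let e : Fin (M + 1) → EuclideanSpace ℝ (Fin d) := fun k => (s.equivFinOfCardEq hM).symm k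
  have he : ∀ k, ‖e k‖ ≤ 1 := fun k => hs_ball _ (Subtype.mem _)
  obtain ⟨idx, hidx_meas, hidx⟩ := exists_measurable_net_index e
  have hidx_near : ∀ θ, ‖θ‖ ≤ 1 → dist (e (idx θ)) θ ≤ exp (-(t / 2)) := fun θ hθ => by
    obtain ⟨y, hy, hyθ⟩ := hs_net θ hθ
    have := hidx θ (s.equivFinOfCardEq hM ⟨y, hy⟩)
    simp only [e, Equiv.symm_apply_apply] at this
    exact this.trans hyθ.le
  obtain ⟨N, u, hu0, hu1, hu_bhatt, hu_ratio⟩ :=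
    exists_hashing_weights (Fin (M + 1)) (c := exp (α / 4)) (one_le_exp (by positivity))
  set ρ : ℝ := (2 / (exp (α / 4) + (exp (α / 4))⁻¹)) ^ 2 with hρ_def
  have hρ : ρ ≤ exp (-(m / 20)) := by
    have hcosh : 2 / (exp (α / 4) + (exp (α / 4))⁻¹) = (cosh (α / 4))⁻¹ := by
      rw [cosh_eq, exp_neg, inv_div]
    have hsq : exp (-(m / 20)) = (exp (m / 40))⁻¹ ^ 2 := by
      rw [← exp_neg, ← exp_nat_mul]
      congr 1
      push_cast
      ring
    rw [hρ_def, hcosh, hsq]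
    exact pow_le_pow_left₀ (inv_nonneg.2 (cosh_pos _).le)
      (inv_anti₀ (exp_pos _) (exp_min_le_cosh hα)) 2
  obtain ⟨dec, hdec⟩ := exists_decoder n u hu0 (sq_nonneg _) fun i j hij => (hu_bhatt i j hij).le
  let ν : Fin (M + 1) → Measure (Fin N) :=
    fun i => Measure.count.withDensity fun z => ENNReal.ofReal (u i z ^ 2)
  have hν : ∀ i z, ν i {z} = ENNReal.ofReal (u i z ^ 2) := fun i z => by
    simp [ν, withDensity_apply]
  have hν_prob : ∀ i, IsProbabilityMeasure (ν i) := fun i => ⟨by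
    rw [withDensity_apply _ MeasurableSet.univ, Measure.restrict_univ, lintegral_count,
      tsum_fintype, ← ENNReal.ofReal_sum_of_nonneg fun z _ => sq_nonneg _, hu1,
      ENNReal.ofReal_one]⟩
  refine ⟨N, fun θ => ν (idx θ), fun z => e (dec z), (measurable_of_countable ν).comp hidx_meas,
    fun θ => hν_prob _, fun S hS x _ x' _ => ?_, fun θ hθ => ?_⟩
  · rw [withDensity_apply _ hS, withDensity_apply _ hS,
      ← lintegral_const_mul _ (measurable_of_countable _)]
    refine lintegral_mono fun z => ?_
    rw [← ENNReal.ofReal_mul (exp_pos _).le]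
    refine ENNReal.ofReal_le_ofReal ((hu_ratio (idx x) (idx x') z).trans_eq ?_)
    rw [← exp_nat_mul]
    congr 2
    push_cast
    ring
  · have hθ1 : ‖θ‖ ≤ 1 := mem_closedBall_zero_iff.1 hθ
    refine (lintegral_sq_dist_pi_le (fun z => u (idx θ) z ^ 2) (fun z => sq_nonneg _)
      (hu1 _) (ν (idx θ)) (hν _) dec e he hθ1 (idx θ) (hidx_near θ hθ1)).trans
      (ENNReal.ofReal_le_ofReal ?_)
    have herr := hdec (idx θ)
    rw [Fintype.card_fin] at herr
    rw [hM] at hs_card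
    have hbudget := net_card_mul_error_le hd ht htm (sq_nonneg _) hρ hs_card
    have hε : exp (-(t / 2)) ^ 2 = exp (-t) := by
      rw [← exp_nat_mul]
      congr 1
      push_cast
      ring
    rw [hε, neg_div, ← ht_def]
    linarith [exp_pos (-t)]
end

section
/- T-independent lower bound for user-level locally private univariate mean estimation (inequality (9) of Example 1, non-interactive case). Let α ∈ (0,1], let n, T ≥ 1 be integers and let Z be a measurable space. For θ ∈ {0,1}, let x^θ = (θ, θ, …, θ) ∈ ℝ^T be the constant vector (the sample of a user drawing T i.i.d. observations from the point mass δ_θ; both point masses have mean in [−1,1]). Then for every family of Markov kernels Q_1, …, Q_n from ℝ^T to Z, each α-LDP on [−1,1]^T, and every measurable estimator θ̂ : Z^n → ℝ, max_{θ ∈ {0,1}} ∫ (θ̂(z) − θ)² d(⊗_{i=1}^n Q_i(x^θ))(z) ≥ (1/4)·exp(−12·n·α²). In particular the risk does not vanish as T → ∞ for fixed n and α. -/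
open MeasureTheory Real
open scoped ENNReal

open ProbabilityTheory in
theorem MeasureTheory.lintegral_pi_prod_eq_prod_lintegral {ι : Type*} [Fintype ι] {X : ι → Type*}
    [∀ i, MeasurableSpace (X i)] (μ : ∀ i, Measure (X i)) [∀ i, IsProbabilityMeasure (μ i)]
    {f : ∀ i, X i → ℝ≥0∞} (hf : ∀ i, Measurable (f i)) :
    ∫⁻ z, ∏ i, f i (z i) ∂(Measure.pi μ) = ∏ i, ∫⁻ x, f i x ∂(μ i) := by
  have h_indep : iIndepFun (fun i (z : ∀ i, X i) => f i (z i)) (Measure.pi μ) :=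
    iIndepFun_pi fun i => (hf i).aemeasurable
  rw [lintegral_prod_eq_prod_lintegral_of_indepFun Finset.univ _ h_indep
    fun i => (hf i).comp (measurable_pi_apply i)]
  exact Finset.prod_congr rfl fun i _ => (measurePreserving_eval μ i).lintegral_comp (hf i)

theorem MeasureTheory.Measure.pi_withDensity {ι : Type*} [Fintype ι] {X : ι → Type*}
    [∀ i, MeasurableSpace (X i)] (μ : ∀ i, Measure (X i)) [∀ i, IsProbabilityMeasure (μ i)]
    {f : ∀ i, X i → ℝ≥0∞} (hf : ∀ i, Measurable (f i))
    [∀ i, SigmaFinite ((μ i).withDensity (f i))] :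
    Measure.pi (fun i => (μ i).withDensity (f i))
      = (Measure.pi μ).withDensity fun z => ∏ i, f i (z i) := by
  refine Measure.pi_eq fun s hs => ?_
  rw [withDensity_apply _ (MeasurableSet.univ_pi hs),
    ← lintegral_indicator (MeasurableSet.univ_pi hs)]
  have h_ind : (Set.univ.pi s).indicator (fun z => ∏ i, f i (z i))
      = fun z => ∏ i, (s i).indicator (f i) (z i) := by
    ext z
    by_cases hz : z ∈ Set.univ.pi s
    · rw [Set.indicator_of_mem hz]
      exact Finset.prod_congr rfl fun i _ =>
        (Set.indicator_of_mem (hz i (Set.mem_univ i)) _).symm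
    · rw [Set.indicator_of_notMem hz]
      obtain ⟨i, hi⟩ : ∃ i, z i ∉ s i := by simpa using hz
      exact (Finset.prod_eq_zero (Finset.mem_univ i) (Set.indicator_of_notMem hi _)).symm
  rw [h_ind, lintegral_pi_prod_eq_prod_lintegral μ fun i => (hf i).indicator (hs i)]
  exact Finset.prod_congr rfl fun i _ => by
    rw [lintegral_indicator (hs i), withDensity_apply _ (hs i)]

/-- If two probability measures are within a factor `exp α` of each other, then the second moment
of their likelihood ratio is at most `exp (α ^ 2)`. -/
theorem lintegral_rnDeriv_sq_le_exp_sq {Z : Type*} [MeasurableSpace Z] (μ ν : Measure Z)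
    [IsProbabilityMeasure μ] [IsProbabilityMeasure ν] (α : ℝ)
    (hμν : ∀ S, MeasurableSet S → μ S ≤ ENNReal.ofReal (exp α) * ν S)
    (hνμ : ∀ S, MeasurableSet S → ν S ≤ ENNReal.ofReal (exp α) * μ S) :
    ∫⁻ z, μ.rnDeriv ν z ^ 2 ∂ν ≤ ENNReal.ofReal (exp (α ^ 2)) := by
  have hac : μ ≪ ν := Measure.AbsolutelyContinuous.mk fun S hS h0 => by
    simpa [h0] using hμν S hS
  have h_upper : μ.rnDeriv ν ≤ᵐ[ν] fun _ => ENNReal.ofReal (exp α) := by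
    refine ae_le_of_forall_setLIntegral_le_of_sigmaFinite (μ.measurable_rnDeriv ν) fun S hS _ => ?_
    rw [Measure.setLIntegral_rnDeriv hac, setLIntegral_const]
    exact hμν S hS
  have h_lower : (fun _ => ENNReal.ofReal (exp (-α))) ≤ᵐ[ν] μ.rnDeriv ν := by
    refine ae_le_of_forall_setLIntegral_le_of_sigmaFinite measurable_const fun S hS _ => ?_
    rw [Measure.setLIntegral_rnDeriv hac, setLIntegral_const]
    calc ENNReal.ofReal (exp (-α)) * ν S
        ≤ ENNReal.ofReal (exp (-α)) * (ENNReal.ofReal (exp α) * μ S) := by gcongr; exact hνμ S hS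
      _ = μ S := by
        rw [← mul_assoc, ← ENNReal.ofReal_mul (exp_pos _).le, ← Real.exp_add]
        simp
  have h_le : ∫⁻ z, (μ.rnDeriv ν z ^ 2 + 1) ∂ν
      ≤ ∫⁻ z, ENNReal.ofReal (exp α + exp (-α)) * μ.rnDeriv ν z ∂ν := by
    refine lintegral_mono_ae ?_
    filter_upwards [h_upper, h_lower] with z hz_upper hz_lower
    have h_top : μ.rnDeriv ν z ≠ ⊤ := ne_top_of_le_ne_top ENNReal.ofReal_ne_top hz_upper
    lift μ.rnDeriv ν z to NNReal using h_top with r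
    rw [← ENNReal.ofReal_coe_nnreal] at hz_upper hz_lower ⊢
    rw [ENNReal.ofReal_le_ofReal_iff (exp_pos _).le] at hz_upper
    rw [ENNReal.ofReal_le_ofReal_iff r.coe_nonneg] at hz_lower
    rw [← ENNReal.ofReal_pow r.coe_nonneg, ← ENNReal.ofReal_one,
      ← ENNReal.ofReal_add (by positivity) zero_le_one, ← ENNReal.ofReal_mul (by positivity)]
    refine ENNReal.ofReal_le_ofReal ?_
    have h_inv : exp α * exp (-α) = 1 := by rw [← Real.exp_add]; simp
    nlinarith [mul_nonneg (sub_nonneg.2 hz_upper) (sub_nonneg.2 hz_lower)]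
  rw [lintegral_add_right _ measurable_const, lintegral_const_mul _ (μ.measurable_rnDeriv ν),
    Measure.lintegral_rnDeriv hac] at h_le
  simp only [lintegral_const, measure_univ, mul_one] at h_le
  have h_exp : exp α + exp (-α) ≤ exp (α ^ 2) + 1 := by
    have h_cosh := Real.cosh_le_exp_half_sq α
    rw [Real.cosh_eq] at h_cosh
    have h_sq : exp (α ^ 2) = exp (α ^ 2 / 2) ^ 2 := by
      rw [← Real.exp_nat_mul]; congr 1; push_cast; ring
    nlinarith [sq_nonneg (exp (α ^ 2 / 2) - 1)]
  refine (ENNReal.add_le_add_iff_right ENNReal.one_ne_top).1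
    (h_le.trans ((ENNReal.ofReal_le_ofReal h_exp).trans_eq ?_))
  rw [ENNReal.ofReal_add (exp_pos _).le zero_le_one, ENNReal.ofReal_one]

/-- Le Cam type two-point bound for the squared loss: if `μ` has density `f` with respect to `ν` and
the second moment of `f` is at most `M`, the two risks sum to at least `1 / (1 + M)`. -/
theorem ofReal_one_div_one_add_le_lintegral_add_lintegral {Ω : Type*} [MeasurableSpace Ω]
    (ν : Measure Ω) {f : Ω → ℝ≥0∞} (hf : Measurable f) (hf_one : ∫⁻ z, f z ∂ν = 1)
    {M : ℝ} (hM : 0 ≤ M) (hf_sq : ∫⁻ z, f z ^ 2 ∂ν ≤ ENNReal.ofReal M)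
    {g : Ω → ℝ} (hg : Measurable g) :
    ENNReal.ofReal (1 / (1 + M)) ≤ ∫⁻ z, ENNReal.ofReal ((g z - 0) ^ 2) ∂(ν.withDensity f)
      + ∫⁻ z, ENNReal.ofReal ((g z - 1) ^ 2) ∂ν := by
  set c : ℝ := 1 / (1 + M) ^ 2 with hc
  set d : ℝ := (1 + 2 * M) / (1 + M) ^ 2 with hd
  have hc_pos : 0 < c := by positivity
  have hd_nonneg : 0 ≤ d := by positivity
  have h_point : ∀ z, ENNReal.ofReal d * f z ≤ f z * ENNReal.ofReal ((g z - 0) ^ 2)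
      + ENNReal.ofReal ((g z - 1) ^ 2) + ENNReal.ofReal c * f z ^ 2 := by
    intro z
    by_cases h_top : f z = ⊤
    · have h_ne : ENNReal.ofReal c ≠ 0 := by simpa using hc_pos
      simp [h_top, ENNReal.mul_top h_ne]
    lift f z to NNReal using h_top with r
    rw [← ENNReal.ofReal_coe_nnreal, ← ENNReal.ofReal_mul hd_nonneg,
      ← ENNReal.ofReal_mul r.coe_nonneg, ← ENNReal.ofReal_pow r.coe_nonneg,
      ← ENNReal.ofReal_mul hc_pos.le, ← ENNReal.ofReal_add (by positivity) (by positivity),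
      ← ENNReal.ofReal_add (by positivity) (by positivity)]
    refine ENNReal.ofReal_le_ofReal ?_
    have hr : (0 : ℝ) ≤ r := r.coe_nonneg
    generalize (r : ℝ) = r at hr
    have h_min : r / (1 + r) ≤ r * (g z - 0) ^ 2 + (g z - 1) ^ 2 := by
      rw [div_le_iff₀ (by positivity)]
      nlinarith [sq_nonneg ((1 + r) * g z - 1)]
    have h_tangent : d * r - c * r ^ 2 ≤ r / (1 + r) := by
      have h_diff : r / (1 + r) - (d * r - c * r ^ 2)
          = r * (r - M) ^ 2 / ((1 + r) * (1 + M) ^ 2) := by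
        rw [hc, hd]; field_simp; ring
      have : 0 ≤ r * (r - M) ^ 2 / ((1 + r) * (1 + M) ^ 2) := by positivity
      linarith
    linarith
  have h_int := lintegral_mono (μ := ν) h_point
  rw [lintegral_const_mul _ hf, hf_one, mul_one, lintegral_add_left (by fun_prop),
    lintegral_add_left (by fun_prop), lintegral_const_mul _ (by fun_prop)] at h_int
  rw [lintegral_withDensity_eq_lintegral_mul _ hf (by fun_prop)]
  have h_bound : ENNReal.ofReal c * ∫⁻ z, f z ^ 2 ∂ν ≤ ENNReal.ofReal (c * M) := by
    rw [ENNReal.ofReal_mul hc_pos.le]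
    gcongr
  have h_split : d = 1 / (1 + M) + c * M := by rw [hc, hd]; field_simp; ring
  rw [h_split, ENNReal.ofReal_add (by positivity) (by positivity)] at h_int
  exact (ENNReal.add_le_add_iff_right ENNReal.ofReal_ne_top).1
    (h_int.trans (add_le_add_right h_bound _))

/-- `T`-independent lower bound for user-level locally private univariate mean estimation
(inequality (9) of Example 1, non-interactive case). -/
theorem univariate_T_independent_lower
    {Z : Type*} [MeasurableSpace Z]
    (α : ℝ) (hα0 : 0 < α) (hα1 : α ≤ 1) (n T : ℕ) (hn : 1 ≤ n) (hT : 1 ≤ T)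
    (Q : Fin n → (Fin T → ℝ) → Measure Z)
    (hQmeas : ∀ i, Measurable (Q i)) (hQprob : ∀ i x, IsProbabilityMeasure (Q i x))
    (hQLDP : ∀ i, IsLDPOn (Q i) α {x : Fin T → ℝ | ∀ t, x t ∈ Set.Icc (-1 : ℝ) 1})
    (θhat : (Fin n → Z) → ℝ) (hθhat : Measurable θhat) :
    ENNReal.ofReal ((1 / 4) * Real.exp (-(12 * (n : ℝ) * α ^ 2)))
      ≤ max
          (∫⁻ z, ENNReal.ofReal ((θhat z - 0) ^ 2)
            ∂(Measure.pi fun i : Fin n => Q i fun _ => (0 : ℝ)))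
          (∫⁻ z, ENNReal.ofReal ((θhat z - 1) ^ 2)
            ∂(Measure.pi fun i : Fin n => Q i fun _ => (1 : ℝ))) := by
  have h_mem : ∀ c ∈ Set.Icc (-1 : ℝ) 1,
      (fun _ => c) ∈ {x : Fin T → ℝ | ∀ t, x t ∈ Set.Icc (-1 : ℝ) 1} := fun c hc _ => hc
  have h_mem₀ := h_mem 0 (by norm_num)
  have h_mem₁ := h_mem 1 (by norm_num)
  set μ : Fin n → Measure Z := fun i => Q i fun _ => (0 : ℝ)
  set ν : Fin n → Measure Z := fun i => Q i fun _ => (1 : ℝ)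
  have h_prob_μ : ∀ i, IsProbabilityMeasure (μ i) := fun i => hQprob i _
  have h_prob_ν : ∀ i, IsProbabilityMeasure (ν i) := fun i => hQprob i _
  have hμν : ∀ i S, MeasurableSet S → μ i S ≤ ENNReal.ofReal (exp α) * ν i S :=
    fun i S hS => hQLDP i S hS _ h_mem₀ _ h_mem₁
  have hνμ : ∀ i S, MeasurableSet S → ν i S ≤ ENNReal.ofReal (exp α) * μ i S :=
    fun i S hS => hQLDP i S hS _ h_mem₁ _ h_mem₀
  set f : Fin n → Z → ℝ≥0∞ := fun i => (μ i).rnDeriv (ν i)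
  have hf_meas : ∀ i, Measurable (f i) := fun i => Measure.measurable_rnDeriv _ _
  have h_density : ∀ i, (ν i).withDensity (f i) = μ i := fun i =>
    Measure.withDensity_rnDeriv_eq _ _ <| Measure.AbsolutelyContinuous.mk fun S hS h0 => by
      simpa [h0] using hμν i S hS
  have h_sigma : ∀ i, SigmaFinite ((ν i).withDensity (f i)) := fun i => by
    rw [h_density]; infer_instance
  have h_pi : Measure.pi μ = (Measure.pi ν).withDensity fun z => ∏ i, f i (z i) := by
    rw [← Measure.pi_withDensity ν hf_meas]
    simp_rw [h_density]
  have hF_meas : Measurable fun z : Fin n → Z => ∏ i, f i (z i) :=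
    Finset.measurable_prod _ fun i _ => (hf_meas i).comp (measurable_pi_apply i)
  have hF_one : ∫⁻ z, ∏ i, f i (z i) ∂(Measure.pi ν) = 1 := by
    rw [← setLIntegral_univ, ← withDensity_apply _ MeasurableSet.univ, ← h_pi, measure_univ]
  have hF_sq : ∫⁻ z, (∏ i, f i (z i)) ^ 2 ∂(Measure.pi ν)
      ≤ ENNReal.ofReal (exp (n * α ^ 2)) := by
    simp_rw [← Finset.prod_pow]
    rw [lintegral_pi_prod_eq_prod_lintegral ν fun i => (hf_meas i).pow_const 2]
    calc ∏ i, ∫⁻ x, f i x ^ 2 ∂(ν i) ≤ ∏ _i : Fin n, ENNReal.ofReal (exp (α ^ 2)) :=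
          Finset.prod_le_prod' fun i _ =>
            lintegral_rnDeriv_sq_le_exp_sq (μ i) (ν i) α (hμν i) (hνμ i)
      _ = ENNReal.ofReal (exp (n * α ^ 2)) := by
          rw [Finset.prod_const, Finset.card_univ, Fintype.card_fin,
            ← ENNReal.ofReal_pow (exp_pos _).le, ← Real.exp_nat_mul]
  have h_sum := ofReal_one_div_one_add_le_lintegral_add_lintegral (Measure.pi ν) hF_meas hF_one
    (exp_pos _).le hF_sq hθhat
  rw [← h_pi] at h_sum
  have h_real : 2 * ((1 / 4) * exp (-(12 * (n : ℝ) * α ^ 2))) ≤ 1 / (1 + exp (n * α ^ 2)) := by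
    have h_nonneg : 0 ≤ (n : ℝ) * α ^ 2 := by positivity
    have h_one : 1 ≤ exp (n * α ^ 2) := Real.one_le_exp h_nonneg
    have h_exp : exp (-(12 * (n : ℝ) * α ^ 2)) ≤ (exp (n * α ^ 2))⁻¹ := by
      rw [← Real.exp_neg]
      exact Real.exp_le_exp.2 (by linarith)
    calc 2 * ((1 / 4) * exp (-(12 * (n : ℝ) * α ^ 2)))
        ≤ 2 * ((1 / 4) * (exp (n * α ^ 2))⁻¹) := by gcongr
      _ = 1 / (2 * exp (n * α ^ 2)) := by field_simp; norm_num
      _ ≤ 1 / (1 + exp (n * α ^ 2)) := one_div_le_one_div_of_le (by positivity) (by linarith)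
  refine (ENNReal.mul_le_mul_iff_right two_ne_zero ENNReal.ofNat_ne_top).1 ?_
  rw [← ENNReal.ofReal_ofNat 2, ← ENNReal.ofReal_mul zero_le_two, ENNReal.ofReal_ofNat]
  refine (ENNReal.ofReal_le_ofReal h_real).trans (h_sum.trans ?_)
  exact (add_le_add (le_max_left _ _) (le_max_right _ _)).trans_eq (two_mul _).symm
end

section
/- Kullback–Leibler contraction of an α-LDP channel (the per-step bound established in the proof of Theorem 1 for the low-privacy regime). Let X and Z be measurable spaces, let α > 0, and let Q be a Markov kernel from X to Z satisfying Q(x)(S) ≤ e^α·Q(x')(S) for all measurable S ⊆ Z and all x, x' ∈ X. Then for any two probability measures P₁ and P₂ on X, the output marginals M_i = P_i.bind Q (i.e. M_i(S) = ∫ Q(x)(S) dP_i(x)) are mutually absolutely continuous, and the Kullback–Leibler divergence satisfies KL(M₁ ‖ M₂) = ∫ log(dM₁/dM₂) dM₁ ≤ α. -/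
open MeasureTheory Real
open scoped ENNReal

/-- A measure dominated by `c • ν` has Radon–Nikodym derivative at most `c`. -/
lemma MeasureTheory.Measure.rnDeriv_le_const_of_le_smul {Z : Type*} [MeasurableSpace Z]
    {μ ν : Measure Z} [SigmaFinite ν] {c : ℝ≥0∞} (h : μ ≤ c • ν) :
    ∀ᵐ z ∂ν, μ.rnDeriv ν z ≤ c := by
  refine ae_le_of_forall_setLIntegral_le_of_sigmaFinite (μ.measurable_rnDeriv ν)
    fun s _ _ ↦ ?_
  rw [setLIntegral_const]
  exact (Measure.setLIntegral_rnDeriv_le s).trans (h s)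

/-- If `μ ≤ exp α • ν` with `α ≥ 0`, the integral of the log-likelihood ratio is at most `α`. -/
lemma MeasureTheory.integral_log_rnDeriv_le_of_le_exp_smul {Z : Type*} [MeasurableSpace Z]
    {μ ν : Measure Z} [IsProbabilityMeasure μ] [SigmaFinite ν] {α : ℝ} (hα : 0 ≤ α)
    (hμν : μ ≪ ν) (h : μ ≤ ENNReal.ofReal (exp α) • ν) :
    ∫ z, log (μ.rnDeriv ν z).toReal ∂μ ≤ α := by
  have hlog : ∀ᵐ z ∂μ, log (μ.rnDeriv ν z).toReal ≤ α := by
    filter_upwards [hμν.ae_le (Measure.rnDeriv_le_const_of_le_smul h)] with z hz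
    have hr : (μ.rnDeriv ν z).toReal ≤ exp α :=
      ENNReal.toReal_le_of_le_ofReal (exp_pos α).le hz
    rcases ENNReal.toReal_nonneg.eq_or_lt (b := (μ.rnDeriv ν z).toReal) with h0 | h0
    · rwa [← h0, log_zero]
    · exact (log_le_iff_le_exp h0).2 hr
  by_cases hint : Integrable (fun z ↦ log (μ.rnDeriv ν z).toReal) μ
  · simpa using integral_mono_ae hint (integrable_const α) hlog
  · rwa [integral_undef hint]

/-- A uniform likelihood-ratio bound on a kernel passes to its output marginals. -/
lemma MeasureTheory.Measure.bind_le_smul_bind {X Z : Type*} [MeasurableSpace X]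
    [MeasurableSpace Z] {c : ℝ≥0∞} {Q : X → Measure Z} (hQmeas : Measurable Q)
    (hQ : ∀ S : Set Z, MeasurableSet S → ∀ x x' : X, Q x S ≤ c * Q x' S)
    (P₁ P₂ : Measure X) [IsProbabilityMeasure P₁] [IsProbabilityMeasure P₂] :
    P₁.bind Q ≤ c • P₂.bind Q := by
  refine Measure.le_iff.2 fun S hS ↦ ?_
  have hmeas : Measurable fun x ↦ Q x S := Measure.measurable_measure.1 hQmeas S hS
  rw [Measure.smul_apply, smul_eq_mul, Measure.bind_apply hS hQmeas.aemeasurable,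
    Measure.bind_apply hS hQmeas.aemeasurable, ← lintegral_const_mul c hmeas]
  calc ∫⁻ x, Q x S ∂P₁ = ∫⁻ _, ∫⁻ x, Q x S ∂P₁ ∂P₂ := by simp
    _ ≤ ∫⁻ x', c * Q x' S ∂P₂ := lintegral_mono fun x' ↦
      (lintegral_mono fun x ↦ hQ S hS x x').trans_eq (by simp)

/-- Kullback–Leibler contraction of an `α`-LDP channel: the output marginals of an
`α`-LDP Markov kernel under any two input distributions are mutually absolutely
continuous, and their KL divergence is at most `α`. -/
theorem ldp_kl_contraction
    {X Z : Type*} [MeasurableSpace X] [MeasurableSpace Z]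
    (α : ℝ) (hα : 0 < α) (Q : X → Measure Z)
    (hQmeas : Measurable Q) (hQprob : ∀ x, IsProbabilityMeasure (Q x))
    (hQLDP : ∀ S : Set Z, MeasurableSet S → ∀ x x' : X,
      Q x S ≤ ENNReal.ofReal (Real.exp α) * Q x' S)
    (P₁ P₂ : Measure X) [IsProbabilityMeasure P₁] [IsProbabilityMeasure P₂] :
    P₁.bind Q ≪ P₂.bind Q ∧ P₂.bind Q ≪ P₁.bind Q ∧
      ∫ z, Real.log (((P₁.bind Q).rnDeriv (P₂.bind Q) z).toReal) ∂(P₁.bind Q) ≤ α := by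
  have : IsProbabilityMeasure (P₁.bind Q) :=
    isProbabilityMeasure_bind hQmeas.aemeasurable (.of_forall hQprob)
  have : IsProbabilityMeasure (P₂.bind Q) :=
    isProbabilityMeasure_bind hQmeas.aemeasurable (.of_forall hQprob)
  have h₁₂ := Measure.bind_le_smul_bind hQmeas hQLDP P₁ P₂
  have h₂₁ := Measure.bind_le_smul_bind hQmeas hQLDP P₂ P₁
  have hac := Measure.absolutelyContinuous_of_le_smul h₁₂
  exact ⟨hac, Measure.absolutelyContinuous_of_le_smul h₂₁,
    integral_log_rnDeriv_le_of_le_exp_smul hα.le hac h₁₂⟩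
end

section
/- Binomial tail bound at the midpoint (the Chernoff–Hoeffding step in the proof of Theorem 1). For every natural number n and every real ω with 1/2 ≤ ω ≤ 1, Σ_{k=0}^{n} C(2n, k)·ω^k·(1−ω)^{2n−k} ≤ (4·ω·(1−ω))^n; in other words, a Binomial(2n, ω) random variable takes a value at most n with probability at most (4ω(1−ω))^n. -/
/-- The lower half of the `2n`-th row of Pascal's triangle sums to at most `4 ^ n`. -/
lemma sum_choose_two_mul_le_four_pow (n : ℕ) :
    ∑ k ∈ Finset.range (n + 1), (2 * n).choose k ≤ 4 ^ n :=
  calc ∑ k ∈ Finset.range (n + 1), (2 * n).choose k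
      ≤ ∑ k ∈ Finset.range (2 * n + 1), (2 * n).choose k :=
        Finset.sum_le_sum_of_subset (Finset.range_mono (by lia))
    _ = 4 ^ n := by rw [Nat.sum_range_choose, pow_mul]; norm_num

/-- Shifting `n - k` factors from the smaller base `b` to the larger base `a`. -/
lemma pow_mul_pow_two_mul_sub_le {a b : ℝ} (hb : 0 ≤ b) (hab : b ≤ a) {k n : ℕ} (hk : k ≤ n) :
    a ^ k * b ^ (2 * n - k) ≤ (a * b) ^ n := by
  have ha : 0 ≤ a := hb.trans hab
  obtain ⟨m, rfl⟩ := Nat.exists_eq_add_of_le hk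
  calc a ^ k * b ^ (2 * (k + m) - k) = a ^ k * (b ^ m * b ^ (k + m)) := by
        rw [← pow_add]; congr 2; lia
    _ ≤ a ^ k * (a ^ m * b ^ (k + m)) := by gcongr
    _ = (a * b) ^ (k + m) := by ring

/-- Binomial tail bound at the midpoint (the Chernoff–Hoeffding step in the proof of
Theorem 1): a `Binomial(2n, ω)` random variable is at most `n` with probability at most
`(4ω(1−ω))^n`. -/
theorem binomial_midpoint_tail (n : ℕ) (ω : ℝ) (h1 : 1 / 2 ≤ ω) (h2 : ω ≤ 1) :
    ∑ k ∈ Finset.range (n + 1),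
        (Nat.choose (2 * n) k : ℝ) * ω ^ k * (1 - ω) ^ (2 * n - k)
      ≤ (4 * ω * (1 - ω)) ^ n := by
  have hb : 0 ≤ 1 - ω := by linarith
  have hprod : 0 ≤ ω * (1 - ω) := mul_nonneg (by linarith) hb
  calc ∑ k ∈ Finset.range (n + 1), (Nat.choose (2 * n) k : ℝ) * ω ^ k * (1 - ω) ^ (2 * n - k)
      ≤ ∑ k ∈ Finset.range (n + 1), (Nat.choose (2 * n) k : ℝ) * (ω * (1 - ω)) ^ n := by
        refine Finset.sum_le_sum fun k hk ↦ ?_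
        rw [mul_assoc]
        exact mul_le_mul_of_nonneg_left
          (pow_mul_pow_two_mul_sub_le hb (by linarith) (Finset.mem_range_succ_iff.mp hk))
          (Nat.cast_nonneg _)
    _ = (∑ k ∈ Finset.range (n + 1), (Nat.choose (2 * n) k : ℝ)) * (ω * (1 - ω)) ^ n := by
        rw [Finset.sum_mul]
    _ ≤ 4 ^ n * (ω * (1 - ω)) ^ n :=
        mul_le_mul_of_nonneg_right (by exact_mod_cast sum_choose_two_mul_le_four_pow n)
          (pow_nonneg hprod n)
    _ = (4 * ω * (1 - ω)) ^ n := by rw [← mul_pow, mul_assoc]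
end

section
/- Lemma C.5 (the randomized-response mechanism for sparse binary vectors is α-LDP). Let d, m ≥ 1 be integers, let α > 0, and set ω = e^{α/(2m)}/(1 + e^{α/(2m)}). For x, v ∈ {0,1}^d define p(v | x) = Π_{j=1}^{d} ω^{𝟙{v_j = x_j}}·(1−ω)^{𝟙{v_j ≠ x_j}} (the probability that independently flipping each coordinate of x with probability 1−ω produces v). Then for all x, y ∈ {0,1}^d each having at most m nonzero coordinates, and for every v ∈ {0,1}^d, p(v | x) ≤ e^α · p(v | y). -/
/-- The number of coordinates where two binary vectors differ is at most the sum of the sizes of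
their supports. -/
theorem card_filter_ne_le_card_support_add {ι : Type*} [Fintype ι] (x y : ι → Bool) :
    (Finset.univ.filter fun j => x j ≠ y j).card ≤
      (Finset.univ.filter fun j => x j = true).card +
        (Finset.univ.filter fun j => y j = true).card := by
  classical
  refine (Finset.card_le_card fun j => ?_).trans (Finset.card_union_le _ _)
  cases hxj : x j <;> cases hyj : y j <;> simp [hxj, hyj]

/-- If coordinates are kept with weight `r * q` and flipped with weight `q`, changing the input
changes the likelihood by a factor of at most `r` per differing coordinate. -/
theorem prod_ite_eq_le_pow_card_ne_mul {ι β : Type*} [Fintype ι] [DecidableEq β]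
    {q r : ℝ} (hq : 0 ≤ q) (hr : 1 ≤ r) (x y v : ι → β) :
    (∏ j, if v j = x j then r * q else q) ≤
      r ^ (Finset.univ.filter fun j => x j ≠ y j).card *
        ∏ j, if v j = y j then r * q else q := by
  have hrq : 0 ≤ r * q := by positivity
  have hqr : q ≤ r * q := le_mul_of_one_le_left hq hr
  have hqrr : r * q ≤ r * (r * q) := le_mul_of_one_le_left hrq hr
  rw [← Finset.prod_const, Finset.prod_filter, ← Finset.prod_mul_distrib]
  refine Finset.prod_le_prod (fun j _ => by split_ifs <;> assumption) fun j _ => ?_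
  by_cases hxy : x j = y j
  · simp [hxy]
  · simp only [ne_eq, hxy, not_false_eq_true, if_true]
    split_ifs <;> linarith

/-- Lemma C.5: the randomized-response mechanism for `m`-sparse binary vectors is `α`-LDP. -/
theorem randomized_response_ldp
    (d m : ℕ) (hd : 1 ≤ d) (hm : 1 ≤ m) (α : ℝ) (hα : 0 < α)
    (ω : ℝ) (hω : ω = Real.exp (α / (2 * m)) / (1 + Real.exp (α / (2 * m))))
    (x y v : Fin d → Bool)
    (hx : (Finset.univ.filter fun j => x j = true).card ≤ m)
    (hy : (Finset.univ.filter fun j => y j = true).card ≤ m) :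
    (∏ j, if v j = x j then ω else 1 - ω)
      ≤ Real.exp α * ∏ j, if v j = y j then ω else 1 - ω := by
  set r := Real.exp (α / (2 * m)) with hr_def
  have hm0 : (0 : ℝ) < m := by exact_mod_cast hm
  have hr : 1 ≤ r := Real.one_le_exp (by positivity)
  have hq : 1 - ω = (1 + r)⁻¹ := by
    rw [hω]
    field_simp
    ring
  have hq0 : 0 ≤ 1 - ω := by rw [hq]; positivity
  have hkeep : ω = r * (1 - ω) := by rw [hq, hω, div_eq_mul_inv]
  have hω0 : 0 ≤ ω := by rw [hkeep]; positivity
  have hpow : r ^ (2 * m) = Real.exp α := by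
    rw [hr_def, ← Real.exp_nat_mul]
    congr 1
    push_cast
    field_simp
  have hcard : (Finset.univ.filter fun j => x j ≠ y j).card ≤ 2 * m := by
    have := card_filter_ne_le_card_support_add x y
    omega
  have hratio := prod_ite_eq_le_pow_card_ne_mul hq0 hr x y v
  rw [← hkeep] at hratio
  refine hratio.trans (mul_le_mul_of_nonneg_right ?_ ?_)
  · exact hpow ▸ pow_le_pow_right₀ hr hcard
  · exact Finset.prod_nonneg fun j _ => by split_ifs <;> assumption
end

section
/- Lemma C.9 (lower bound on the covering number of the set of s-sparse vectors in an ℓ∞-ball). Let r > 0, let d ≥ 1 be an integer, let s ∈ {1,…,d}, and let 0 < Δ < r/4. Then every finite set S ⊆ ℝ^d with the property that every θ ∈ ℝ^d with max_j |θ_j| ≤ r and at most s nonzero coordinates satisfies ‖θ − s₀‖₂ ≤ Δ for some s₀ ∈ S must have cardinality |S| ≥ (d/min{s, d−s})^{min{s, d−s}} · (s·(r − 2Δ)²/(20·Δ²))^{s/2}, where in the case s = d the first factor is interpreted as 1. -/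
open MeasureTheory in
/-- Volume bound for covers of a cube in Euclidean space by closed balls. -/
theorem cube_volume_le_card_mul_ball_volume {ι : Type*} [Fintype ι] [Nonempty ι] {a b Δ : ℝ}
    (hab : a ≤ b) (hΔ : 0 ≤ Δ) (C : Finset (EuclideanSpace ℝ ι))
    (hC : ∀ x : EuclideanSpace ℝ ι, (∀ i, x i ∈ Set.Ioc a b) → ∃ c ∈ C, dist x c ≤ Δ) :
    (b - a) ^ Fintype.card ι ≤
      C.card * (Δ ^ Fintype.card ι *
        (√Real.pi ^ Fintype.card ι / Real.Gamma (Fintype.card ι / 2 + 1))) := by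
  have hΓ : 0 < Real.Gamma ((Fintype.card ι : ℝ) / 2 + 1) := Real.Gamma_pos_of_pos (by positivity)
  set Q : Set (ι → ℝ) := Set.univ.pi fun _ => Set.Ioc a b
  have hQ : MeasurableSet Q := MeasurableSet.univ_pi fun _ => measurableSet_Ioc
  have hvol : volume (WithLp.ofLp ⁻¹' Q : Set (EuclideanSpace ℝ ι)) =
      ENNReal.ofReal ((b - a) ^ Fintype.card ι) := by
    rw [(PiLp.volume_preserving_ofLp ι).measure_preimage hQ.nullMeasurableSet, volume_pi_pi]
    simp [ENNReal.ofReal_pow (sub_nonneg.2 hab)]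
  have hsub : (WithLp.ofLp ⁻¹' Q : Set (EuclideanSpace ℝ ι)) ⊆
      ⋃ c ∈ C, Metric.closedBall c Δ := by
    intro x hx
    obtain ⟨c, hc, hxc⟩ := hC x fun i => hx i trivial
    exact Set.mem_biUnion hc hxc
  have h := (measure_mono hsub).trans (measure_biUnion_finset_le (μ := volume) C _)
  simp only [EuclideanSpace.volume_closedBall, Finset.sum_const, nsmul_eq_mul, hvol] at h
  rw [← ENNReal.ofReal_pow hΔ, ← ENNReal.ofReal_mul (by positivity), ← ENNReal.ofReal_natCast,
    ← ENNReal.ofReal_mul (by positivity)] at h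
  exact (ENNReal.ofReal_le_ofReal_iff (by positivity)).1 h

/-- A Stirling-type lower bound for the Gamma function at half-integers. -/
theorem sqrt_pow_le_Gamma_half_add_one (n : ℕ) :
    √(Real.pi * n / 20) ^ n ≤ Real.Gamma ((n : ℝ) / 2 + 1) := by
  induction n using Nat.twoStepInduction with
  | zero => simp
  | one =>
    rw [Nat.cast_one, pow_one, mul_one, Real.Gamma_add_one (by norm_num), Real.Gamma_one_half_eq]
    rw [Real.sqrt_le_left (by positivity), mul_pow, Real.sq_sqrt Real.pi_pos.le]
    linarith [Real.pi_pos]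
  | more n ih _ =>
    have hexp : √(Real.pi * ((n + 2 : ℕ) : ℝ) / 20) ^ n ≤
        Real.exp 1 * √(Real.pi * n / 20) ^ n := by
      rcases Nat.eq_zero_or_pos n with rfl | hn
      · simp
      have hn' : (0 : ℝ) < n := by exact_mod_cast hn
      have hle : √(Real.pi * ((n + 2 : ℕ) : ℝ) / 20) ≤
          Real.exp (1 / n) * √(Real.pi * n / 20) := by
        rw [Real.sqrt_le_left (by positivity), mul_pow, Real.sq_sqrt (by positivity),
          ← Real.exp_nat_mul]
        have h := Real.add_one_le_exp (((2 : ℕ) : ℝ) * (1 / n))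
        calc Real.pi * ((n + 2 : ℕ) : ℝ) / 20
            = (((2 : ℕ) : ℝ) * (1 / n) + 1) * (Real.pi * n / 20) := by
              push_cast; field_simp; ring
          _ ≤ _ := by gcongr
      calc _ ≤ (Real.exp (1 / n) * √(Real.pi * n / 20)) ^ n := by gcongr
        _ = _ := by
          rw [mul_pow, ← Real.exp_nat_mul, mul_one_div_cancel hn'.ne']
    have hΓ : Real.Gamma (((n + 2 : ℕ) : ℝ) / 2 + 1) =
        ((n : ℝ) / 2 + 1) * Real.Gamma ((n : ℝ) / 2 + 1) := by
      rw [← Real.Gamma_add_one (by positivity)]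
      congr 1; push_cast; ring
    have hc : Real.exp 1 * Real.pi ≤ 10 := by
      nlinarith [Real.exp_one_lt_d9, Real.pi_lt_d2, Real.pi_pos, Real.exp_pos 1]
    rw [hΓ, pow_add, Real.sq_sqrt (by positivity)]
    calc _ ≤ Real.exp 1 * √(Real.pi * n / 20) ^ n * (Real.pi * ((n + 2 : ℕ) : ℝ) / 20) := by
          gcongr
      _ = (Real.exp 1 * Real.pi) / 10 * ((n : ℝ) / 2 + 1) * √(Real.pi * n / 20) ^ n := by
          push_cast; ring
      _ ≤ 10 / 10 * ((n : ℝ) / 2 + 1) * √(Real.pi * n / 20) ^ n := by gcongr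
      _ = ((n : ℝ) / 2 + 1) * √(Real.pi * n / 20) ^ n := by ring
      _ ≤ _ := by gcongr

/-- The standard lower bound `(n / k) ^ k ≤ n.choose k`. -/
theorem div_pow_le_choose {n k : ℕ} (hkn : k ≤ n) :
    ((n : ℝ) / k) ^ k ≤ n.choose k := by
  induction k generalizing n with
  | zero => simp
  | succ k ih =>
    obtain ⟨n, rfl⟩ : ∃ m, n = m + 1 := ⟨n - 1, by omega⟩
    have hkn' : k ≤ n := by omega
    have hratio : (((n + 1 : ℕ) : ℝ) / (k + 1 : ℕ)) ^ k ≤ ((n : ℝ) / k) ^ k := by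
      rcases Nat.eq_zero_or_pos k with rfl | hk
      · simp
      have hk' : (0 : ℝ) < k := by exact_mod_cast hk
      have : (k : ℝ) ≤ n := by exact_mod_cast hkn'
      refine pow_le_pow_left₀ (by positivity) ?_ k
      rw [div_le_div_iff₀ (by positivity) hk']
      push_cast
      nlinarith
    have hchoose : ((n + 1).choose (k + 1) : ℝ) =
        n.choose k * (((n + 1 : ℕ) : ℝ) / (k + 1 : ℕ)) := by
      rw [← mul_div_assoc, eq_div_iff (by positivity), mul_comm (n.choose k : ℝ)]
      exact_mod_cast (Nat.add_one_mul_choose_eq n k).symm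
    rw [pow_succ, hchoose]
    gcongr
    exact hratio.trans (ih hkn')

/-- A cover of the cube `(a, b]^s` by balls of radius `Δ` has at least
`(s (b - a)² / (20 Δ²))^(s / 2)` elements. -/
theorem rpow_le_card_of_cube_cover {ι : Type*} [Fintype ι] [Nonempty ι] {a b Δ : ℝ}
    (hab : a ≤ b) (hΔ : 0 < Δ) (C : Finset (EuclideanSpace ℝ ι))
    (hC : ∀ x : EuclideanSpace ℝ ι, (∀ i, x i ∈ Set.Ioc a b) → ∃ c ∈ C, dist x c ≤ Δ) :
    ((Fintype.card ι : ℝ) * (b - a) ^ 2 / (20 * Δ ^ 2)) ^ ((Fintype.card ι : ℝ) / 2) ≤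
      (C.card : ℝ) := by
  have h := cube_volume_le_card_mul_ball_volume hab hΔ.le C hC
  set n := Fintype.card ι
  have hΓ : 0 < Real.Gamma ((n : ℝ) / 2 + 1) := Real.Gamma_pos_of_pos (by positivity)
  have hG := sqrt_pow_le_Gamma_half_add_one n
  have hba : 0 ≤ b - a := sub_nonneg.2 hab
  have hroot : √((n : ℝ) * (b - a) ^ 2 / (20 * Δ ^ 2)) = √((n : ℝ) / 20) * ((b - a) / Δ) := by
    rw [show (n : ℝ) * (b - a) ^ 2 / (20 * Δ ^ 2) = (n / 20) * ((b - a) / Δ) ^ 2 by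
      field_simp, Real.sqrt_mul (by positivity), Real.sqrt_sq (by positivity)]
  have hpow : ((n : ℝ) * (b - a) ^ 2 / (20 * Δ ^ 2)) ^ ((n : ℝ) / 2) =
      √((n : ℝ) / 20) ^ n * ((b - a) ^ n / Δ ^ n) := by
    rw [← div_pow, ← mul_pow, ← hroot, Real.sqrt_eq_rpow, ← Real.rpow_mul_natCast (by positivity)]
    congr 1; ring
  rw [hpow]
  calc _ ≤ √((n : ℝ) / 20) ^ n * (C.card * (Δ ^ n *
        (√Real.pi ^ n / Real.Gamma ((n : ℝ) / 2 + 1))) / Δ ^ n) := by gcongr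
    _ = C.card * (√(Real.pi * n / 20) ^ n / Real.Gamma ((n : ℝ) / 2 + 1)) := by
      rw [mul_div_assoc Real.pi, Real.sqrt_mul Real.pi_pos.le, mul_pow]
      field_simp
    _ ≤ C.card * 1 := by
      gcongr
      exact (div_le_one hΓ).2 hG
    _ = _ := mul_one _

/-- Lemma C.9: lower bound on the covering number of the set of `s`-sparse vectors in an
`ℓ∞`-ball of radius `r`.  In the case `s = d` the first factor is `(d/0)^0 = 1`. -/
theorem sparse_covering_lower (r : ℝ) (hr : 0 < r) (d s : ℕ) (hd : 1 ≤ d)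
    (hs1 : 1 ≤ s) (hsd : s ≤ d) (Δ : ℝ) (hΔ0 : 0 < Δ) (hΔr : Δ < r / 4)
    (S : Finset (EuclideanSpace ℝ (Fin d)))
    (hS : ∀ θ : EuclideanSpace ℝ (Fin d),
      (∀ j, |θ j| ≤ r) → {j | θ j ≠ 0}.ncard ≤ s → ∃ s₀ ∈ S, dist θ s₀ ≤ Δ) :
    ((d : ℝ) / ((min s (d - s) : ℕ) : ℝ)) ^ (min s (d - s))
        * ((s : ℝ) * (r - 2 * Δ) ^ 2 / (20 * Δ ^ 2)) ^ ((s : ℝ) / 2)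
      ≤ (S.card : ℝ) := by
  classical
  let V (T : Finset (Fin d)) (θ : EuclideanSpace ℝ (Fin d)) : Prop :=
    (∀ j ∈ T, θ j ∈ Set.Ioc (2 * Δ) r) ∧ ∀ j ∉ T, θ j = 0
  let N (T : Finset (Fin d)) : Finset (EuclideanSpace ℝ (Fin d)) :=
    S.filter fun c => ∃ θ, V T θ ∧ dist θ c ≤ Δ
  have hdisj : ∀ T T', (∃ c, c ∈ N T ∧ c ∈ N T') → T ⊆ T' := by
    rintro T T' ⟨c, hc, hc'⟩ j hj
    obtain ⟨-, θ, hθ, hθc⟩ := Finset.mem_filter.1 hc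
    obtain ⟨-, θ', hθ', hθc'⟩ := Finset.mem_filter.1 hc'
    by_contra hj'
    have hcoord := PiLp.norm_apply_le (θ - θ') j
    rw [PiLp.sub_apply, hθ'.2 j hj', sub_zero, ← dist_eq_norm, Real.norm_eq_abs] at hcoord
    linarith [dist_triangle_right θ θ' c, le_abs_self (θ j), (hθ.1 j hj).1]
  have hN : ∀ T : Finset (Fin d), T.card = s →
      ((s : ℝ) * (r - 2 * Δ) ^ 2 / (20 * Δ ^ 2)) ^ ((s : ℝ) / 2) ≤ (N T).card := by
    intro T hT
    have : Nonempty T := (Finset.card_pos.1 (by omega)).to_subtype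
    let p (c : EuclideanSpace ℝ (Fin d)) : EuclideanSpace ℝ T := WithLp.toLp 2 fun i => c i
    have h := rpow_le_card_of_cube_cover (a := 2 * Δ) (b := r) (by linarith) hΔ0
      ((N T).image p) ?_
    · rw [Fintype.card_coe, hT] at h
      exact h.trans (by exact_mod_cast Finset.card_image_le)
    intro x hx
    let θ : EuclideanSpace ℝ (Fin d) :=
      WithLp.toLp 2 fun j => if hj : j ∈ T then x ⟨j, hj⟩ else 0
    have hθ : V T θ := ⟨fun j hj => by simpa [θ, hj] using hx ⟨j, hj⟩, fun j hj => by simp [θ, hj]⟩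
    obtain ⟨c, hc, hd⟩ := hS θ
      (fun j => by
        by_cases hj : j ∈ T
        · have := hθ.1 j hj
          rw [abs_le]; constructor <;> linarith [this.1, this.2]
        · rw [hθ.2 j hj, abs_zero]; exact hr.le)
      (by
        rw [← hT, ← Set.ncard_coe_finset]
        refine Set.ncard_le_ncard (fun j hj => ?_) T.finite_toSet
        by_contra hj'
        exact hj (hθ.2 j hj'))
    refine ⟨p c, Finset.mem_image_of_mem p (Finset.mem_filter.2 ⟨hc, θ, hθ, hd⟩), le_trans ?_ hd⟩
    rw [EuclideanSpace.dist_eq, EuclideanSpace.dist_eq]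
    refine Real.sqrt_le_sqrt ?_
    calc ∑ i : T, dist (x i) (p c i) ^ 2 = ∑ i : T, dist (θ i) (c i) ^ 2 := by simp [θ, p]
      _ = ∑ j ∈ T, dist (θ j) (c j) ^ 2 :=
        Finset.sum_coe_sort T fun j => dist (θ j) (c j) ^ 2
      _ ≤ ∑ j, dist (θ j) (c j) ^ 2 :=
        Finset.sum_le_univ_sum_of_nonneg fun j => by positivity
  have hchoose : ((d : ℝ) / ((min s (d - s) : ℕ) : ℝ)) ^ (min s (d - s)) ≤ d.choose s := by
    refine (div_pow_le_choose (by omega)).trans (le_of_eq ?_)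
    rcases min_choice s (d - s) with h | h
    · rw [h]
    · rw [h, Nat.choose_symm hsd]
  have hunion : (Finset.powersetCard s (Finset.univ : Finset (Fin d))).biUnion N ⊆ S :=
    Finset.biUnion_subset.2 fun _ _ => Finset.filter_subset _ _
  have hcard : ∑ T ∈ Finset.powersetCard s (Finset.univ : Finset (Fin d)), (N T).card ≤ S.card := by
    rw [← Finset.card_biUnion]
    · exact Finset.card_le_card hunion
    · intro T _ T' _ hne
      refine Finset.disjoint_left.2 fun c hc hc' => hne ?_
      exact (hdisj T T' ⟨c, hc, hc'⟩).antisymm (hdisj T' T ⟨c, hc', hc⟩)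
  calc _ ≤ (d.choose s : ℝ) * ((s : ℝ) * (r - 2 * Δ) ^ 2 / (20 * Δ ^ 2)) ^ ((s : ℝ) / 2) := by
        gcongr
    _ = ∑ T ∈ Finset.powersetCard s (Finset.univ : Finset (Fin d)),
        ((s : ℝ) * (r - 2 * Δ) ^ 2 / (20 * Δ ^ 2)) ^ ((s : ℝ) / 2) := by simp
    _ ≤ ∑ T ∈ Finset.powersetCard s (Finset.univ : Finset (Fin d)), ((N T).card : ℝ) :=
        Finset.sum_le_sum fun T hT => hN T (Finset.mem_powersetCard.1 hT).2
    _ ≤ S.card := by exact_mod_cast hcard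
end

section
/- The packing construction underlying Lemma C.8 (a Varshamov–Gilbert packing of smooth probability densities). For every integer β ≥ 1 there exists a constant c > 0, depending only on β, such that for every r > 0 there is k₀ ∈ ℕ with the following property: for every integer k ≥ k₀ there exists a finite family F of at least 2^{k/8} functions f : ℝ → ℝ such that (i) each f is (β−1)-times differentiable and its (β−1)-st derivative is Lipschitz on [0,1] with Lipschitz constant r·π^β; (ii) 1/2 ≤ f(x) ≤ 3/2 for all x ∈ [0,1] and ∫₀¹ f(x) dx = 1, so that each f restricted to [0,1] is a probability density; and (iii) for any two distinct f, g ∈ F, ∫₀¹ (f(x) − g(x))² dx ≥ c·r²/k^{2β}. -/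
open MeasureTheory Function Set

/-- The superposition of the `k` translates to the cells `[j/k, (j+1)/k]` of a rescaled profile `ψ`,
weighted by `w`. -/
noncomputable def bumpSum {k : ℕ} (ψ : ℝ → ℝ) (w : Fin k → ℝ) (x : ℝ) : ℝ :=
  ∑ j, w j * ψ (k * x - j)

theorem cell_unique {k : ℕ} {y : ℝ} {i j : Fin k} (hi : y - i ∈ Ioo (0 : ℝ) 1)
    (hj : y - j ∈ Ioo (0 : ℝ) 1) : i = j := by
  obtain ⟨h1, h2⟩ := hi
  obtain ⟨h3, h4⟩ := hj
  have h5 : ((i : ℕ) : ℝ) < (j : ℕ) + 1 := by linarith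
  have h6 : ((j : ℕ) : ℝ) < (i : ℕ) + 1 := by linarith
  norm_cast at h5 h6
  exact Fin.ext (by omega)

theorem bumpSum_eq_single {k : ℕ} {ψ : ℝ → ℝ} (hψ : support ψ ⊆ Ioo 0 1) (w : Fin k → ℝ) {x : ℝ}
    {j : Fin k} (hj : ψ (k * x - j) ≠ 0) : bumpSum ψ w x = w j * ψ (k * x - j) := by
  refine Finset.sum_eq_single j (fun i _ hij => ?_) (by simp)
  have : ψ (k * x - i) = 0 := by
    by_contra h
    exact hij (cell_unique (hψ h) (hψ hj))
  rw [this, mul_zero]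

theorem abs_bumpSum_le {k : ℕ} {ψ : ℝ → ℝ} {M : ℝ} (hψ : support ψ ⊆ Ioo 0 1)
    (hM : ∀ x, |ψ x| ≤ M) {w : Fin k → ℝ} (hw : ∀ j, |w j| ≤ 1) (x : ℝ) :
    |bumpSum ψ w x| ≤ M := by
  by_cases h : ∃ j : Fin k, ψ (k * x - j) ≠ 0
  · obtain ⟨j, hj⟩ := h
    rw [bumpSum_eq_single hψ w hj, abs_mul]
    calc |w j| * |ψ (k * x - j)| ≤ 1 * M :=
          mul_le_mul (hw j) (hM _) (abs_nonneg _) zero_le_one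
      _ = M := one_mul M
  · push Not at h
    simp only [bumpSum, h, mul_zero, Finset.sum_const_zero, abs_zero]
    exact (abs_nonneg _).trans (hM 0)

theorem bumpSum_sq {k : ℕ} {ψ : ℝ → ℝ} (hψ : support ψ ⊆ Ioo 0 1) (w : Fin k → ℝ) (x : ℝ) :
    bumpSum ψ w x ^ 2 = bumpSum (fun y => ψ y ^ 2) (fun j => w j ^ 2) x := by
  by_cases h : ∃ j : Fin k, ψ (k * x - j) ≠ 0
  · obtain ⟨j, hj⟩ := h
    have hsupp : support (fun y => ψ y ^ 2) ⊆ Ioo 0 1 := fun y hy =>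
      hψ fun h0 => hy (by simp [h0])
    rw [bumpSum_eq_single hψ w hj, bumpSum_eq_single hsupp _ (pow_ne_zero 2 hj), mul_pow]
  · push Not at h
    simp [bumpSum, h]

theorem bumpSum_sub {k : ℕ} (ψ : ℝ → ℝ) (v w : Fin k → ℝ) (x : ℝ) :
    bumpSum ψ v x - bumpSum ψ w x = bumpSum ψ (fun j => v j - w j) x := by
  simp only [bumpSum, sub_mul, Finset.sum_sub_distrib]

theorem continuous_bumpSum {k : ℕ} {ψ : ℝ → ℝ} (hψ : Continuous ψ) (w : Fin k → ℝ) :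
    Continuous (bumpSum ψ w) := by
  unfold bumpSum
  fun_prop

theorem contDiff_bumpSum {k : ℕ} {n : WithTop ℕ∞} {ψ : ℝ → ℝ} (hψ : ContDiff ℝ n ψ)
    (w : Fin k → ℝ) : ContDiff ℝ n (bumpSum ψ w) := by
  unfold bumpSum
  fun_prop

theorem iteratedDeriv_bumpSum {k n : ℕ} {ψ : ℝ → ℝ} (hψ : ContDiff ℝ n ψ) (w : Fin k → ℝ) (x : ℝ) :
    iteratedDeriv n (bumpSum ψ w) x = (k : ℝ) ^ n * bumpSum (iteratedDeriv n ψ) w x := by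
  have hcomp : ∀ j : Fin k, ContDiff ℝ n fun y : ℝ => w j * ψ (k * y - j) := fun j => by fun_prop
  unfold bumpSum
  rw [iteratedDeriv_fun_sum fun j _ => (hcomp j).contDiffAt, Finset.mul_sum]
  refine Finset.sum_congr rfl fun j _ => ?_
  have hshift : ContDiff ℝ n fun y : ℝ => ψ (y - j) := by fun_prop
  rw [iteratedDeriv_const_mul_field, iteratedDeriv_comp_const_mul hshift (k : ℝ),
    iteratedDeriv_comp_sub_const]
  ring

theorem integral_bumpSum {k : ℕ} {ψ : ℝ → ℝ} (hψ : Continuous ψ) (hsupp : support ψ ⊆ Ioo 0 1)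
    (w : Fin k → ℝ) : ∫ x in (0 : ℝ)..1, bumpSum ψ w x = (∑ j, w j) / k * ∫ x, ψ x := by
  unfold bumpSum
  rw [intervalIntegral.integral_finsetSum
    fun j _ => (by fun_prop : Continuous fun x : ℝ => w j * ψ (k * x - j)).intervalIntegrable _ _,
    div_mul_eq_mul_div, Finset.sum_mul, Finset.sum_div]
  refine Finset.sum_congr rfl fun j _ => ?_
  have hk : (k : ℝ) ≠ 0 := by
    have := j.pos
    positivity
  have hj : ((j : ℕ) : ℝ) + 1 ≤ k := by exact_mod_cast j.isLt
  rw [intervalIntegral.integral_const_mul, intervalIntegral.integral_comp_mul_sub _ hk,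
    intervalIntegral.integral_eq_integral_of_support_subset, smul_eq_mul]
  · ring
  · intro y hy
    obtain ⟨h0, h1⟩ := hsupp hy
    have : (0 : ℝ) ≤ (j : ℕ) := Nat.cast_nonneg _
    constructor <;> linarith

theorem tsupport_iteratedDeriv_subset (f : ℝ → ℝ) (n : ℕ) :
    tsupport (iteratedDeriv n f) ⊆ tsupport f := by
  induction n with
  | zero => rw [iteratedDeriv_zero]
  | succ n ih =>
    rw [iteratedDeriv_succ]
    exact tsupport_deriv_subset.trans ih

/-- A smooth nonzero profile of mean zero supported inside the open unit interval. -/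
theorem exists_mean_zero_bump : ∃ φ : ℝ → ℝ, (∀ n : ℕ, ContDiff ℝ n φ) ∧ HasCompactSupport φ ∧
    tsupport φ ⊆ Ioo 0 1 ∧ ∫ x, φ x = 0 ∧ 0 < ∫ x, φ x ^ 2 := by
  let b : ContDiffBump (1 / 2 : ℝ) := ⟨1 / 8, 1 / 4, by norm_num, by norm_num⟩
  have hb : ContDiff ℝ ((⊤ : ℕ∞) : WithTop ℕ∞) b := b.contDiff
  have hφ : ContDiff ℝ ((⊤ : ℕ∞) : WithTop ℕ∞) (deriv b) := (contDiff_infty_iff_deriv.1 hb).2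
  have htb : tsupport b ⊆ Ioo (0 : ℝ) 1 := by
    rw [b.tsupport_eq, Real.closedBall_eq_Icc]
    intro x hx
    obtain ⟨h1, h2⟩ := hx
    simp only [b] at h1 h2
    constructor <;> linarith
  have hts : tsupport (deriv b) ⊆ Ioo (0 : ℝ) 1 := tsupport_deriv_subset.trans htb
  have hcomp : HasCompactSupport (deriv b) := b.hasCompactSupport.deriv
  have hdiff : Differentiable ℝ b := hb.differentiable (by simp)
  have hb0 : ∀ x : ℝ, x ∉ Ioo (0 : ℝ) 1 → b x = 0 := fun x hx =>
    image_eq_zero_of_notMem_tsupport fun h => hx (htb h)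
  refine ⟨deriv b, fun n => hφ.of_le (by exact_mod_cast le_top), hcomp, hts, ?_, ?_⟩
  · have hsub : support (deriv b) ⊆ Ioc (0 : ℝ) 1 :=
      (subset_tsupport _).trans (hts.trans Ioo_subset_Ioc_self)
    rw [← intervalIntegral.integral_eq_integral_of_support_subset hsub,
      intervalIntegral.integral_deriv_eq_sub (fun x _ => hdiff x)
        (hφ.continuous.intervalIntegrable _ _), hb0 0 (by simp), hb0 1 (by simp), sub_zero]
  · obtain ⟨x, hx⟩ : ∃ x, deriv b x ≠ 0 := by
      by_contra! h
      have h1 : b (1 / 2) = b 1 := is_const_of_deriv_eq_zero hdiff h _ _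
      rw [hb0 1 (by simp), b.one_of_mem_closedBall (Metric.mem_closedBall_self b.rIn_pos.le)] at h1
      exact one_ne_zero h1
    have hcomp2 : HasCompactSupport fun x => deriv b x ^ 2 :=
      hcomp.comp_left (g := fun y : ℝ => y ^ 2) (by simp)
    exact (hφ.continuous.pow 2).integral_pos_of_hasCompactSupport_nonneg_nonzero hcomp2
      (fun y => sq_nonneg _) (pow_ne_zero 2 hx)

theorem sum_half_pow_card_symmDiff {k : ℕ} (T : Finset (Fin k)) :
    ∑ S : Finset (Fin k), (1 / 2 : ℝ) ^ (symmDiff S T).card = (3 / 2) ^ k := by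
  refine (Equiv.sum_comp (symmDiff_left_involutive T).toPerm
    fun S : Finset (Fin k) => (1 / 2 : ℝ) ^ S.card).trans ?_
  have := Fintype.sum_pow_mul_eq_add_pow (Fin k) (1 / 2 : ℝ) 1
  simp only [one_pow, mul_one, Fintype.card_fin] at this
  rw [this]
  norm_num

/-- The Varshamov–Gilbert bound. -/
theorem varshamov_gilbert (k : ℕ) : ∃ C : Finset (Finset (Fin k)),
    (2 : ℝ) ^ ((k : ℝ) / 8) ≤ C.card ∧
    ∀ S ∈ C, ∀ T ∈ C, S ≠ T → (k : ℝ) / 8 ≤ (symmDiff S T).card := by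
  obtain ⟨C, hC⟩ := {C : Finset (Finset (Fin k)) | ∀ S ∈ C, ∀ T ∈ C, S ≠ T →
    (k : ℝ) / 8 ≤ (symmDiff S T).card}.toFinite.exists_maximal ⟨∅, by simp⟩
  refine ⟨C, ?_, hC.prop⟩
  have hcover : ∀ S : Finset (Fin k), ∃ T ∈ C, ((symmDiff S T).card : ℝ) ≤ k / 8 := by
    intro S
    by_contra! h
    have hins : insert S C ⊆ C := by
      refine hC.le_of_ge ?_ (Finset.subset_insert S C)
      intro U hU V hV hUV
      rw [Finset.mem_insert] at hU hV
      rcases hU with rfl | hU <;> rcases hV with rfl | hV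
      · exact absurd rfl hUV
      · exact (h V hV).le
      · rw [symmDiff_comm]
        exact (h U hU).le
      · exact hC.prop U hU V hV hUV
    have := h S (hins (Finset.mem_insert_self S C))
    rw [symmDiff_self] at this
    simp only [Finset.bot_eq_empty, Finset.card_empty, Nat.cast_zero] at this
    have hk : (0 : ℝ) ≤ k := Nat.cast_nonneg k
    linarith
  have hlower : ∀ S : Finset (Fin k),
      (1 / 2 : ℝ) ^ ((k : ℝ) / 8) ≤ ∑ T ∈ C, (1 / 2 : ℝ) ^ (symmDiff S T).card := by
    intro S
    obtain ⟨T, hT, hST⟩ := hcover S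
    calc (1 / 2 : ℝ) ^ ((k : ℝ) / 8) ≤ (1 / 2 : ℝ) ^ ((symmDiff S T).card : ℝ) :=
          Real.rpow_le_rpow_of_exponent_ge (by norm_num) (by norm_num) hST
      _ = (1 / 2 : ℝ) ^ (symmDiff S T).card := Real.rpow_natCast _ _
      _ ≤ _ := Finset.single_le_sum (f := fun T => (1 / 2 : ℝ) ^ (symmDiff S T).card)
          (fun _ _ => by positivity) hT
  have hcount : (2 : ℝ) ^ k * (1 / 2 : ℝ) ^ ((k : ℝ) / 8) ≤ C.card * (3 / 2) ^ k := by
    have h := Finset.sum_le_sum fun S (_ : S ∈ (Finset.univ : Finset (Finset (Fin k)))) => hlower S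
    rw [Finset.sum_comm] at h
    simp_rw [sum_half_pow_card_symmDiff] at h
    simpa using h
  have hquarter : (2 : ℝ) ^ ((1 : ℝ) / 4) ≤ 4 / 3 := by
    refine le_of_pow_le_pow_left₀ four_ne_zero (by norm_num) ?_
    rw [← Real.rpow_mul_natCast zero_le_two]
    norm_num
  have hfour : (2 : ℝ) ^ ((k : ℝ) / 8) * (2 : ℝ) ^ ((k : ℝ) / 8) * (3 / 2) ^ k ≤ 2 ^ k := by
    rw [← Real.rpow_add two_pos]
    calc (2 : ℝ) ^ ((k : ℝ) / 8 + (k : ℝ) / 8) * (3 / 2) ^ k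
        = ((2 : ℝ) ^ ((1 : ℝ) / 4)) ^ k * (3 / 2) ^ k := by
          rw [← Real.rpow_mul_natCast zero_le_two]
          ring_nf
      _ ≤ (4 / 3) ^ k * (3 / 2) ^ k := by gcongr
      _ = 2 ^ k := by rw [← mul_pow]; norm_num
  have hinv : (1 / 2 : ℝ) ^ ((k : ℝ) / 8) * (2 : ℝ) ^ ((k : ℝ) / 8) = 1 := by
    rw [← Real.mul_rpow (by norm_num) (by norm_num)]
    norm_num
  have hpos : (0 : ℝ) < (3 / 2) ^ k := by positivity
  refine le_of_mul_le_mul_right ?_ hpos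
  calc (2 : ℝ) ^ ((k : ℝ) / 8) * (3 / 2) ^ k
      = (1 / 2 : ℝ) ^ ((k : ℝ) / 8)
        * ((2 : ℝ) ^ ((k : ℝ) / 8) * (2 : ℝ) ^ ((k : ℝ) / 8) * (3 / 2) ^ k) := by
        linear_combination (-(2 : ℝ) ^ ((k : ℝ) / 8) * (3 / 2) ^ k) * hinv
    _ ≤ (1 / 2 : ℝ) ^ ((k : ℝ) / 8) * 2 ^ k := by gcongr
    _ ≤ C.card * (3 / 2) ^ k := by rwa [mul_comm]

/-- The density `1 + a ∑ j ∈ S, φ (k x - j)`. -/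
noncomputable def perturbedDensity {k : ℕ} (φ : ℝ → ℝ) (a : ℝ) (S : Finset (Fin k)) (x : ℝ) : ℝ :=
  1 + a * bumpSum φ (fun j => if j ∈ S then 1 else 0) x

theorem abs_indicator_le_one {k : ℕ} (S : Finset (Fin k)) (j : Fin k) :
    |if j ∈ S then (1 : ℝ) else 0| ≤ 1 := by
  split_ifs <;> simp

theorem contDiff_perturbedDensity {k : ℕ} {n : WithTop ℕ∞} {φ : ℝ → ℝ} (hφ : ContDiff ℝ n φ)
    (a : ℝ) (S : Finset (Fin k)) : ContDiff ℝ n (perturbedDensity φ a S) :=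
  contDiff_const.add (contDiff_const.mul (contDiff_bumpSum hφ _))

theorem abs_iteratedDeriv_perturbedDensity_le {k n : ℕ} (hn : 0 < n) {φ : ℝ → ℝ}
    (hφ : ContDiff ℝ n φ) (hsupp : tsupport φ ⊆ Ioo 0 1) {M : ℝ}
    (hM : ∀ x, |iteratedDeriv n φ x| ≤ M) {a : ℝ} (ha : 0 ≤ a) (S : Finset (Fin k)) (x : ℝ) :
    |iteratedDeriv n (perturbedDensity φ a S) x| ≤ a * k ^ n * M := by
  have hs : support (iteratedDeriv n φ) ⊆ Ioo 0 1 :=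
    (subset_tsupport _).trans ((tsupport_iteratedDeriv_subset φ n).trans hsupp)
  unfold perturbedDensity
  rw [iteratedDeriv_const_add hn, iteratedDeriv_const_mul_field, iteratedDeriv_bumpSum hφ,
    ← mul_assoc, abs_mul, abs_of_nonneg (by positivity)]
  gcongr
  exact abs_bumpSum_le hs hM (abs_indicator_le_one S) x

theorem integral_perturbedDensity {k : ℕ} {φ : ℝ → ℝ} (hφ : Continuous φ)
    (hsupp : support φ ⊆ Ioo 0 1) (hmean : ∫ x, φ x = 0) (a : ℝ) (S : Finset (Fin k)) :
    ∫ x in (0 : ℝ)..1, perturbedDensity φ a S x = 1 := by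
  unfold perturbedDensity
  rw [intervalIntegral.integral_add intervalIntegrable_const
    (((continuous_bumpSum hφ _).const_mul a).intervalIntegrable _ _),
    intervalIntegral.integral_const_mul, integral_bumpSum hφ hsupp, hmean]
  simp

theorem integral_sq_sub_perturbedDensity {k : ℕ} {φ : ℝ → ℝ} (hφ : Continuous φ)
    (hsupp : support φ ⊆ Ioo 0 1) (a : ℝ) (S T : Finset (Fin k)) :
    ∫ x in (0 : ℝ)..1, (perturbedDensity φ a S x - perturbedDensity φ a T x) ^ 2
      = a ^ 2 * ((symmDiff S T).card / k * ∫ x, φ x ^ 2) := by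
  have hsupp2 : support (fun y => φ y ^ 2) ⊆ Ioo 0 1 := fun y hy =>
    hsupp fun h0 => hy (by simp [h0])
  have hpt : ∀ x, (perturbedDensity φ a S x - perturbedDensity φ a T x) ^ 2
      = a ^ 2 * bumpSum (fun y => φ y ^ 2)
        (fun j : Fin k => ((if j ∈ S then (1 : ℝ) else 0) - if j ∈ T then 1 else 0) ^ 2) x := by
    intro x
    rw [← bumpSum_sq hsupp, ← bumpSum_sub]
    unfold perturbedDensity
    ring
  have hcard : ∑ j : Fin k, ((if j ∈ S then (1 : ℝ) else 0) - if j ∈ T then 1 else 0) ^ 2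
      = ((symmDiff S T).card : ℝ) := by
    have : ∀ j : Fin k, ((if j ∈ S then (1 : ℝ) else 0) - if j ∈ T then 1 else 0) ^ 2
        = if j ∈ symmDiff S T then 1 else 0 := by
      intro j
      by_cases hS : j ∈ S <;> by_cases hT : j ∈ T <;> simp [Finset.mem_symmDiff, hS, hT]
    simp [this]
  simp_rw [hpt]
  rw [intervalIntegral.integral_const_mul, integral_bumpSum (by fun_prop) hsupp2, hcard]


/-- The packing construction underlying Lemma C.8: a Varshamov–Gilbert packing of smooth
probability densities on `[0,1]`. -/
theorem density_packing (β : ℕ) (hβ : 1 ≤ β) :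
    ∃ c : ℝ, 0 < c ∧ ∀ r : ℝ, 0 < r → ∃ k₀ : ℕ, ∀ k : ℕ, k₀ ≤ k →
      ∃ F : Finset (ℝ → ℝ),
        (2 : ℝ) ^ ((k : ℝ) / 8) ≤ (F.card : ℝ) ∧
        (∀ f ∈ F,
          (∀ i < β - 1, Differentiable ℝ (iteratedDeriv i f)) ∧
          (∀ x ∈ Set.Icc (0 : ℝ) 1, ∀ y ∈ Set.Icc (0 : ℝ) 1,
            |iteratedDeriv (β - 1) f x - iteratedDeriv (β - 1) f y|
              ≤ r * Real.pi ^ β * |x - y|) ∧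
          (∀ x ∈ Set.Icc (0 : ℝ) 1, 1 / 2 ≤ f x ∧ f x ≤ 3 / 2) ∧
          (∫ x in (0 : ℝ)..1, f x) = 1) ∧
        (∀ f ∈ F, ∀ g ∈ F, f ≠ g →
          c * r ^ 2 / (k : ℝ) ^ (2 * β) ≤ ∫ x in (0 : ℝ)..1, (f x - g x) ^ 2) := by
  classical
  obtain ⟨φ, hφ, hcomp, hts, hmean, hA⟩ := exists_mean_zero_bump
  have hcont : Continuous φ := (hφ 0).continuous
  have hsupp : support φ ⊆ Ioo 0 1 := (subset_tsupport _).trans hts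
  obtain ⟨M₀, hM₀⟩ := hcomp.exists_bound_of_continuous hcont
  obtain ⟨M₁, hM₁⟩ := (hcomp.mono' ((subset_tsupport _).trans
    (tsupport_iteratedDeriv_subset φ β))).exists_bound_of_continuous
      ((hφ β).continuous_iteratedDeriv β le_rfl)
  set A := ∫ x, φ x ^ 2
  set M := max 1 (max M₀ M₁)
  have hM : 0 < M := lt_of_lt_of_le one_pos (le_max_left _ _)
  have hφM : ∀ x, |φ x| ≤ M := fun x =>
    (hM₀ x).trans ((le_max_left _ _).trans (le_max_right _ _))
  have hdM : ∀ x, |iteratedDeriv β φ x| ≤ M := fun x =>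
    (hM₁ x).trans ((le_max_right _ _).trans (le_max_right _ _))
  refine ⟨(Real.pi ^ β / M) ^ 2 * A / 8, by positivity, fun r hr => ?_⟩
  obtain ⟨N, hN⟩ := exists_nat_ge (2 * r * Real.pi ^ β)
  refine ⟨N + 1, fun k hk => ?_⟩
  have hk1 : (1 : ℝ) ≤ k := by exact_mod_cast (by omega : 1 ≤ k)
  have hk0 : (0 : ℝ) < k := by linarith
  have hkN : 2 * r * Real.pi ^ β ≤ (k : ℝ) ^ β := by
    calc 2 * r * Real.pi ^ β ≤ N := hN
      _ ≤ k := by exact_mod_cast (by omega : N ≤ k)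
      _ ≤ (k : ℝ) ^ β := le_self_pow₀ hk1 (by omega)
  set a : ℝ := r * Real.pi ^ β / (M * k ^ β) with ha
  have ha0 : 0 < a := by positivity
  have hakM : a * k ^ β * M = r * Real.pi ^ β := by
    rw [ha]
    field_simp
  have haM : a * M ≤ 1 / 2 := by
    have : a * M = r * Real.pi ^ β / k ^ β := by
      rw [ha]
      field_simp
    rw [this, div_le_iff₀ (by positivity)]
    linarith
  obtain ⟨C, hcard, hsep⟩ := varshamov_gilbert k
  have hdist : ∀ S ∈ C, ∀ T ∈ C, S ≠ T →
      (Real.pi ^ β / M) ^ 2 * A / 8 * r ^ 2 / (k : ℝ) ^ (2 * β)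
        ≤ ∫ x in (0 : ℝ)..1, (perturbedDensity φ a S x - perturbedDensity φ a T x) ^ 2 := by
    intro S hS T hT hST
    rw [integral_sq_sub_perturbedDensity hcont hsupp]
    have h8 : 1 / 8 ≤ ((symmDiff S T).card : ℝ) / k := by
      rw [le_div_iff₀ hk0]
      linarith [hsep S hS T hT hST]
    calc (Real.pi ^ β / M) ^ 2 * A / 8 * r ^ 2 / (k : ℝ) ^ (2 * β) = a ^ 2 * (1 / 8 * A) := by
          rw [ha, pow_mul']
          field_simp
      _ ≤ _ := by gcongr
  have hinj : Set.InjOn (perturbedDensity φ a) (C : Set (Finset (Fin k))) := by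
    intro S hS T hT hST
    by_contra hne
    have h := hdist S hS T hT hne
    rw [hST] at h
    simp only [sub_self, ne_eq, OfNat.ofNat_ne_zero, not_false_eq_true, zero_pow,
      intervalIntegral.integral_zero] at h
    exact absurd h (not_le.2 (by positivity))
  refine ⟨C.image (perturbedDensity φ a), ?_, ?_, ?_⟩
  · rwa [Finset.card_image_of_injOn hinj]
  · intro f hf
    obtain ⟨S, -, rfl⟩ := Finset.mem_image.1 hf
    have hsmooth := contDiff_perturbedDensity (hφ β) a S
    refine ⟨fun i hi => hsmooth.differentiable_iteratedDeriv i (by exact_mod_cast (by omega)),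
      fun x _ y _ => ?_, fun x _ => ?_, integral_perturbedDensity hcont hsupp hmean a S⟩
    · have hd : Differentiable ℝ (iteratedDeriv (β - 1) (perturbedDensity φ a S)) :=
        hsmooth.differentiable_iteratedDeriv _ (by exact_mod_cast (by omega))
      have hbound : ∀ z ∈ (univ : Set ℝ),
          ‖deriv (iteratedDeriv (β - 1) (perturbedDensity φ a S)) z‖ ≤ r * Real.pi ^ β := by
        intro z _
        rw [← iteratedDeriv_succ, Nat.sub_add_cancel hβ, ← hakM]
        exact abs_iteratedDeriv_perturbedDensity_le hβ (hφ β) hts hdM ha0.le S z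
      exact convex_univ.norm_image_sub_le_of_norm_deriv_le (fun z _ => hd z) hbound
        (mem_univ y) (mem_univ x)
    · have h : |a * bumpSum φ (fun j => if j ∈ S then 1 else 0) x| ≤ 1 / 2 := by
        rw [abs_mul, abs_of_pos ha0]
        exact (mul_le_mul_of_nonneg_left (abs_bumpSum_le hsupp hφM (abs_indicator_le_one S) x)
          ha0.le).trans haM
      obtain ⟨h1, h2⟩ := abs_le.1 h
      unfold perturbedDensity
      constructor <;> linarith
  · intro f hf g hg hfg
    obtain ⟨S, hS, rfl⟩ := Finset.mem_image.1 hf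
    obtain ⟨T, hT, rfl⟩ := Finset.mem_image.1 hg
    exact hdist S hS T hT fun h => hfg (h ▸ rfl)
end

section
/- Lemma C.3 (Assouad's method restricted to a subfamily, in the corrected form established in its proof). Let k ≥ 1 be an integer and V = {−1,1}^k. Let (Θ, ρ) be a metric space with its Borel σ-algebra, let Φ : [0,∞) → [0,∞) be nondecreasing, let ϱ > 0, and let θ_v ∈ Θ (v ∈ V) satisfy the separation-with-equality condition Φ(ρ(θ_u, θ_v)/2) = 2·ϱ·|{j : u_j ≠ v_j}| for all u, v ∈ V. Let Ω be a measurable space, let (μ_v)_{v∈V} be probability measures on Ω, let w : V → [0,1] with Σ_{v∈V} w_v = 1, and let V* ⊆ V. Let θ̂ : Ω → Θ be measurable and let ψ : Ω → V be a measurable nearest-point selector, i.e. ρ(θ_{ψ(ω)}, θ̂(ω)) ≤ ρ(θ_v, θ̂(ω)) for all ω ∈ Ω and all v ∈ V. Then sup_{v ∈ V*} ∫ Φ(ρ(θ̂(ω), θ_v)) dμ_v(ω) ≥ Σ_{v∈V} w_v ∫ Φ(ρ(θ_{ψ(ω)}, θ_v)/2) dμ_v(ω) − 2·k·ϱ·Σ_{v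 ∉ V*} w_v. -/
open MeasureTheory Real
open scoped ENNReal

/-- Lemma C.3: Assouad's method restricted to a subfamily, in the corrected form
established in its proof.  The hypercube `{−1,1}^k` is encoded as `Fin k → Bool`. -/
theorem assouad_restricted
    (k : ℕ) (hk : 1 ≤ k)
    {Θ : Type*} [MetricSpace Θ] [MeasurableSpace Θ] [BorelSpace Θ]
    (Φ : ℝ → ℝ) (hΦmono : MonotoneOn Φ (Set.Ici 0)) (hΦnonneg : ∀ x : ℝ, 0 ≤ x → 0 ≤ Φ x)
    (ϱ : ℝ) (hϱ : 0 < ϱ)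
    (θ : (Fin k → Bool) → Θ)
    (hsep : ∀ u v : Fin k → Bool,
      Φ (dist (θ u) (θ v) / 2)
        = 2 * ϱ * ((Finset.univ.filter fun j => u j ≠ v j).card : ℝ))
    {Ω : Type*} [MeasurableSpace Ω]
    (μ : (Fin k → Bool) → Measure Ω) (hμ : ∀ v, IsProbabilityMeasure (μ v))
    (w : (Fin k → Bool) → ℝ) (hw0 : ∀ v, 0 ≤ w v) (hw1 : ∀ v, w v ≤ 1)
    (hwsum : ∑ v : Fin k → Bool, w v = 1)
    (Vstar : Finset (Fin k → Bool))
    (θhat : Ω → Θ) (hθhat : Measurable θhat)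
    (ψ : Ω → (Fin k → Bool)) (hψ : Measurable ψ)
    (hsel : ∀ ω : Ω, ∀ v : Fin k → Bool, dist (θ (ψ ω)) (θhat ω) ≤ dist (θ v) (θhat ω)) :
    (∑ v : Fin k → Bool, ENNReal.ofReal (w v) *
        ∫⁻ ω, ENNReal.ofReal (Φ (dist (θ (ψ ω)) (θ v) / 2)) ∂(μ v))
      ≤ (⨆ v ∈ Vstar, ∫⁻ ω, ENNReal.ofReal (Φ (dist (θhat ω) (θ v))) ∂(μ v))
        + ENNReal.ofReal (2 * (k : ℝ) * ϱ * ∑ v ∈ Finset.univ \ Vstar, w v) := by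
  have hclose : ∀ v ω, Φ (dist (θ (ψ ω)) (θ v) / 2) ≤ Φ (dist (θhat ω) (θ v)) := by
    intro v ω
    refine hΦmono (by simp only [Set.mem_Ici]; positivity) dist_nonneg ?_
    have h₁ := dist_triangle (θ (ψ ω)) (θhat ω) (θ v)
    have h₂ := hsel ω v
    rw [dist_comm (θ v)] at h₂
    linarith
  have hbound : ∀ u v, Φ (dist (θ u) (θ v) / 2) ≤ 2 * k * ϱ := by
    intro u v
    have hcard : ((Finset.univ.filter fun j => u j ≠ v j).card : ℝ) ≤ k := by
      exact_mod_cast (Finset.card_le_univ _).trans_eq (Fintype.card_fin k)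
    rw [hsep]
    nlinarith
  rw [← Finset.sum_sdiff (Finset.subset_univ Vstar), add_comm]
  refine add_le_add ?_ ?_
  · set S := ⨆ v ∈ Vstar, ∫⁻ ω, ENNReal.ofReal (Φ (dist (θhat ω) (θ v))) ∂(μ v)
    calc _ ≤ ∑ v ∈ Vstar, ENNReal.ofReal (w v) * S := by
          refine Finset.sum_le_sum fun v hv => mul_le_mul_right ?_ _
          exact (lintegral_mono fun ω => ENNReal.ofReal_le_ofReal (hclose v ω)).trans
            (le_iSup₂_of_le v hv le_rfl)
      _ = ENNReal.ofReal (∑ v ∈ Vstar, w v) * S := by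
          rw [← Finset.sum_mul, ENNReal.ofReal_sum_of_nonneg fun v _ => hw0 v]
      _ ≤ 1 * S := by
          refine mul_le_mul_left (ENNReal.ofReal_le_one.2 ?_) _
          rw [← hwsum]
          exact Finset.sum_le_sum_of_subset_of_nonneg (Finset.subset_univ _) fun v _ _ => hw0 v
      _ = S := one_mul S
  · rw [Finset.mul_sum, ENNReal.ofReal_sum_of_nonneg
      fun v _ => mul_nonneg (by positivity) (hw0 v)]
    refine Finset.sum_le_sum fun v _ => ?_
    rw [mul_comm (2 * (k : ℝ) * ϱ), ENNReal.ofReal_mul (hw0 v)]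
    refine mul_le_mul_right ?_ _
    calc _ ≤ ∫⁻ _, ENNReal.ofReal (2 * k * ϱ) ∂(μ v) :=
          lintegral_mono fun ω => ENNReal.ofReal_le_ofReal (hbound (ψ ω) v)
      _ = ENNReal.ofReal (2 * k * ϱ) := by
          have := hμ v
          simp
end
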